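/- arXiv:2604.28172 — 3 statements merged into one kernel-verified Lean document; each statement's English description precedes it below -/
import Mathlib

section
/- For every ε > 0 and every constant β > 0 there is a constant c' > 0 such that for all integers c, D, k, n with D ≤ 2 log n, 1 ≤ c ≤ ⌈log n⌉, and k ≤ β·D: if G ~ G(n,k,n^{−2/D}), then with probability tending to 1 as n → ∞, every semantic tree-like Frege refutation of the c-ary block clique formula bclique_c(G,k) in which every line is a Boolean formula of size at most n^{2−ε} has length at least n^{c'·D}. -/
open Finset

abbrev Vtx (k n : ℕ) := Fin k × Fin n
abbrev Tup (k n : ℕ) := Fin k → Fin n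

/-- Potential edges: pairs of vertices lying in distinct blocks. -/
def potEdges (k n : ℕ) : Finset (Sym2 (Vtx k n)) :=
  Finset.univ.filter fun e => ¬ (Sym2.map Prod.fst e).IsDiag

open Classical in
/-- The probability, under the distribution `G(n,k,p)` (each potential edge present
independently with probability `p`), that the sampled graph satisfies `P`. -/
noncomputable def probG (k n : ℕ) (p : ℝ) (P : Finset (Sym2 (Vtx k n)) → Prop) : ℝ :=
  ∑ G ∈ (potEdges k n).powerset,
    if P G then p ^ G.card * (1 - p) ^ ((potEdges k n).card - G.card) else 0

/-- The biased character `χ_E(G) = ∏_{e ∈ E} χ_e(G)`. -/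
noncomputable def chiE {k n : ℕ} (p : ℝ) (G E : Finset (Sym2 (Vtx k n))) : ℝ :=
  ∏ e ∈ E, if e ∈ G then (1 - p) / p else -1

/-- The edge of a tuple `t` joining its vertices in blocks `i` and `j`. -/
def tupEdge {k n : ℕ} (t : Tup k n) (i j : Fin k) : Sym2 (Vtx k n) := s((i, t i), (j, t j))

/-- `t` is a `k`-clique of `G`. -/
def IsClique {k n : ℕ} (G : Finset (Sym2 (Vtx k n))) (t : Tup k n) : Prop :=
  ∀ i j : Fin k, i ≠ j → tupEdge t i j ∈ G

/-- `S` is a vertex cover of the graph `H` on `[k]`. -/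
def IsCover {k : ℕ} (H : Finset (Sym2 (Fin k))) (S : Finset (Fin k)) : Prop :=
  ∀ e ∈ H, ∃ v ∈ S, v ∈ e

/-- Minimum vertex cover size. -/
noncomputable def vc {k : ℕ} (H : Finset (Sym2 (Fin k))) : ℕ :=
  sInf {m | ∃ S : Finset (Fin k), S.card = m ∧ IsCover H S}

/-- The graph `H(t)` on the vertices of the tuple `t` obtained from a graph `H` on `[k]`. -/
def graphOf {k n : ℕ} (H : Finset (Sym2 (Fin k))) (t : Tup k n) : Finset (Sym2 (Vtx k n)) :=
  H.image (Sym2.map fun i => (i, t i))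

open Classical in
/-- The pseudo-measure `μ_{G,d}` on a single tuple. -/
noncomputable def mu {k n : ℕ} (p : ℝ) (G : Finset (Sym2 (Vtx k n))) (d : ℝ) (t : Tup k n) : ℝ :=
  ((n : ℝ) ^ k)⁻¹ *
    ∑ H ∈ Finset.univ.filter
        (fun H : Finset (Sym2 (Fin k)) => (∀ e ∈ H, ¬ e.IsDiag) ∧ (vc H : ℝ) ≤ d),
      chiE p G (graphOf H t)

/-- The pseudo-measure `μ_{G,d}` on a set of tuples. -/
noncomputable def muSet {k n : ℕ} (p : ℝ) (G : Finset (Sym2 (Vtx k n))) (d : ℝ)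
    (Q : Finset (Tup k n)) : ℝ :=
  ∑ t ∈ Q, mu p G d t

/-- `Q` is ruled out by a missing edge: some potential edge `e ∉ E(G)` satisfies `e ⊆ t`
for every `t ∈ Q`. -/
def RuledOut {k n : ℕ} (G : Finset (Sym2 (Vtx k n))) (Q : Finset (Tup k n)) : Prop :=
  ∃ e ∈ potEdges k n, e ∉ G ∧ ∀ t ∈ Q, ∀ u ∈ e, t u.1 = u.2


/-- A Boolean function on `N` variables, viewed as the indicator of the set of
assignments it rules out. -/
abbrev BFunc (N : ℕ) := (Fin N → Bool) → Bool

/-- A clause over `N` Boolean variables: a disjunction of literals over distinct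
variables, recorded by the polarity (if any) of each variable. -/
abbrev Clause (N : ℕ) := Fin N → Option Bool

/-- The assignment `α` satisfies the clause `c`. -/
def clauseSat {N : ℕ} (c : Clause N) (α : Fin N → Bool) : Prop :=
  ∃ i b, c i = some b ∧ α i = b

/-- The indicator of the falsifying assignments of the clause `c`. -/
def falsInd {N : ℕ} (c : Clause N) : BFunc N :=
  fun α => decide (∀ i b, c i = some b → α i ≠ b)

/-- A tree-like semantic proof: a tree each of whose nodes is labelled with a Boolean
function and has at most two children. -/
inductive SemProof (N : ℕ) : Type
  | leaf : BFunc N → SemProof N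
  | node1 : BFunc N → SemProof N → SemProof N
  | node2 : BFunc N → SemProof N → SemProof N → SemProof N

namespace SemProof

/-- The function labelling the root. -/
def root {N : ℕ} : SemProof N → BFunc N
  | leaf f => f
  | node1 f _ => f
  | node2 f _ _ => f

/-- The length of a tree-like proof: its number of lines. -/
def length {N : ℕ} : SemProof N → ℕ
  | leaf _ => 1
  | node1 _ s => s.length + 1
  | node2 _ s t => s.length + t.length + 1

/-- A valid tree-like `sem(F)` derivation from the CNF formula `A`: every line either is
the indicator of the falsifying assignments of a clause of `A`, or belongs to `F` and is
semantically implied by its (at most two) premises. -/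
def Valid {N : ℕ} (F : Set (BFunc N)) (A : Finset (Clause N)) : SemProof N → Prop
  | leaf f => ∃ c ∈ A, f = falsInd c
  | node1 f s => ((∃ c ∈ A, f = falsInd c) ∨
      (f ∈ F ∧ ∀ α, f α = true → s.root α = true)) ∧ Valid F A s
  | node2 f s t => ((∃ c ∈ A, f = falsInd c) ∨
      (f ∈ F ∧ ∀ α, f α = true → s.root α = true ∨ t.root α = true)) ∧
      Valid F A s ∧ Valid F A t

end SemProof

/-- A tree-like `sem(F)` refutation of `A`: a valid derivation whose final line is the
constant-`1` function (ruling out every assignment, i.e. contradiction). -/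
def IsRefutation {N : ℕ} (F : Set (BFunc N)) (A : Finset (Clause N)) (π : SemProof N) : Prop :=
  SemProof.Valid F A π ∧ ∀ α, π.root α = true

/-- A tree-like `sem(F)` derivation of the function `g` from `A`. -/
def IsDerivation {N : ℕ} (F : Set (BFunc N)) (A : Finset (Clause N)) (π : SemProof N)
    (g : BFunc N) : Prop :=
  SemProof.Valid F A π ∧ π.root = g


/-- Boolean formulas over the connectives `∧`, `∨`, `¬` and variables `Fin N`. -/
inductive BFormula (N : ℕ) : Type
  | var : Fin N → BFormula N
  | not : BFormula N → BFormula N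
  | and : BFormula N → BFormula N → BFormula N
  | or : BFormula N → BFormula N → BFormula N

namespace BFormula

/-- The size of a Boolean formula. -/
def size {N : ℕ} : BFormula N → ℕ
  | var _ => 1
  | not φ => φ.size + 1
  | and φ ψ => φ.size + ψ.size + 1
  | or φ ψ => φ.size + ψ.size + 1

/-- Evaluation of a Boolean formula. -/
def eval {N : ℕ} (α : Fin N → Bool) : BFormula N → Bool
  | var i => α i
  | not φ => !(eval α φ)
  | and φ ψ => eval α φ && eval α ψ
  | or φ ψ => eval α φ || eval α ψ

end BFormula

/-- The lines of semantic Frege with line size `s`: Boolean functions that are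
(indicators of the falsifying assignments of) Boolean formulas of size at most `s`. -/
def FregeLines (N : ℕ) (s : ℝ) : Set (BFunc N) :=
  {f | ∃ φ : BFormula N, (φ.size : ℝ) ≤ s ∧ ∀ α, f α = !(φ.eval α)}

/-- The `j`-th `m`-ary digit of a vertex `v ∈ Fin (m^c)`. -/
def digit {m c : ℕ} (v : Fin (m ^ c)) (j : Fin c) : Fin m :=
  finFunctionFinEquiv.symm v j

open Classical in
/-- The `c`-ary block clique formula `bclique_c(G,k)` (here `n = m^c`), a CNF formula
over the variables `{x_{i,j,a} : i ∈ [k], j ∈ [c], a ∈ {0,…,m−1}}`: edge axioms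
`C_u ∨ C_v` for every pair of vertices in distinct blocks with `{u,v} ∉ E(G)`, where
`C_{v_{i,α}} = ∨_j ¬x_{i,j,α_j}`, and range axioms `∨_a x_{i,j,a}`. -/
noncomputable def bcliqueC (k m c : ℕ) (G : Finset (Sym2 (Vtx k (m ^ c)))) :
    Finset (Clause (k * (c * m))) :=
  ((Finset.univ.filter fun q : Vtx k (m ^ c) × Vtx k (m ^ c) =>
      q.1.1 ≠ q.2.1 ∧ s(q.1, q.2) ∉ G).image
    fun q => (fun w =>
      let p := finProdFinEquiv.symm w
      let jc := finProdFinEquiv.symm p.2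
      if p.1 = q.1.1 ∧ digit q.1.2 jc.1 = jc.2 then some false
      else if p.1 = q.2.1 ∧ digit q.2.2 jc.1 = jc.2 then some false
      else none : Clause (k * (c * m)))) ∪
  (Finset.univ.image fun ij : Fin k × Fin c =>
    (fun w =>
      let p := finProdFinEquiv.symm w
      let jc := finProdFinEquiv.symm p.2
      if p.1 = ij.1 ∧ jc.1 = ij.2 then some true else none : Clause (k * (c * m))))

/-! ## Greedy matchings (cores) -/
namespace TF

def tch {k : ℕ} (a b : Sym2 (Fin k)) : Prop := ∃ v, v ∈ a ∧ v ∈ b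

lemma tch_symm {k : ℕ} {a b : Sym2 (Fin k)} (h : tch a b) : tch b a := by
  obtain ⟨v, h1, h2⟩ := h
  exact ⟨v, h2, h1⟩

lemma tch_refl {k : ℕ} (a : Sym2 (Fin k)) : tch a a := by
  induction a with
  | h x y => exact ⟨x, by simp, by simp⟩

noncomputable def rk {k : ℕ} (a : Sym2 (Fin k)) : ℕ := (Fintype.equivFin (Sym2 (Fin k)) a : ℕ)

lemma rk_inj {k : ℕ} {a b : Sym2 (Fin k)} (h : rk a = rk b) : a = b := by
  unfold rk at h
  exact (Fintype.equivFin _).injective (Fin.ext h)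

open Classical in
noncomputable def UU {k : ℕ} (M : Finset (Sym2 (Fin k))) : Finset (Sym2 (Fin k)) :=
  univ.filter fun h => h ∈ M ∨ ∃ m ∈ M, rk m < rk h ∧ tch m h

def IsMat {k : ℕ} (M : Finset (Sym2 (Fin k))) : Prop :=
  ∀ a ∈ M, ∀ b ∈ M, a ≠ b → ¬ tch a b

def IsCore {k : ℕ} (M H : Finset (Sym2 (Fin k))) : Prop :=
  IsMat M ∧ M ⊆ H ∧ H ⊆ UU M

lemma mem_UU {k : ℕ} {M : Finset (Sym2 (Fin k))} {h : Sym2 (Fin k)} :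
    h ∈ UU M ↔ h ∈ M ∨ ∃ m ∈ M, rk m < rk h ∧ tch m h := by
  simp [UU]

lemma exists_core {k : ℕ} (H : Finset (Sym2 (Fin k))) : ∃ M, IsCore M H := by
  classical
  induction H using Finset.induction_on_max_value rk with
  | empty => exact ⟨∅, by intro a ha; simp at ha, by simp, by simp⟩
  | insert a s has hmax ih =>
    obtain ⟨M, hM, hMs, hsU⟩ := ih
    have hlt : ∀ x ∈ s, rk x < rk a := by
      intro x hx
      refine lt_of_le_of_ne (hmax x hx) ?_
      intro h
      exact has (rk_inj h ▸ hx)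
    by_cases hh : ∃ m ∈ M, tch m a
    · refine ⟨M, hM, hMs.trans (subset_insert _ _), ?_⟩
      intro x hx
      rcases mem_insert.1 hx with rfl | hx
      · obtain ⟨m, hm, hmx⟩ := hh
        exact mem_UU.2 (Or.inr ⟨m, hm, hlt m (hMs hm), hmx⟩)
      · exact hsU hx
    · push Not at hh
      refine ⟨insert a M, ?_, insert_subset_insert _ hMs, ?_⟩
      · intro x hx y hy hxy
        rcases mem_insert.1 hx with hx1 | hx1 <;> rcases mem_insert.1 hy with hy1 | hy1
        · exact absurd (hx1.trans hy1.symm) hxy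
        · exact fun h => hh y hy1 (hx1 ▸ tch_symm h)
        · exact hy1 ▸ hh x hx1
        · exact hM x hx1 y hy1 hxy
      · intro x hx
        rcases mem_insert.1 hx with rfl | hx
        · exact mem_UU.2 (Or.inl (mem_insert_self _ _))
        · rcases mem_UU.1 (hsU hx) with h | ⟨m, hm, h⟩
          · exact mem_UU.2 (Or.inl (mem_insert_of_mem h))
          · exact mem_UU.2 (Or.inr ⟨m, mem_insert_of_mem hm, h⟩)

lemma core_unique {k : ℕ} {H M₁ M₂ : Finset (Sym2 (Fin k))} (h₁ : IsCore M₁ H)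
    (h₂ : IsCore M₂ H) : M₁ = M₂ := by
  have key : ∀ N : ℕ, ∀ h : Sym2 (Fin k), rk h = N → (h ∈ M₁ ↔ h ∈ M₂) := by
    intro N
    induction N using Nat.strong_induction_on with
    | _ N ih =>
      have aux : ∀ A B : Finset (Sym2 (Fin k)), IsCore A H → IsCore B H →
          (∀ n < N, ∀ h : Sym2 (Fin k), rk h = n → (h ∈ A ↔ h ∈ B)) →
          ∀ h : Sym2 (Fin k), rk h = N → h ∈ A → h ∈ B := by
        intro A B hA hB ih h hh hhA
        rcases mem_UU.1 (hB.2.2 (hA.2.1 hhA)) with h' | ⟨m, hm, hlt, ht⟩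
        · exact h'
        · exfalso
          have hmA := (ih (rk m) (hh ▸ hlt) m rfl).2 hm
          refine hA.1 m hmA h hhA ?_ ht
          rintro rfl
          exact lt_irrefl _ hlt
      intro h hh
      exact ⟨aux M₁ M₂ h₁ h₂ ih h hh,
        aux M₂ M₁ h₂ h₁ (fun n hn h hh => (ih n hn h hh).symm) h hh⟩
  ext h
  exact key _ h rfl

noncomputable def core {k : ℕ} (H : Finset (Sym2 (Fin k))) : Finset (Sym2 (Fin k)) :=
  (exists_core H).choose

lemma core_spec {k : ℕ} (H : Finset (Sym2 (Fin k))) : IsCore (core H) H :=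
  (exists_core H).choose_spec

lemma core_eq_iff {k : ℕ} {H M : Finset (Sym2 (Fin k))} : core H = M ↔ IsCore M H :=
  ⟨fun h => h ▸ core_spec H, fun h => core_unique (core_spec H) h⟩

open Classical in
noncomputable def VV {k : ℕ} (M : Finset (Sym2 (Fin k))) : Finset (Fin k) :=
  univ.filter fun v => ∃ m ∈ M, v ∈ m

lemma mem_VV {k : ℕ} {M : Finset (Sym2 (Fin k))} {v : Fin k} :
    v ∈ VV M ↔ ∃ m ∈ M, v ∈ m := by simp [VV]

lemma card_VV {k : ℕ} (M : Finset (Sym2 (Fin k))) : (VV M).card ≤ 2 * M.card := by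
  classical
  have : VV M = M.biUnion (fun m => m.toFinset) := by
    ext v
    simp [mem_VV]
  rw [this, mul_comm]
  refine card_biUnion_le_card_mul _ _ _ ?_
  intro m _
  rw [Sym2.card_toFinset]
  split_ifs <;> omega

lemma card_mat_le {k : ℕ} {M N : Finset (Sym2 (Fin k))} (hM : IsMat M)
    (h : ∀ a ∈ M, ∃ b ∈ N, tch b a) : M.card ≤ 2 * N.card := by
  classical
  refine le_trans ?_ (card_VV N)
  have h' : ∀ a ∈ M, ∃ v ∈ VV N, v ∈ a := by
    intro a ha
    obtain ⟨b, hb, v, h1, h2⟩ := h a ha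
    exact ⟨v, mem_VV.2 ⟨b, hb, h1⟩, h2⟩
  rcases M.eq_empty_or_nonempty with rfl | ⟨a0, ha0⟩
  · simp
  have : Nonempty (Fin k) := ⟨(h' a0 ha0).choose⟩
  choose! f hf using h'
  refine card_le_card_of_injOn f (fun a ha => (hf a ha).1) ?_
  intro a ha b hb hab
  by_contra hne
  exact hM a ha b hb hne ⟨f a, (hf a ha).2, hab ▸ (hf b hb).2⟩

lemma core_touch {k : ℕ} {M H : Finset (Sym2 (Fin k))} (h : IsCore M H) {a : Sym2 (Fin k)}
    (ha : a ∈ H) : ∃ b ∈ M, tch b a := by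
  rcases mem_UU.1 (h.2.2 ha) with h | ⟨m, hm, _, ht⟩
  · exact ⟨a, h, tch_refl a⟩
  · exact ⟨m, hm, ht⟩

lemma sum_interval {ι : Type*} [DecidableEq ι] (A B : Finset ι) (hAB : Disjoint A B)
    (z : ι → ℝ) :
    ∑ H ∈ (A ∪ B).powerset with A ⊆ H, ∏ s ∈ H, z s
      = (∏ s ∈ A, z s) * ∏ s ∈ B, (1 + z s) := by
  rw [Finset.prod_one_add, mul_sum]
  symm
  refine Finset.sum_nbij' (fun S => A ∪ S) (fun H => H \ A) ?_ ?_ ?_ ?_ ?_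
  · intro S hS
    simp only [mem_filter, mem_powerset] at hS ⊢
    exact ⟨union_subset_union_right hS, subset_union_left⟩
  · intro H hH
    simp only [mem_filter, mem_powerset] at hH ⊢
    intro x hx
    have := mem_sdiff.1 hx
    rcases mem_union.1 (hH.1 this.1) with h | h
    · exact absurd h this.2
    · exact h
  · intro S hS
    have hd : Disjoint A S := hAB.mono_right (mem_powerset.1 hS)
    rw [union_sdiff_left]
    exact sdiff_eq_self_of_disjoint hd.symm
  · intro H hH
    simp only [mem_filter, mem_powerset] at hH
    exact union_sdiff_of_subset hH.2
  · intro S hS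
    have hd : Disjoint A S := hAB.mono_right (mem_powerset.1 hS)
    rw [prod_union hd]

/-- All slots. -/
noncomputable def EE (k : ℕ) : Finset (Sym2 (Fin k)) := univ.filter fun e => ¬ e.IsDiag

noncomputable def Pfun {k : ℕ} (r : ℕ) (z : Sym2 (Fin k) → ℝ) : ℝ :=
  ∑ H ∈ (EE k).powerset with (core H).card ≤ r, ∏ s ∈ H, z s

open Classical in
lemma Pfun_eq {k : ℕ} (r : ℕ) (z : Sym2 (Fin k) → ℝ) :
    Pfun r z = ∑ M ∈ (EE k).powerset with (IsMat M ∧ M.card ≤ r),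
      (∏ s ∈ M, z s) * ∏ s ∈ (UU M ∩ EE k) \ M, (1 + z s) := by
  unfold Pfun
  rw [← Finset.sum_fiberwise_of_maps_to (g := core)
    (t := (EE k).powerset.filter fun M => IsMat M ∧ M.card ≤ r)]
  · refine sum_congr rfl fun M hM => ?_
    simp only [mem_filter, mem_powerset] at hM
    rw [← sum_interval _ _ disjoint_sdiff]
    refine sum_congr ?_ fun _ _ => rfl
    ext H
    simp only [mem_filter, mem_powerset, core_eq_iff]
    have hMU : M ⊆ UU M ∩ EE k := fun x hx => mem_inter.2 ⟨mem_UU.2 (Or.inl hx), hM.1 hx⟩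
    rw [union_sdiff_of_subset hMU]
    constructor
    · rintro ⟨⟨h1, h2⟩, h3⟩
      exact ⟨subset_inter h3.2.2 h1, h3.2.1⟩
    · rintro ⟨h1, h2⟩
      have hc : IsCore M H := ⟨hM.2.1, h2, h1.trans inter_subset_left⟩
      refine ⟨⟨h1.trans inter_subset_right, ?_⟩, hc⟩
      rw [core_eq_iff.2 hc]
      exact hM.2.2
  · intro H hH
    simp only [mem_filter, mem_powerset] at hH ⊢
    exact ⟨(core_spec H).2.1.trans hH.1, (core_spec H).1, hH.2⟩

noncomputable def AA {k : ℕ} (e : Sym2 (Fin k)) (q : Finset (Sym2 (Fin k)) × Finset (Sym2 (Fin k))) :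
    Finset (Sym2 (Fin k)) := q.1 ∪ q.2.erase e

noncomputable def BB {k : ℕ} (e : Sym2 (Fin k)) (q : Finset (Sym2 (Fin k)) × Finset (Sym2 (Fin k))) :
    Finset (Sym2 (Fin k)) := ((UU q.1 ∩ UU q.2 ∩ EE k) \ AA e q).erase e

open Classical in
lemma Pfun_missing {k : ℕ} (r : ℕ) (hr : 1 ≤ r) (e : Sym2 (Fin k)) (he : e ∈ EE k) :
    ∃ Q : Finset (Finset (Sym2 (Fin k)) × Finset (Sym2 (Fin k))),
    ∃ coef : Finset (Sym2 (Fin k)) × Finset (Sym2 (Fin k)) → ℝ,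
      (∀ q ∈ Q, |coef q| ≤ 1 ∧ q.1 ⊆ EE k ∧ q.2 ⊆ EE k ∧ IsMat q.1 ∧ IsMat q.2 ∧
        q.1.card + q.2.card ≤ 4 * r ∧ e ∉ q.1 ∧ (r < q.1.card ∨ r < q.2.card)) ∧
      ∀ z : Sym2 (Fin k) → ℝ, z e = -1 →
        Pfun r z = ∑ q ∈ Q, coef q * ((∏ s ∈ AA e q, z s) * ∏ s ∈ BB e q, (1 + z s)) := by
  set cf : Finset (Sym2 (Fin k)) × Finset (Sym2 (Fin k)) → ℝ :=
    fun q => (if q.1.card ≤ r then 1 else 0) - (if q.2.card ≤ r then 1 else 0) with hcf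
  set pr : Finset (Sym2 (Fin k)) → Finset (Sym2 (Fin k)) × Finset (Sym2 (Fin k)) :=
    fun H => (core H, core (insert e H)) with hpr
  set Q0 := ((EE k).erase e).powerset.image pr with hQ0
  refine ⟨Q0.filter fun q => cf q ≠ 0, cf, ?_, ?_⟩
  · intro q hq
    obtain ⟨hq, hne⟩ := mem_filter.1 hq
    obtain ⟨H, hH, rfl⟩ := mem_image.1 hq
    have hHE := mem_powerset.1 hH
    have h1 := core_spec H
    have h2 := core_spec (insert e H)
    have hHE' : insert e H ⊆ EE k := insert_subset he (hHE.trans (erase_subset _ _))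
    have c1 : (core H).card ≤ 2 * (core (insert e H)).card :=
      card_mat_le h1.1 fun a ha => core_touch h2 (mem_insert_of_mem (h1.2.1 ha))
    have c2 : ((core (insert e H)).erase e).card ≤ 2 * (core H).card := by
      refine card_mat_le ?_ ?_
      · intro a ha b hb
        exact h2.1 a (mem_of_mem_erase ha) b (mem_of_mem_erase hb)
      · intro a ha
        refine core_touch h1 ?_
        have := h2.2.1 (mem_of_mem_erase ha)
        exact (mem_insert.1 this).resolve_left (ne_of_mem_erase ha)
    have c3 : (core (insert e H)).card ≤ ((core (insert e H)).erase e).card + 1 := by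
      have := Finset.pred_card_le_card_erase (s := core (insert e H)) (a := e)
      omega
    refine ⟨?_, h1.2.1.trans (hHE.trans (erase_subset _ _)), h2.2.1.trans hHE', h1.1, h2.1,
      ?_, ?_, ?_⟩
    · simp only [hcf]
      split_ifs <;> norm_num
    · simp only [hcf, hpr] at hne ⊢
      split_ifs at hne <;> first | (exfalso; simp at hne; done) | omega
    · intro h
      exact (mem_erase.1 (hHE (h1.2.1 h))).1 rfl
    · simp only [hcf, hpr] at hne ⊢
      split_ifs at hne <;> first | (exfalso; simp at hne; done) | omega
  · intro z hz
    have hE : EE k = insert e ((EE k).erase e) := (insert_erase he).symm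
    have step1 : Pfun r z = ∑ H ∈ ((EE k).erase e).powerset, cf (pr H) * ∏ s ∈ H, z s := by
      unfold Pfun
      rw [sum_filter, hE, Finset.sum_powerset_insert (notMem_erase _ _), ← sum_add_distrib]
      refine sum_congr (by simp) fun H hH => ?_
      have heH : e ∉ H := fun h => (mem_erase.1 (mem_powerset.1 hH h)).1 rfl
      rw [prod_insert heH, hz]
      simp only [hcf, hpr]
      split_ifs <;> ring
    rw [step1, ← Finset.sum_fiberwise_of_maps_to (g := pr) (t := Q0)
      (fun H hH => mem_image_of_mem _ hH), sum_filter]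
    refine sum_congr rfl fun q hq => ?_
    have e1 : ∑ H ∈ ((EE k).erase e).powerset with pr H = q, cf (pr H) * ∏ s ∈ H, z s
        = cf q * ∑ H ∈ ((EE k).erase e).powerset with pr H = q, ∏ s ∈ H, z s := by
      rw [mul_sum]
      refine sum_congr rfl fun H hH => ?_
      rw [(mem_filter.1 hH).2]
    rw [e1]
    split_ifs with h0
    swap
    · push Not at h0
      rw [h0, zero_mul]
    congr 1
    have hdis : Disjoint (AA e q) (BB e q) := by
      unfold BB
      exact (disjoint_sdiff.mono_right (erase_subset _ _))
    rw [← sum_interval _ _ hdis]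
    refine sum_congr ?_ fun _ _ => rfl
    obtain ⟨H0, hH0, rfl⟩ := mem_image.1 hq
    have hH0E := mem_powerset.1 hH0
    have heH0 : e ∉ H0 := fun h => (mem_erase.1 (hH0E h)).1 rfl
    have h1 := core_spec H0
    have h2 := core_spec (insert e H0)
    ext H
    simp only [mem_filter, mem_powerset, hpr, Prod.mk.injEq, core_eq_iff]
    have hA : ∀ x, x ∈ AA e (core H0, core (insert e H0)) ↔
        x ∈ core H0 ∨ (x ≠ e ∧ x ∈ core (insert e H0)) := by
      intro x; simp [AA]
    have hB : ∀ x, x ∈ BB e (core H0, core (insert e H0)) ↔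
        x ≠ e ∧ (x ∈ UU (core H0) ∧ x ∈ UU (core (insert e H0)) ∧ x ∈ EE k) ∧
          ¬ x ∈ AA e (core H0, core (insert e H0)) := by
      intro x; simp [BB, and_assoc]
    have hA0 : ∀ x, x ∈ AA e (core H0, core (insert e H0)) → x ∈ H0 := by
      intro x hx
      rcases (hA x).1 hx with h | ⟨h, h'⟩
      · exact h1.2.1 h
      · exact (mem_insert.1 (h2.2.1 h')).resolve_left h
    constructor
    · rintro ⟨hHE, hc1, hc2⟩
      constructor
      · intro x hx
        rw [mem_union]
        by_cases hxA : x ∈ AA e (core H0, core (insert e H0))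
        · exact Or.inl hxA
        · right
          have := mem_erase.1 (hHE hx)
          exact (hB x).2 ⟨this.1, ⟨hc1.2.2 hx, hc2.2.2 (mem_insert_of_mem hx), this.2⟩, hxA⟩
      · intro x hx
        rcases (hA x).1 hx with h | ⟨h, h'⟩
        · exact hc1.2.1 h
        · exact (mem_insert.1 (hc2.2.1 h')).resolve_left h
    · rintro ⟨hHu, hAH⟩
      have hx0 : ∀ x ∈ H, x ≠ e ∧ x ∈ UU (core H0) ∧ x ∈ UU (core (insert e H0)) ∧ x ∈ EE k := by
        intro x hx
        rcases mem_union.1 (hHu hx) with h | h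
        · have h' := hA0 x h
          have h'' := mem_erase.1 (hH0E h')
          exact ⟨h''.1, h1.2.2 h', h2.2.2 (mem_insert_of_mem h'), h''.2⟩
        · have := (hB x).1 h
          exact ⟨this.1, this.2.1⟩
      refine ⟨?_, ⟨h1.1, ?_, ?_⟩, ⟨h2.1, ?_, ?_⟩⟩
      · intro x hx
        exact mem_erase.2 ⟨(hx0 x hx).1, (hx0 x hx).2.2.2⟩
      · intro x hx
        exact hAH ((hA x).2 (Or.inl hx))
      · intro x hx
        exact (hx0 x hx).2.1
      · intro x hx
        by_cases hxe : x = e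
        · exact hxe ▸ mem_insert_self _ _
        · exact mem_insert_of_mem (hAH ((hA x).2 (Or.inr ⟨hxe, hx⟩)))
      · intro x hx
        rcases mem_insert.1 hx with rfl | hx
        · exact h2.2.2 (mem_insert_self _ _)
        · exact (hx0 x hx).2.2.1

end TF

/-! ## Elementary product probability -/
namespace TF

set_option linter.unusedSectionVars false

section prob
variable {α : Type*} [DecidableEq α]

noncomputable def Ex (P : Finset α) (p : ℝ) (F : Finset α → ℝ) : ℝ :=
  ∑ G ∈ P.powerset, p ^ G.card * (1 - p) ^ (P.card - G.card) * F G

open Classical in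
noncomputable def Pr (P : Finset α) (p : ℝ) (S : Finset α → Prop) : ℝ :=
  Ex P p (fun G => if S G then 1 else 0)

lemma wt_nonneg {p : ℝ} (h0 : 0 ≤ p) (h1 : p ≤ 1) (a b : ℕ) : 0 ≤ p ^ a * (1 - p) ^ b :=
  mul_nonneg (pow_nonneg h0 _) (pow_nonneg (by linarith) _)

lemma Ex_mono {P : Finset α} {p : ℝ} (h0 : 0 ≤ p) (h1 : p ≤ 1) {F F' : Finset α → ℝ}
    (h : ∀ G ⊆ P, F G ≤ F' G) : Ex P p F ≤ Ex P p F' :=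
  sum_le_sum fun G hG => mul_le_mul_of_nonneg_left (h G (mem_powerset.1 hG)) (wt_nonneg h0 h1 _ _)

lemma Ex_const (P : Finset α) (p : ℝ) (a : ℝ) : Ex P p (fun _ => a) = a := by
  unfold Ex
  rw [← sum_mul, Finset.sum_pow_mul_eq_add_pow]
  simp

lemma Ex_mul (P : Finset α) (p : ℝ) (a : ℝ) (F : Finset α → ℝ) :
    Ex P p (fun G => a * F G) = a * Ex P p F := by
  unfold Ex
  rw [mul_sum]
  exact sum_congr rfl fun _ _ => by ring

lemma Ex_add (P : Finset α) (p : ℝ) (F F' : Finset α → ℝ) :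
    Ex P p (fun G => F G + F' G) = Ex P p F + Ex P p F' := by
  unfold Ex
  rw [← sum_add_distrib]
  exact sum_congr rfl fun _ _ => by ring

lemma Ex_sum {ι : Type*} (P : Finset α) (p : ℝ) (I : Finset ι) (F : ι → Finset α → ℝ) :
    Ex P p (fun G => ∑ i ∈ I, F i G) = ∑ i ∈ I, Ex P p (F i) := by
  unfold Ex
  rw [sum_comm]
  exact sum_congr rfl fun _ _ => by rw [mul_sum]

lemma Ex_prod (P : Finset α) (p : ℝ) (a b : α → ℝ) :
    Ex P p (fun G => ∏ e ∈ P, if e ∈ G then a e else b e)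
      = ∏ e ∈ P, (p * a e + (1 - p) * b e) := by
  rw [Finset.prod_add]
  unfold Ex
  refine sum_congr rfl fun G hG => ?_
  have hG := mem_powerset.1 hG
  rw [prod_mul_distrib, prod_mul_distrib, prod_const, prod_const, card_sdiff_of_subset hG]
  have : ∏ e ∈ P, (if e ∈ G then a e else b e) = (∏ e ∈ G, a e) * ∏ e ∈ P \ G, b e := by
    rw [← prod_sdiff hG, mul_comm]
    congr 1
    · exact prod_congr rfl fun e he => by simp [he]
    · exact prod_congr rfl fun e he => by simp [(mem_sdiff.1 he).2]
  beta_reduce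
  rw [this]
  ring

lemma Ex_split (P P0 : Finset α) (hP : P0 ⊆ P) (p : ℝ) (F : Finset α → ℝ) :
    Ex P p F = Ex (P \ P0) p (fun G1 => Ex P0 p (fun G0 => F (G1 ∪ G0))) := by
  unfold Ex
  simp_rw [mul_sum]
  rw [← sum_product']
  symm
  refine Finset.sum_nbij' (fun q => q.1 ∪ q.2) (fun G => (G \ P0, G ∩ P0)) ?_ ?_ ?_ ?_ ?_
  · intro q hq
    simp only [mem_product, mem_powerset] at hq ⊢
    exact union_subset (hq.1.trans sdiff_subset) (hq.2.trans hP)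
  · intro G hG
    simp only [mem_product, mem_powerset] at hG ⊢
    exact ⟨sdiff_subset_sdiff hG le_rfl, inter_subset_right⟩
  · rintro ⟨G1, G0⟩ hq
    simp only [mem_product, mem_powerset] at hq
    have h1 : ∀ x ∈ G1, x ∉ P0 := fun x hx => (mem_sdiff.1 (hq.1 hx)).2
    have h2 : ∀ x ∈ G0, x ∈ P0 := fun x hx => hq.2 hx
    ext x
    · simp only [mem_sdiff, mem_union]
      constructor
      · rintro ⟨h | h, h'⟩
        · exact h
        · exact absurd (h2 x h) h'
      · exact fun h => ⟨Or.inl h, h1 x h⟩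
    · simp only [mem_inter, mem_union]
      constructor
      · rintro ⟨h | h, h'⟩
        · exact absurd h' (h1 x h)
        · exact h
      · exact fun h => ⟨Or.inr h, h2 x h⟩
  · intro G _
    exact sdiff_union_inter G P0
  · rintro ⟨G1, G0⟩ hq
    simp only [mem_product, mem_powerset] at hq
    have hd : Disjoint G1 G0 := disjoint_of_subset_left hq.1
      (disjoint_of_subset_right hq.2 sdiff_disjoint)
    simp only
    rw [card_union_of_disjoint hd]
    have e1 := card_sdiff_add_card_eq_card hP
    have e2 := card_le_card hq.1
    have e3 := card_le_card hq.2
    have : P.card - (G1.card + G0.card) = ((P \ P0).card - G1.card) + (P0.card - G0.card) := by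
      omega
    rw [this, pow_add, pow_add]
    ring

lemma Pr_nonneg {P : Finset α} {p : ℝ} (h0 : 0 ≤ p) (h1 : p ≤ 1) (S : Finset α → Prop) :
    0 ≤ Pr P p S := by
  unfold Pr
  refine (Ex_const P p 0).symm.le.trans ?_
  refine Ex_mono h0 h1 fun G _ => ?_
  split_ifs <;> norm_num

lemma Pr_mono {P : Finset α} {p : ℝ} (h0 : 0 ≤ p) (h1 : p ≤ 1) {S S' : Finset α → Prop}
    (h : ∀ G ⊆ P, S G → S' G) : Pr P p S ≤ Pr P p S' := by
  unfold Pr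
  refine Ex_mono h0 h1 fun G hG => ?_
  have := h G hG
  split_ifs <;> first | (norm_num; done) | tauto

lemma Pr_or {P : Finset α} {p : ℝ} (h0 : 0 ≤ p) (h1 : p ≤ 1) (S S' : Finset α → Prop) :
    Pr P p (fun G => S G ∨ S' G) ≤ Pr P p S + Pr P p S' := by
  unfold Pr
  rw [← Ex_add]
  refine Ex_mono h0 h1 fun G hG => ?_
  beta_reduce
  split_ifs <;> first | (norm_num; done) | tauto

lemma Pr_exists {ι : Type*} {P : Finset α} {p : ℝ} (h0 : 0 ≤ p) (h1 : p ≤ 1) (I : Finset ι)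
    (S : ι → Finset α → Prop) {B : ℝ} (hB : ∀ i ∈ I, Pr P p (S i) ≤ B) :
    Pr P p (fun G => ∃ i ∈ I, S i G) ≤ I.card * B := by
  classical
  refine le_trans ?_ (sum_le_card_nsmul I (fun i => Pr P p (S i)) B hB |>.trans (by simp))
  unfold Pr
  rw [← Ex_sum]
  refine Ex_mono h0 h1 fun G hG => ?_
  split_ifs with h
  · obtain ⟨i, hi, hS⟩ := h
    refine le_trans ?_ (single_le_sum (f := fun i => if S i G then (1:ℝ) else 0) ?_ hi)
    · simp [hS]
    · intro j _
      split_ifs <;> norm_num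
  · refine sum_nonneg fun j _ => ?_
    split_ifs <;> norm_num

lemma Pr_compl (P : Finset α) (p : ℝ) (S : Finset α → Prop) :
    Pr P p S = 1 - Pr P p (fun G => ¬ S G) := by
  have : Pr P p S + Pr P p (fun G => ¬ S G) = 1 := by
    unfold Pr
    rw [← Ex_add]
    refine Eq.trans ?_ (Ex_const P p 1)
    congr 1
    ext G
    beta_reduce
    split_ifs <;> first | (norm_num; done) | tauto
  linarith

noncomputable def chi1 (p : ℝ) (G : Finset α) (e : α) : ℝ := if e ∈ G then (1 - p) / p else -1

lemma exp_le_one_add_sq {x : ℝ} (hx : |x| ≤ 1) : Real.exp x ≤ 1 + x + x ^ 2 := by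
  have := Real.abs_exp_sub_one_sub_id_le hx
  have := abs_le.1 this
  linarith [this.2]

lemma mgf_bound {p y : ℝ} (h0 : 0 < p) (h1 : p ≤ 1) (hy : |y| ≤ p) :
    p * Real.exp (y * ((1 - p) / p)) + (1 - p) * Real.exp (y * (-1))
      ≤ Real.exp ((y / p) ^ 2) := by
  have hyp : |y| / p ≤ 1 := (div_le_one h0).2 hy
  have a1 : |y * ((1 - p) / p)| ≤ 1 := by
    rw [abs_mul, abs_of_nonneg (div_nonneg (by linarith) h0.le)]
    calc |y| * ((1 - p) / p) = (|y| / p) * (1 - p) := by ring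
      _ ≤ 1 * 1 := mul_le_mul hyp (by linarith) (by linarith) (by norm_num)
      _ = 1 := by ring
  have a2 : |y * (-1)| ≤ 1 := by
    rw [abs_mul]; simp; linarith
  have b1 := exp_le_one_add_sq a1
  have b2 := exp_le_one_add_sq a2
  have key : p * (y * ((1 - p) / p)) ^ 2 + (1 - p) * (y * (-1)) ^ 2 ≤ (y / p) ^ 2 := by
    have : p * (y * ((1 - p) / p)) ^ 2 + (1 - p) * (y * (-1)) ^ 2 = (y / p) ^ 2 * (p * (1 - p)) := by
      field_simp
      ring
    rw [this]
    have hpp : p * (1 - p) ≤ 1 := by nlinarith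
    nlinarith [sq_nonneg (y / p)]
  have e0 : p * (y * ((1 - p) / p)) + (1 - p) * (y * (-1)) = 0 := by
    field_simp
    ring
  calc _ ≤ p * (1 + y * ((1 - p) / p) + (y * ((1 - p) / p)) ^ 2)
        + (1 - p) * (1 + y * (-1) + (y * (-1)) ^ 2) := by
        refine add_le_add (mul_le_mul_of_nonneg_left b1 h0.le)
          (mul_le_mul_of_nonneg_left b2 (by linarith))
    _ = 1 + (p * (y * ((1 - p) / p)) ^ 2 + (1 - p) * (y * (-1)) ^ 2) := by
        linear_combination e0
    _ ≤ 1 + (y / p) ^ 2 := by linarith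
    _ ≤ _ := by linarith [Real.add_one_le_exp ((y / p) ^ 2)]

lemma tail_one {p : ℝ} (h0 : 0 < p) (h1 : p ≤ 1) (P0 : Finset α) (c : α → ℝ) {b l : ℝ}
    (hb : 0 < b) (hl : 0 < l) (hl1 : l ≤ 1) (hc : ∀ e ∈ P0, |c e| ≤ b) :
    Pr P0 p (fun G => l * b * P0.card < ∑ e ∈ P0, c e * chi1 p G e)
      ≤ Real.exp (-(l ^ 2 * p ^ 2 * P0.card / 4)) := by
  set s : ℝ := l * p ^ 2 / (2 * b) with hs
  have hs0 : 0 < s := by positivity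
  have m1 : Pr P0 p (fun G => l * b * P0.card < ∑ e ∈ P0, c e * chi1 p G e)
      ≤ Ex P0 p (fun G => Real.exp (-(s * (l * b * P0.card))) *
          ∏ e ∈ P0, if e ∈ G then Real.exp (s * c e * ((1 - p) / p))
            else Real.exp (s * c e * (-1))) := by
    unfold Pr
    refine Ex_mono h0.le h1 fun G hG => ?_
    have e1 : (∏ e ∈ P0, if e ∈ G then Real.exp (s * c e * ((1 - p) / p))
            else Real.exp (s * c e * (-1))) = Real.exp (s * ∑ e ∈ P0, c e * chi1 p G e) := by
      rw [mul_sum, Real.exp_sum]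
      refine prod_congr rfl fun e _ => ?_
      unfold chi1
      split_ifs <;> ring_nf
    rw [e1, ← Real.exp_add]
    split_ifs with h
    · apply Real.one_le_exp
      nlinarith
    · positivity
  refine m1.trans ?_
  rw [Ex_mul, Ex_prod]
  have hsb : s * b = l * p ^ 2 / 2 := by
    rw [hs]; field_simp
  have m2 : ∏ e ∈ P0, (p * Real.exp (s * c e * ((1 - p) / p))
      + (1 - p) * Real.exp (s * c e * (-1))) ≤ ∏ e ∈ P0, Real.exp (l ^ 2 * p ^ 2 / 4) := by
    refine prod_le_prod (fun e _ => ?_) fun e he => ?_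
    · have : 0 ≤ 1 - p := by linarith
      positivity
    · have hsc : |s * c e| ≤ l * p ^ 2 / 2 := by
        rw [abs_mul, abs_of_pos hs0, ← hsb]
        exact mul_le_mul_of_nonneg_left (hc e he) hs0.le
      refine (mgf_bound h0 h1 (hsc.trans ?_)).trans ?_
      · nlinarith [mul_pos h0 h0, mul_pos hl h0]
      · rw [Real.exp_le_exp, div_pow, div_le_iff₀ (by positivity), ← sq_abs]
        calc |s * c e| ^ 2 ≤ (l * p ^ 2 / 2) ^ 2 := by gcongr
          _ = _ := by ring
  calc _ ≤ Real.exp (-(s * (l * b * P0.card))) * ∏ e ∈ P0, Real.exp (l ^ 2 * p ^ 2 / 4) :=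
        mul_le_mul_of_nonneg_left m2 (Real.exp_pos _).le
    _ = Real.exp (-(l ^ 2 * p ^ 2 * P0.card / 4)) := by
      rw [prod_const, ← Real.exp_nat_mul, ← Real.exp_add]
      congr 1
      have : s * (l * b * P0.card) = (s * b) * l * P0.card := by ring
      rw [this, hsb]
      ring

lemma tail {ι : Type*} [Fintype ι] {p : ℝ} (h0 : 0 < p) (h1 : p ≤ 1) (P : Finset α)
    (edge : ι → α) (hinj : Function.Injective edge) (hP : ∀ x, edge x ∈ P)
    (c : Finset α → ι → ℝ)
    (hc : ∀ G G' : Finset α, (∀ e, e ∉ Set.range edge → (e ∈ G ↔ e ∈ G')) → c G = c G')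
    {b l : ℝ} (hb : 0 < b) (hl : 0 < l) (hl1 : l ≤ 1) :
    Pr P p (fun G => (∀ x, |c G x| ≤ b) ∧
        l * b * Fintype.card ι < |∑ x, c G x * chi1 p G (edge x)|)
      ≤ 2 * Real.exp (-(l ^ 2 * p ^ 2 * Fintype.card ι / 4)) := by
  classical
  set P0 : Finset α := univ.image edge with hP0
  have hP0P : P0 ⊆ P := by
    intro e he
    obtain ⟨x, _, rfl⟩ := mem_image.1 he
    exact hP x
  have hcard : P0.card = Fintype.card ι := by
    rw [hP0, card_image_of_injective _ hinj, card_univ]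
  unfold Pr
  rw [Ex_split P P0 hP0P]
  rw [← Ex_const (P \ P0) p (2 * _)]
  refine Ex_mono h0.le h1 fun G1 hG1 => ?_
  have hcG : ∀ G0 ⊆ P0, c (G1 ∪ G0) = c G1 := by
    intro G0 hG0
    apply hc
    intro e he
    rw [mem_union]
    constructor
    · rintro (h | h)
      · exact h
      · exfalso
        obtain ⟨x, _, rfl⟩ := mem_image.1 (hG0 h)
        exact he ⟨x, rfl⟩
    · exact Or.inl
  have hchi : ∀ G0 : Finset α, ∀ x, chi1 p (G1 ∪ G0) (edge x) = chi1 p G0 (edge x) := by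
    intro G0 x
    have : edge x ∉ G1 := fun h => (mem_sdiff.1 (hG1 h)).2 (mem_image_of_mem _ (mem_univ x))
    simp [chi1, this]
  by_cases hall : ∀ x, |c G1 x| ≤ b
  swap
  · refine le_trans ?_ (by positivity : (0:ℝ) ≤ _)
    refine le_trans ?_ (Ex_const P0 p 0).le
    refine Ex_mono h0.le h1 fun G0 hG0 => ?_
    beta_reduce
    rw [hcG G0 hG0, if_neg (fun h => hall h.1)]
  have key : ∀ c' : ι → ℝ, (∀ x, |c' x| ≤ b) →
      Pr P0 p (fun G => l * b * P0.card < ∑ x, c' x * chi1 p G (edge x))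
        ≤ Real.exp (-(l ^ 2 * p ^ 2 * P0.card / 4)) := by
    intro c' hc'
    have := tail_one h0 h1 P0 (Function.extend edge c' 0) hb hl hl1 ?_
    · convert this using 4 with G
      rw [hP0, sum_image (fun x _ y _ h => hinj h)]
      exact sum_congr rfl fun x _ => by rw [hinj.extend_apply]
    · intro e he
      obtain ⟨x, _, rfl⟩ := mem_image.1 he
      rw [hinj.extend_apply]
      exact hc' x
  have k1 := key (c G1) hall
  have k2 := key (fun x => - c G1 x) (by simpa using hall)
  rw [hcard] at k1 k2
  calc _ ≤ Pr P0 p (fun G => l * b * Fintype.card ι < ∑ x, c G1 x * chi1 p G (edge x)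
            ∨ l * b * Fintype.card ι < ∑ x, (- c G1 x) * chi1 p G (edge x)) := by
        unfold Pr
        refine Ex_mono h0.le h1 fun G0 hG0 => ?_
        beta_reduce
        rw [hcG G0 hG0]
        simp_rw [hchi G0]
        split_ifs with h h'
        · exact le_rfl
        · exfalso
          apply h'
          rcases lt_abs.1 h.2 with h | h
          · exact Or.inl h
          · right
            simpa [neg_mul, sum_neg_distrib] using h
        · norm_num
        · norm_num
    _ ≤ _ := Pr_or h0.le h1 _ _
    _ ≤ _ := by linarith

end prob
end TF

/-! ## Weighted averages over tuples -/
namespace TF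

variable {k n : ℕ}

def ed (t : Tup k n) (s : Sym2 (Fin k)) : Sym2 (Vtx k n) := Sym2.map (fun i => (i, t i)) s

noncomputable def ch (p : ℝ) (G : Finset (Sym2 (Vtx k n))) (t : Tup k n) (s : Sym2 (Fin k)) : ℝ :=
  chi1 p G (ed t s)

lemma ed_congr {t t' : Tup k n} {s : Sym2 (Fin k)} (h : ∀ i ∈ s, t i = t' i) : ed t s = ed t' s := by
  unfold ed
  refine Sym2.map_congr fun i hi => ?_
  rw [h i hi]

lemma ch_congr {p : ℝ} {G : Finset (Sym2 (Vtx k n))} {t t' : Tup k n} {s : Sym2 (Fin k)}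
    (h : ∀ i ∈ s, t i = t' i) : ch p G t s = ch p G t' s := by
  unfold ch
  rw [ed_congr h]

lemma ed_fst (t : Tup k n) (s : Sym2 (Fin k)) : Sym2.map Prod.fst (ed t s) = s := by
  induction s with
  | h x y => simp [ed]

lemma ed_mem_pot {t : Tup k n} {s : Sym2 (Fin k)} (hs : ¬ s.IsDiag) : ed t s ∈ potEdges k n := by
  unfold potEdges
  rw [mem_filter, ed_fst]
  exact ⟨mem_univ _, hs⟩

lemma abs_ch_le {p : ℝ} (h0 : 0 < p) (h1 : p ≤ 1) (G : Finset (Sym2 (Vtx k n)))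
    (t : Tup k n) (s : Sym2 (Fin k)) :
    |ch p G t s| ≤ 1 / p := by
  unfold ch chi1
  have h3 : 1 ≤ 1 / p := by rw [le_div_iff₀ h0]; linarith
  split_ifs
  · rw [abs_of_nonneg (div_nonneg (by linarith) h0.le)]
    gcongr
    linarith
  · simpa using h3

lemma one_add_ch_nonneg {p : ℝ} (h0 : 0 < p) (h1 : p ≤ 1) (G : Finset (Sym2 (Vtx k n)))
    (t : Tup k n) (s : Sym2 (Fin k)) :
    0 ≤ 1 + ch p G t s := by
  unfold ch chi1
  split_ifs
  · have : 0 ≤ (1 - p) / p := div_nonneg (by linarith) h0.le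
    linarith
  · norm_num

lemma one_add_ch_le {p : ℝ} (h0 : 0 < p) (_h1 : p ≤ 1) (G : Finset (Sym2 (Vtx k n)))
    (t : Tup k n) (s : Sym2 (Fin k)) :
    1 + ch p G t s ≤ 1 / p := by
  unfold ch chi1
  split_ifs
  · have : 1 + (1 - p) / p = 1 / p := by field_simp; ring
    exact this.le
  · have : 0 < 1 / p := by positivity
    linarith

def Agree (f : Sym2 (Fin k)) (G G' : Finset (Sym2 (Vtx k n))) : Prop :=
  ∀ e, Sym2.map Prod.fst e ≠ f → (e ∈ G ↔ e ∈ G')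

lemma ch_agree {p : ℝ} {f : Sym2 (Fin k)} {G G' : Finset (Sym2 (Vtx k n))} (h : Agree f G G')
    (t : Tup k n) {s : Sym2 (Fin k)} (hs : s ≠ f) : ch p G t s = ch p G' t s := by
  unfold ch chi1
  have := h (ed t s) (by rwa [ed_fst])
  simp [this]

def merge (T : Finset (Fin k)) (t t' : Tup k n) : Tup k n := fun i => if i ∈ T then t i else t' i

def upd (f : Fin k × Fin k) (t : Tup k n) (x : Fin n × Fin n) : Tup k n :=
  Function.update (Function.update t f.1 x.1) f.2 x.2

noncomputable def w0 (R : Finset (Tup k n)) (A B : Finset (Sym2 (Fin k))) (p : ℝ)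
    (G : Finset (Sym2 (Vtx k n))) (t : Tup k n) : ℝ :=
  (if t ∈ R then 1 else 0) * (∏ s ∈ A, ch p G t s) * ∏ s ∈ B, (1 + ch p G t s)

noncomputable def W0 (T : Finset (Fin k)) (R : Finset (Tup k n)) (A B : Finset (Sym2 (Fin k)))
    (p : ℝ) (G : Finset (Sym2 (Vtx k n))) (t : Tup k n) : ℝ :=
  ((n : ℝ) ^ k)⁻¹ * ∑ t' : Tup k n, w0 R A B p G (merge T t t')

def sl (f : Fin k × Fin k) : Sym2 (Fin k) := s(f.1, f.2)

noncomputable def Wl (T : Finset (Fin k)) (R : Finset (Tup k n)) (A B : Finset (Sym2 (Fin k)))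
    (p : ℝ) : List (Fin k × Fin k) → Finset (Sym2 (Vtx k n)) → Tup k n → ℝ
  | [], G, t => W0 T R A B p G t
  | f :: L, G, t => ((n : ℝ) ^ 2)⁻¹ * ∑ x : Fin n × Fin n,
      Wl T R A B p L G (upd f t x) * ch p G (upd f t x) (sl f)

lemma Wl_agree {T : Finset (Fin k)} {R : Finset (Tup k n)} {A B : Finset (Sym2 (Fin k))}
    {p : ℝ} {f : Sym2 (Fin k)} {G G' : Finset (Sym2 (Vtx k n))} (h : Agree f G G')
    (hA : f ∉ A) (hB : f ∉ B) (L : List (Fin k × Fin k)) (hL : f ∉ L.map sl) (t : Tup k n) :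
    Wl T R A B p L G t = Wl T R A B p L G' t := by
  induction L generalizing t with
  | nil =>
    simp only [Wl, W0, w0]
    congr 1
    refine sum_congr rfl fun t' _ => ?_
    congr 1
    · congr 1
      exact prod_congr rfl fun s hs => ch_agree h _ (fun e => hA (e ▸ hs))
    · exact prod_congr rfl fun s hs => by rw [ch_agree h _ (fun e => hB (e ▸ hs))]
  | cons g L ih =>
    simp only [List.map_cons, List.mem_cons, not_or] at hL
    simp only [Wl]
    congr 1
    refine sum_congr rfl fun x _ => ?_
    rw [ih hL.2, ch_agree h _ (Ne.symm hL.1)]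

lemma sum_update (i : Fin k) (F : Tup k n → ℝ) :
    ∑ t : Tup k n, ∑ a : Fin n, F (Function.update t i a) = n * ∑ t, F t := by
  have : (n : ℝ) * ∑ t, F t = ∑ t : Tup k n, ∑ a : Fin n, F t := by
    simp [mul_sum]
  rw [this, ← Fintype.sum_prod_type', ← Fintype.sum_prod_type']
  refine Finset.sum_nbij' (fun q => (Function.update q.1 i q.2, q.1 i))
    (fun q => (Function.update q.1 i q.2, q.1 i)) ?_ ?_ ?_ ?_ ?_ <;> simp

lemma sum_upd {f : Fin k × Fin k} (F : Tup k n → ℝ) :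
    ∑ t : Tup k n, ∑ x : Fin n × Fin n, F (upd f t x) = (n : ℝ) ^ 2 * ∑ t, F t := by
  simp only [upd, Fintype.sum_prod_type]
  have := sum_update f.1 (fun t => ∑ b : Fin n, F (Function.update t f.2 b))
  rw [this, sum_update f.2 F]
  ring

lemma sum_merge (T : Finset (Fin k)) (F : Tup k n → ℝ) :
    ∑ t : Tup k n, ∑ t' : Tup k n, F (merge T t t') = (n : ℝ) ^ k * ∑ t, F t := by
  have : (n : ℝ) ^ k * ∑ t, F t = ∑ t : Tup k n, ∑ _a : Tup k n, F t := by
    simp [mul_sum]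
  rw [this, ← Fintype.sum_prod_type', ← Fintype.sum_prod_type']
  refine Finset.sum_nbij' (fun q => (merge T q.1 q.2, merge T q.2 q.1))
    (fun q => (merge T q.1 q.2, merge T q.2 q.1)) ?_ ?_ ?_ ?_ ?_
  · simp
  · simp
  · rintro ⟨a, b⟩ _
    ext i <;> simp only [merge] <;> split_ifs <;> rfl
  · rintro ⟨a, b⟩ _
    ext i <;> simp only [merge] <;> split_ifs <;> rfl
  · simp

lemma Wl_sum (hn : 0 < n) (T : Finset (Fin k)) (R : Finset (Tup k n)) (A B : Finset (Sym2 (Fin k)))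
    (p : ℝ) (G : Finset (Sym2 (Vtx k n))) (L : List (Fin k × Fin k)) (K : List (Sym2 (Fin k)))
    (hL : (L.map sl).Pairwise fun a b => ¬ tch a b)
    (hKL : ∀ a ∈ K, ∀ b ∈ L, ¬ tch a (sl b)) :
    ∑ t, (K.map (ch p G t)).prod * Wl T R A B p L G t
      = ∑ t, (K.map (ch p G t)).prod * ((L.map sl).map (ch p G t)).prod * W0 T R A B p G t := by
  have hn' : (n : ℝ) ≠ 0 := by positivity
  induction L generalizing K with
  | nil => simp [Wl]
  | cons f L ih =>
    rw [List.map_cons, List.pairwise_cons] at hL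
    have e1 : ∑ t, (K.map (ch p G t)).prod * Wl T R A B p (f :: L) G t
        = ∑ t, ((sl f :: K).map (ch p G t)).prod * Wl T R A B p L G t := by
      have := sum_upd (f := f) (fun t => ((sl f :: K).map (ch p G t)).prod * Wl T R A B p L G t)
      rw [← mul_right_inj' (pow_ne_zero 2 hn'), ← this, mul_sum]
      refine sum_congr rfl fun t _ => ?_
      simp only [Wl]
      rw [mul_left_comm, mul_inv_cancel_left₀ (pow_ne_zero 2 hn'), mul_sum]
      refine sum_congr rfl fun x _ => ?_
      have hK : K.map (ch p G (upd f t x)) = K.map (ch p G t) := by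
        refine List.map_congr_left fun a ha => ch_congr fun i hi => ?_
        have hni : i ∉ sl f := fun h => hKL a ha f (by simp) ⟨i, hi, h⟩
        simp only [sl, Sym2.mem_iff, not_or] at hni
        simp [upd, Function.update_of_ne hni.2, Function.update_of_ne hni.1]
      rw [List.map_cons, List.prod_cons, hK]
      ring
    rw [e1, ih (sl f :: K) hL.2]
    · refine sum_congr rfl fun t _ => ?_
      simp only [List.map_cons, List.prod_cons]
      ring
    · intro a ha b hb
      rcases List.mem_cons.1 ha with rfl | ha
      · exact hL.1 _ (List.mem_map_of_mem hb)
      · exact hKL a ha b (List.mem_cons_of_mem _ hb)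

/-- The expression for a single interval of graphs. -/
noncomputable def XX (R : Finset (Tup k n)) (A B : Finset (Sym2 (Fin k))) (p : ℝ)
    (G : Finset (Sym2 (Vtx k n))) : ℝ :=
  ((n : ℝ) ^ k)⁻¹ * ∑ t ∈ R, (∏ s ∈ A, ch p G t s) * ∏ s ∈ B, (1 + ch p G t s)

lemma XX_eq (hn : 0 < n) (T : Finset (Fin k)) (R : Finset (Tup k n))
    (A B N : Finset (Sym2 (Fin k)))
    (p : ℝ) (G : Finset (Sym2 (Vtx k n))) (L : List (Fin k × Fin k))
    (hLN : L.map sl = N.toList) (hNA : N ⊆ A) (hN : IsMat N) (hNT : ∀ s ∈ N, ∀ v ∈ s, v ∈ T) :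
    XX R A B p G = ((n : ℝ) ^ k)⁻¹ * ∑ t, Wl T R (A \ N) B p L G t := by
  have hn' : (n : ℝ) ≠ 0 := by positivity
  have hp : (L.map sl).Pairwise fun a b => ¬ tch a b := by
    rw [hLN]
    refine List.Pairwise.imp_of_mem ?_ N.nodup_toList
    intro a b ha hb hab
    exact hN a (mem_toList.1 ha) b (mem_toList.1 hb) hab
  have := Wl_sum hn T R (A \ N) B p G L [] hp (by simp)
  simp only [List.map_nil, List.prod_nil, one_mul] at this
  rw [this, hLN]
  have e2 : ∀ t, (N.toList.map (ch p G t)).prod = ∏ s ∈ N, ch p G t s := fun t => prod_map_toList N _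
  simp_rw [e2]
  unfold XX
  congr 1
  have e3 := sum_merge T (fun t => (∏ s ∈ N, ch p G t s) * w0 R (A \ N) B p G t)
  rw [← mul_right_inj' (pow_ne_zero k hn'), mul_sum]
  trans (n : ℝ) ^ k * ∑ t, (∏ s ∈ N, ch p G t s) * w0 R (A \ N) B p G t
  · rw [← mul_sum]
    congr 1
    have e4 : ∀ t, (∏ s ∈ N, ch p G t s) * w0 R (A \ N) B p G t
        = if t ∈ R then (∏ s ∈ A, ch p G t s) * ∏ s ∈ B, (1 + ch p G t s) else 0 := by
      intro t
      unfold w0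
      rw [← prod_sdiff hNA]
      split_ifs <;> ring
    simp_rw [e4]
    rw [← sum_filter]
    simp
  · rw [← e3, mul_sum]
    refine sum_congr rfl fun t _ => ?_
    unfold W0
    rw [mul_left_comm, mul_inv_cancel_left₀ (pow_ne_zero k hn'), mul_sum]
    refine sum_congr rfl fun t' _ => ?_
    congr 1
    refine prod_congr rfl fun s hs => ch_congr fun i hi => ?_
    simp [merge, hNT s hs i hi]

lemma Wl_prob {p : ℝ} (h0 : 0 < p) (h1 : p ≤ 1) (T : Finset (Fin k)) (R : Finset (Tup k n))
    (A B : Finset (Sym2 (Fin k))) {b l : ℝ} (hb : 0 < b) (hl : 0 < l) (hl1 : l ≤ 1)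
    (L : List (Fin k × Fin k)) (hdiag : ∀ f ∈ L, f.1 ≠ f.2) (hnd : (L.map sl).Nodup)
    (hLA : ∀ f ∈ L, sl f ∉ A ∧ sl f ∉ B) :
    Pr (potEdges k n) p (fun G => (∀ t, |W0 T R A B p G t| ≤ b) ∧
        ∃ t, b * l ^ L.length < |Wl T R A B p L G t|)
      ≤ L.length * ((n : ℝ) ^ k * (2 * Real.exp (-(l ^ 2 * p ^ 2 * (n : ℝ) ^ 2 / 4)))) := by
  induction L with
  | nil =>
    refine le_trans (Pr_mono h0.le h1 (S' := fun _ => False) ?_) ?_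
    · rintro G _ ⟨ha, t, ht⟩
      have := ha t
      simp only [Wl, List.length_nil, pow_zero, mul_one] at ht
      linarith
    · simp [Pr, Ex]
  | cons f L ih =>
    have hnd' := List.nodup_cons.1 (by simpa using hnd : (sl f :: L.map sl).Nodup)
    have ih' := ih (fun g hg => hdiag g (List.mem_cons_of_mem _ hg)) hnd'.2
      (fun g hg => hLA g (List.mem_cons_of_mem _ hg))
    have hf := hdiag f (by simp)
    have hfA := hLA f (by simp)
    set b' := b * l ^ L.length with hb'
    have hb'0 : 0 < b' := by positivity
    have step : ∀ t ∈ (univ : Finset (Tup k n)), Pr (potEdges k n) p (fun G =>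
        (∀ x : Fin n × Fin n, |Wl T R A B p L G (upd f t x)| ≤ b') ∧
        l * b' * Fintype.card (Fin n × Fin n) < |∑ x : Fin n × Fin n,
          Wl T R A B p L G (upd f t x) * chi1 p G (ed (upd f t x) (sl f))|)
        ≤ 2 * Real.exp (-(l ^ 2 * p ^ 2 * (n : ℝ) ^ 2 / 4)) := by
      intro t _
      have := tail h0 h1 (potEdges k n) (fun x : Fin n × Fin n => ed (upd f t x) (sl f)) ?_ ?_
        (fun G x => Wl T R A B p L G (upd f t x)) ?_ hb'0 hl hl1
      · refine this.trans (le_of_eq ?_)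
        simp [Fintype.card_prod, pow_two]
      · intro x y hxy
        simp only [ed, sl, upd, Sym2.map_mk, Function.update_self,
          Function.update_of_ne hf, Sym2.eq_iff, Prod.mk.injEq] at hxy
        rcases hxy with h | h
        · exact Prod.ext h.1.2 h.2.2
        · exact absurd h.1.1 hf
      · intro x
        apply ed_mem_pot
        simpa [sl] using hf
      · intro G G' hG
        funext x
        refine Wl_agree (f := sl f) ?_ hfA.1 hfA.2 L hnd'.1 _
        intro e he
        apply hG
        rintro ⟨y, rfl⟩
        exact he (ed_fst _ _)
    have hall := Pr_exists h0.le h1 univ _ step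
    have hcard : ((univ : Finset (Tup k n)).card : ℝ) = (n : ℝ) ^ k := by simp
    rw [hcard] at hall
    refine le_trans (Pr_mono h0.le h1 ?_) ((Pr_or h0.le h1 _ _).trans (add_le_add ih' hall)) |>.trans ?_
    · rintro G _ ⟨hW, t, ht⟩
      by_cases hc : ∃ t, b' < |Wl T R A B p L G t|
      · exact Or.inl ⟨hW, hc⟩
      · right
        push Not at hc
        refine ⟨t, mem_univ _, fun x => hc _, ?_⟩
        have hn : (0:ℝ) < (n : ℝ) ^ 2 := by
          rcases Nat.eq_zero_or_pos n with rfl | hn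
          · exfalso
            simp [Wl] at ht
            have : 0 ≤ b * l ^ (L.length + 1) := by positivity
            linarith
          · positivity
        simp only [Wl, List.length_cons, abs_mul, abs_inv, abs_of_pos hn] at ht
        rw [inv_mul_eq_div, lt_div_iff₀ hn] at ht
        have : l * b' * (Fintype.card (Fin n × Fin n) : ℝ) = b * l ^ (L.length + 1) * (n : ℝ) ^ 2 := by
          rw [hb']; simp [Fintype.card_prod]; ring
        rw [this]
        exact ht
    · push_cast [List.length_cons]
      linarith

end TF

namespace TF

variable {k n : ℕ}

/-- Neighbourhood pseudo-randomness. -/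
def Good1 (p τ : ℝ) (T0 : ℕ) (G : Finset (Sym2 (Vtx k n))) : Prop :=
  ∀ (t : Tup k n) (v u : Fin k) (J : Finset (Fin k)), J.card ≤ T0 → u ∉ J → v ∉ J → u ≠ v →
    |∑ y : Fin n, (∏ w ∈ J, (1 + ch p G (Function.update t v y) s(w, v)))
      * ch p G (Function.update t v y) s(u, v)| ≤ τ * n

lemma Good1_prob {p : ℝ} (h0 : 0 < p) (h1 : p ≤ 1) {τ : ℝ} (hτ : 0 < τ) (hτ1 : τ ≤ 1) (T0 : ℕ) :
    Pr (potEdges k n) p (fun G => ¬ Good1 p τ T0 G)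
      ≤ ((n : ℝ) ^ k * (k * (k * 2 ^ k))) *
        (2 * Real.exp (-((τ * p ^ T0) ^ 2 * p ^ 2 * n / 4))) := by
  have hpT : 0 < p ^ T0 := pow_pos h0 _
  set b : ℝ := (1 / p) ^ T0 with hb
  set l : ℝ := τ * p ^ T0 with hl
  have hlb : l * b = τ := by
    rw [hl, hb, mul_assoc, ← mul_pow, mul_one_div_cancel h0.ne', one_pow, mul_one]
  have step : ∀ i ∈ (univ : Finset (Tup k n × Fin k × Fin k × Finset (Fin k))),
      Pr (potEdges k n) p (fun G => i.2.2.2.card ≤ T0 ∧ i.2.2.1 ∉ i.2.2.2 ∧ i.2.1 ∉ i.2.2.2 ∧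
        i.2.2.1 ≠ i.2.1 ∧
        τ * n < |∑ y : Fin n, (∏ w ∈ i.2.2.2, (1 + ch p G (Function.update i.1 i.2.1 y) s(w, i.2.1)))
      * ch p G (Function.update i.1 i.2.1 y) s(i.2.2.1, i.2.1)|)
      ≤ 2 * Real.exp (-(l ^ 2 * p ^ 2 * n / 4)) := by
    rintro ⟨t, v, u, J⟩ _
    dsimp only
    by_cases hcond : J.card ≤ T0 ∧ u ∉ J ∧ v ∉ J ∧ u ≠ v
    · obtain ⟨c1, c2, c3, c4⟩ := hcond
      have := tail h0 h1 (potEdges k n)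
        (fun y : Fin n => ed (Function.update t v y) s(u, v)) ?_ ?_
        (fun G y => ∏ w ∈ J, (1 + ch p G (Function.update t v y) s(w, v))) ?_
        (b := b) (l := l) (by positivity) (by positivity)
        (mul_le_one₀ hτ1 hpT.le (pow_le_one₀ h0.le h1))
      · rw [Fintype.card_fin] at this
        refine le_trans (Pr_mono h0.le h1 ?_) this
        rintro G _ ⟨_, _, _, _, hh⟩
        refine ⟨fun y => ?_, by rw [hlb]; exact hh⟩
        rw [abs_prod]
        calc ∏ w ∈ J, |1 + ch p G (Function.update t v y) s(w, v)|
            ≤ ∏ w ∈ J, (1 / p) := by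
              refine prod_le_prod (fun _ _ => abs_nonneg _) fun w _ => ?_
              rw [abs_of_nonneg (one_add_ch_nonneg h0 h1 _ _ _)]
              exact one_add_ch_le h0 h1 _ _ _
          _ = (1 / p) ^ J.card := by simp
          _ ≤ (1 / p) ^ T0 := pow_le_pow_right₀ (by rw [le_div_iff₀ h0]; linarith) c1
      · intro x y hxy
        simp only [ed, Sym2.map_mk, Function.update_self,
          Function.update_of_ne c4, Sym2.eq_iff, Prod.mk.injEq] at hxy
        rcases hxy with h | h
        · exact h.2.2
        · exact absurd h.1.1 c4
      · intro x
        apply ed_mem_pot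
        simpa using c4
      · intro G G' hG
        funext y
        refine prod_congr rfl fun w hw => ?_
        congr 1
        refine ch_agree (f := s(u, v)) ?_ _ ?_
        · intro e he
          apply hG
          rintro ⟨z, rfl⟩
          exact he (ed_fst _ _)
        · intro h
          rw [Sym2.eq_iff] at h
          rcases h with h | h
          · exact c2 (h.1 ▸ hw)
          · exact c3 (h.1 ▸ hw)
    · refine le_trans (Pr_mono h0.le h1 (S' := fun _ => False) ?_) ?_
      · rintro G _ ⟨a, b, c, d, _⟩
        exact hcond ⟨a, b, c, d⟩
      · simp [Pr, Ex]
        positivity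
  have hall := Pr_exists h0.le h1 univ _ step
  refine le_trans (Pr_mono h0.le h1 ?_) (hall.trans (le_of_eq ?_))
  · intro G _ hG
    unfold Good1 at hG
    push Not at hG
    obtain ⟨t, v, u, J, a, b, c, d, e⟩ := hG
    exact ⟨(t, v, u, J), mem_univ _, a, b, c, d, e⟩
  · simp [Fintype.card_prod]

lemma Good1_avg {p τ : ℝ} {T0 : ℕ} {G : Finset (Sym2 (Vtx k n))} (hG : Good1 p τ T0 G)
    (t : Tup k n) (v : Fin k) (J : Finset (Fin k)) (hv : v ∉ J) (hJ : J.card ≤ T0) :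
    ∑ y : Fin n, ∏ w ∈ J, (1 + ch p G (Function.update t v y) s(w, v)) ≤ n * (1 + J.card * τ) := by
  induction J using Finset.induction_on with
  | empty => simp
  | insert u J hu ih =>
    rw [card_insert_of_notMem hu] at hJ ⊢
    rw [mem_insert, not_or] at hv
    have h1 := ih hv.2 (by omega)
    have h2 := hG t v u J (by omega) hu hv.2 (Ne.symm hv.1)
    have h3 := (abs_le.1 h2).2
    have : ∑ y : Fin n, ∏ w ∈ insert u J, (1 + ch p G (Function.update t v y) s(w, v))
        = ∑ y : Fin n, ∏ w ∈ J, (1 + ch p G (Function.update t v y) s(w, v)) +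
          ∑ y : Fin n, (∏ w ∈ J, (1 + ch p G (Function.update t v y) s(w, v)))
      * ch p G (Function.update t v y) s(u, v) := by
      rw [← sum_add_distrib]
      refine sum_congr rfl fun y _ => ?_
      rw [prod_insert hu]
      ring
    rw [this]
    push_cast
    linarith

lemma W0_bound {p τ : ℝ} (h0 : 0 < p) (h1 : p ≤ 1) (hτ : 0 ≤ τ) {T0 : ℕ} (hn : 0 < n)
    {G : Finset (Sym2 (Vtx k n))}
    (hG : Good1 p τ T0 G) (T : Finset (Fin k)) (hT : T.card ≤ T0) (R : Finset (Tup k n))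
    (A B : Finset (Sym2 (Fin k))) (hA : ∀ s ∈ A, ∀ v ∈ s, v ∈ T)
    (hB : ∀ s ∈ B, ∃ v ∈ s, v ∈ T) (hAB : Disjoint A B) (t : Tup k n) :
    |W0 T R A B p G t| ≤ (1 / p) ^ (T.card ^ 2) * (1 + T0 * τ) ^ k := by
  classical
  have hp1 : 1 ≤ 1 / p := by rw [le_div_iff₀ h0]; linarith
  set BT := B.filter (fun s => ∀ v ∈ s, v ∈ T) with hBT
  set BO := B.filter (fun s => ¬ ∀ v ∈ s, v ∈ T) with hBO
  let J : Fin k → Finset (Fin k) := fun v => if v ∈ T then ∅ else T.filter (fun u => s(u, v) ∈ B)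
  have hJT : ∀ v, J v ⊆ T := by
    intro v
    dsimp only [J]
    split_ifs
    · simp
    · exact filter_subset _ _
  have hvJ : ∀ v, v ∉ J v := by
    intro v hv
    have := hJT v hv
    simp [J, this] at hv
  have hBOprod : ∀ f : Sym2 (Fin k) → ℝ, ∏ s ∈ BO, f s = ∏ v, ∏ u ∈ J v, f s(u, v) := by
    intro f
    rw [prod_sigma']
    symm
    refine prod_nbij (fun q => s(q.2, q.1)) ?_ ?_ ?_ ?_
    · rintro ⟨v, u⟩ hq
      simp only [mem_sigma, mem_univ, true_and, J] at hq
      split_ifs at hq with hv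
      · simp at hq
      · rw [mem_filter] at hq
        rw [hBO, mem_filter]
        exact ⟨hq.2, fun h => hv (h v (by simp))⟩
    · rintro ⟨v, u⟩ hq ⟨v', u'⟩ hq' h
      simp only [coe_sigma, Set.mem_sigma_iff, mem_coe, mem_univ, true_and, J] at hq hq'
      split_ifs at hq with hv
      · simp at hq
      split_ifs at hq' with hv'
      · simp at hq'
      rw [mem_filter] at hq hq'
      simp only [Sym2.eq_iff] at h
      rcases h with h | h
      · obtain ⟨rfl, rfl⟩ := h
        rfl
      · exact absurd (h.1 ▸ hq.1) hv'
    · intro s hs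
      have hs := mem_filter.1 (mem_coe.1 hs)
      obtain ⟨u, hus, huT⟩ := hB s hs.1
      obtain ⟨v, rfl⟩ := Sym2.mem_iff_exists.1 hus
      have hv : v ∉ T := by
        intro hv
        apply hs.2
        intro w hw
        rcases Sym2.mem_iff.1 hw with rfl | rfl <;> assumption
      refine ⟨⟨v, u⟩, ?_, rfl⟩
      simp [J, hv, huT, hs.1]
    · intro q _
      rfl
  set g : Fin k → Fin n → ℝ := fun v y =>
    ∏ u ∈ J v, (1 + ch p G (Function.update t v y) s(u, v)) with hg
  have hg0 : ∀ v y, 0 ≤ g v y := fun v y => prod_nonneg fun _ _ => one_add_ch_nonneg h0 h1 _ _ _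
  have key : ∀ t', |w0 R A B p G (merge T t t')| ≤ (1 / p) ^ (T.card ^ 2) * ∏ v, g v (t' v) := by
    intro t'
    unfold w0
    rw [abs_mul, abs_mul]
    have a1 : |(if merge T t t' ∈ R then (1:ℝ) else 0)| ≤ 1 := by split_ifs <;> simp
    have a2 : |∏ s ∈ A, ch p G (merge T t t') s| ≤ (1 / p) ^ A.card := by
      rw [abs_prod]
      refine (prod_le_prod (fun _ _ => abs_nonneg _) fun s _ => abs_ch_le h0 h1 _ _ _).trans ?_
      simp
    have a3 : |∏ s ∈ B, (1 + ch p G (merge T t t') s)| ≤ (1 / p) ^ BT.card * ∏ v, g v (t' v) := by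
      rw [abs_of_nonneg (prod_nonneg fun _ _ => one_add_ch_nonneg h0 h1 _ _ _)]
      rw [← prod_filter_mul_prod_filter_not B (fun s => ∀ v ∈ s, v ∈ T)]
      refine mul_le_mul ?_ (le_of_eq ?_)
        (prod_nonneg fun _ _ => one_add_ch_nonneg h0 h1 _ _ _) (by positivity)
      · refine (prod_le_prod (fun _ _ => one_add_ch_nonneg h0 h1 _ _ _)
          fun s _ => one_add_ch_le h0 h1 _ _ _).trans ?_
        rw [prod_const]
      · rw [← hBO, hBOprod]
        refine prod_congr rfl fun v _ => prod_congr rfl fun u hu => ?_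
        congr 1
        refine ch_congr fun i hi => ?_
        have huT := hJT v hu
        have huv : u ≠ v := fun h => hvJ v (h ▸ hu)
        have hv : v ∉ T := by
          intro hv
          simp [J, hv] at hu
        rcases Sym2.mem_iff.1 hi with rfl | rfl
        · simp [merge, huT, Function.update_of_ne huv]
        · simp [merge, hv]
    have a4 : A.card + BT.card ≤ T.card ^ 2 := by
      rw [← card_union_of_disjoint (hAB.mono_right (filter_subset _ _))]
      have : A ∪ BT ⊆ T.sym2 := by
        intro s hs
        rw [mem_sym2_iff]
        rcases mem_union.1 hs with h | h
        · exact hA s h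
        · exact (mem_filter.1 h).2
      refine (card_le_card this).trans ?_
      rw [card_sym2, Nat.choose_two_right]
      apply Nat.div_le_of_le_mul
      simp only [Nat.add_sub_cancel]
      nlinarith [Nat.zero_le T.card, sq_nonneg (T.card), Nat.le_self_pow (n := 2) (by norm_num) T.card]
    calc _ ≤ 1 * (1 / p) ^ A.card * ((1 / p) ^ BT.card * ∏ v, g v (t' v)) := by
          have : 0 ≤ ∏ v, g v (t' v) := prod_nonneg fun _ _ => hg0 _ _
          gcongr
      _ = (1 / p) ^ (A.card + BT.card) * ∏ v, g v (t' v) := by rw [pow_add]; ring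
      _ ≤ _ := by
          have : 0 ≤ ∏ v, g v (t' v) := prod_nonneg fun _ _ => hg0 _ _
          gcongr
  unfold W0
  have hnk : (0:ℝ) < (n:ℝ) ^ k := by positivity
  rw [abs_mul, abs_inv, abs_of_pos hnk, inv_mul_le_iff₀ hnk]
  calc |∑ t', w0 R A B p G (merge T t t')| ≤ ∑ t', |w0 R A B p G (merge T t t')| :=
        abs_sum_le_sum_abs _ _
    _ ≤ ∑ t' : Tup k n, (1 / p) ^ (T.card ^ 2) * ∏ v, g v (t' v) := sum_le_sum fun t' _ => key t'
    _ = (1 / p) ^ (T.card ^ 2) * ∏ v, ∑ y, g v y := by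
        rw [← mul_sum, Finset.prod_univ_sum, Fintype.piFinset_univ]
    _ ≤ (1 / p) ^ (T.card ^ 2) * ∏ v : Fin k, (n * (1 + T0 * τ)) := by
        gcongr with v
        · intro v _; exact sum_nonneg fun _ _ => hg0 _ _
        · refine (Good1_avg hG t v (J v) (hvJ v) ((card_le_card (hJT v)).trans hT)).trans ?_
          gcongr
          exact (card_le_card (hJT v)).trans hT
    _ = _ := by
        rw [prod_const, card_univ, Fintype.card_fin, mul_pow]
        ring

end TF

namespace TF

variable {k n : ℕ}

noncomputable def Lof (N : Finset (Sym2 (Fin k))) : List (Fin k × Fin k) := N.toList.map Quot.out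

lemma sl_out (s : Sym2 (Fin k)) : sl (Quot.out s) = s := Quot.out_eq s

lemma Lof_map (N : Finset (Sym2 (Fin k))) : (Lof N).map sl = N.toList := by
  unfold Lof
  rw [List.map_map]
  conv_rhs => rw [← List.map_id N.toList]
  exact List.map_congr_left fun s _ => sl_out s

lemma Lof_length (N : Finset (Sym2 (Fin k))) : (Lof N).length = N.card := by
  simp [Lof]

def Good2 (p l : ℝ) (b : ℕ → ℝ) (Reg : Finset (Finset (Tup k n))) (G : Finset (Sym2 (Vtx k n))) : Prop :=
  ∀ R ∈ Reg, ∀ (A B N : Finset (Sym2 (Fin k))) (T : Finset (Fin k)),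
    N ⊆ EE k → Disjoint N A → Disjoint N B → (∀ t, |W0 T R A B p G t| ≤ b T.card) →
    ∀ t, |Wl T R A B p (Lof N) G t| ≤ b T.card * l ^ N.card

lemma card_sym2_le : Fintype.card (Sym2 (Fin k)) ≤ k ^ 2 := by
  rw [Sym2.card, Fintype.card_fin, Nat.choose_two_right]
  apply Nat.div_le_of_le_mul
  simp only [Nat.add_sub_cancel]
  nlinarith [Nat.le_self_pow (n := 2) (by norm_num) k]

lemma Good2_prob {p : ℝ} (h0 : 0 < p) (h1 : p ≤ 1) {l : ℝ} (hl : 0 < l) (hl1 : l ≤ 1)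
    (b : ℕ → ℝ) (hb : ∀ i, 0 < b i) (Reg : Finset (Finset (Tup k n))) :
    Pr (potEdges k n) p (fun G => ¬ Good2 p l b Reg G)
      ≤ (Reg.card * (2 ^ (k ^ 2) * (2 ^ (k ^ 2) * (2 ^ (k ^ 2) * 2 ^ k)))) *
        ((k : ℝ) ^ 2 * ((n : ℝ) ^ k * (2 * Real.exp (-(l ^ 2 * p ^ 2 * (n : ℝ) ^ 2 / 4))))) := by
  have step : ∀ i ∈ Reg ×ˢ (univ : Finset (Finset (Sym2 (Fin k)) × Finset (Sym2 (Fin k)) ×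
      Finset (Sym2 (Fin k)) × Finset (Fin k))),
      Pr (potEdges k n) p (fun G => i.2.2.2.1 ⊆ EE k ∧ Disjoint i.2.2.2.1 i.2.1 ∧
        Disjoint i.2.2.2.1 i.2.2.1 ∧
        (∀ t, |W0 i.2.2.2.2 i.1 i.2.1 i.2.2.1 p G t| ≤ b i.2.2.2.2.card) ∧
        ∃ t, b i.2.2.2.2.card * l ^ i.2.2.2.1.card
          < |Wl i.2.2.2.2 i.1 i.2.1 i.2.2.1 p (Lof i.2.2.2.1) G t|)
      ≤ (k : ℝ) ^ 2 * ((n : ℝ) ^ k * (2 * Real.exp (-(l ^ 2 * p ^ 2 * (n : ℝ) ^ 2 / 4)))) := by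
    rintro ⟨R, A, B, N, T⟩ _
    dsimp only
    by_cases hc : N ⊆ EE k ∧ Disjoint N A ∧ Disjoint N B
    · obtain ⟨c1, c2, c3⟩ := hc
      have hmem : ∀ f ∈ Lof N, sl f ∈ N := by
        intro f hf
        have : sl f ∈ (Lof N).map sl := List.mem_map_of_mem hf
        rw [Lof_map] at this
        exact mem_toList.1 this
      have := Wl_prob (n := n) h0 h1 T R A B (hb T.card) hl hl1 (Lof N) ?_ ?_ ?_
      · refine le_trans (Pr_mono h0.le h1 ?_) (this.trans ?_)
        · rintro G _ ⟨_, _, _, h⟩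
          rwa [Lof_length]
        · rw [Lof_length]
          gcongr
          exact_mod_cast (card_le_univ N).trans card_sym2_le
      · intro f hf
        have := c1 (hmem f hf)
        simpa [EE, sl] using this
      · rw [Lof_map]
        exact nodup_toList N
      · intro f hf
        exact ⟨disjoint_left.1 c2 (hmem f hf), disjoint_left.1 c3 (hmem f hf)⟩
    · refine le_trans (Pr_mono h0.le h1 (S' := fun _ => False) ?_) ?_
      · rintro G _ ⟨a, b, c, _⟩
        exact hc ⟨a, b, c⟩
      · simp [Pr, Ex]
        positivity
  have hall := Pr_exists h0.le h1 _ _ step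
  refine le_trans (Pr_mono h0.le h1 ?_) (hall.trans ?_)
  · intro G _ hG
    unfold Good2 at hG
    push Not at hG
    obtain ⟨R, hR, A, B, N, T, a, b, c, d, e⟩ := hG
    exact ⟨(R, A, B, N, T), by simp [hR], a, b, c, d, e⟩
  · have h2 : ((2:ℝ) ^ Fintype.card (Sym2 (Fin k))) ≤ 2 ^ (k ^ 2) :=
      pow_le_pow_right₀ (by norm_num) card_sym2_le
    simp only [card_product, card_univ, Fintype.card_prod, Fintype.card_finset, Fintype.card_fin]
    push_cast
    gcongr

lemma XX_bound {p τ l : ℝ} (h0 : 0 < p) (h1 : p ≤ 1) (hτ : 0 ≤ τ) {T0 : ℕ}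
    (hn : 0 < n) {Reg : Finset (Finset (Tup k n))}
    {G : Finset (Sym2 (Vtx k n))} (hG : Good1 p τ T0 G)
    (hG2 : Good2 p l (fun i => (1 / p) ^ (i ^ 2) * (1 + T0 * τ) ^ k) Reg G)
    {R : Finset (Tup k n)} (hR : R ∈ Reg) (T : Finset (Fin k)) (hT : T.card ≤ T0)
    (A B N : Finset (Sym2 (Fin k))) (hA : ∀ s ∈ A, ∀ v ∈ s, v ∈ T) (hAE : A ⊆ EE k)
    (hB : ∀ s ∈ B, ∃ v ∈ s, v ∈ T) (hAB : Disjoint A B) (hNA : N ⊆ A) (hN : IsMat N) :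
    |XX R A B p G| ≤ (1 / p) ^ (T.card ^ 2) * (1 + T0 * τ) ^ k * l ^ N.card := by
  rw [XX_eq hn T R A B N p G (Lof N) (Lof_map N) hNA hN (fun s hs => hA s (hNA hs))]
  have hnk : (0:ℝ) < (n:ℝ) ^ k := by positivity
  rw [abs_mul, abs_inv, abs_of_pos hnk, inv_mul_le_iff₀ hnk]
  refine (abs_sum_le_sum_abs _ _).trans ?_
  have := hG2 R hR (A \ N) B N T (hNA.trans hAE) disjoint_sdiff (hAB.mono_left hNA)
    (W0_bound h0 h1 hτ hn hG T hT R (A \ N) B (fun s hs => hA s (mem_sdiff.1 hs).1) hB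
      (hAB.mono_left sdiff_subset))
  refine (sum_le_card_nsmul _ _ _ fun t _ => this t).trans (le_of_eq ?_)
  simp

end TF

namespace TF

variable {k n : ℕ}

noncomputable def nu (r : ℕ) (p : ℝ) (G : Finset (Sym2 (Vtx k n))) (R : Finset (Tup k n)) : ℝ :=
  ((n : ℝ) ^ k)⁻¹ * ∑ t ∈ R, Pfun r (ch p G t)

lemma UU_touch {M : Finset (Sym2 (Fin k))} {s : Sym2 (Fin k)} (hs : s ∈ UU M) :
    ∃ v ∈ s, v ∈ VV M := by
  rcases mem_UU.1 hs with h | ⟨m, hm, _, v, hv1, hv2⟩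
  · obtain ⟨v, hv, _⟩ := tch_refl s
    exact ⟨v, hv, mem_VV.2 ⟨s, h, hv⟩⟩
  · exact ⟨v, hv2, mem_VV.2 ⟨m, hm, hv1⟩⟩

lemma card_EE_le : (EE k).card ≤ k ^ 2 := (card_le_univ _).trans card_sym2_le

lemma sum_pow_subsets {x : ℝ} (hx : 0 ≤ x) :
    ∑ M ∈ (EE k).powerset, x ^ M.card ≤ (1 + x) ^ (k ^ 2) := by
  have : ∑ M ∈ (EE k).powerset, x ^ M.card = (1 + x) ^ (EE k).card := by
    have := Finset.sum_pow_mul_eq_add_pow x 1 (EE k)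
    simp only [one_pow, mul_one] at this
    rw [this, add_comm]
  rw [this]
  exact pow_le_pow_right₀ (by linarith) card_EE_le

lemma nu_univ {p τ l x : ℝ} (h0 : 0 < p) (h1 : p ≤ 1) (hτ : 0 ≤ τ) (hl : 0 < l) {T0 r : ℕ}
    (hT0 : 8 * r ≤ T0)
    (hn : 0 < n) {Reg : Finset (Finset (Tup k n))}
    {G : Finset (Sym2 (Vtx k n))} (hG : Good1 p τ T0 G)
    (hG2 : Good2 p l (fun i => (1 / p) ^ (i ^ 2) * (1 + T0 * τ) ^ k) Reg G)
    (hR : univ ∈ Reg) (hx0 : 0 < x) (hC : (1 + T0 * τ) ^ k ≤ 2) (hx : (1 / p) ^ (4 * r) * l ≤ x)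
    (hxk : (1 + x) ^ (k ^ 2) ≤ 5 / 4) : 1 / 2 ≤ nu r p G univ := by
  classical
  have hp1 : 1 ≤ 1 / p := by rw [le_div_iff₀ h0]; linarith
  have e1 : nu r p G univ = ∑ M ∈ (EE k).powerset with (IsMat M ∧ M.card ≤ r),
      XX univ M ((UU M ∩ EE k) \ M) p G := by
    unfold nu XX
    simp_rw [Pfun_eq]
    rw [sum_comm, mul_sum]
  set S := (EE k).powerset.filter (fun M => IsMat M ∧ M.card ≤ r) with hS
  have hmem : (∅ : Finset (Sym2 (Fin k))) ∈ S := by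
    rw [hS, mem_filter]
    exact ⟨by simp, by intro a ha; simp at ha, by simp⟩
  have hX0 : XX (univ : Finset (Tup k n)) ∅ ((UU ∅ ∩ EE k) \ ∅) p G = 1 := by
    have : UU (∅ : Finset (Sym2 (Fin k))) = ∅ := by
      ext s
      simp [mem_UU]
    unfold XX
    have hnk : (n : ℝ) ^ k ≠ 0 := by positivity
    simp [this, hnk]
  rw [e1, ← add_sum_erase S _ hmem, hX0]
  have key : ∀ M ∈ S.erase ∅, |XX univ M ((UU M ∩ EE k) \ M) p G| ≤ 2 * x ^ M.card := by
    intro M hM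
    have hM := mem_filter.1 (mem_of_mem_erase hM)
    rw [mem_powerset] at hM
    obtain ⟨hME, hMm, hMr⟩ := hM
    have hV := card_VV M
    have := XX_bound h0 h1 hτ hn hG hG2 hR (VV M) (by omega) M ((UU M ∩ EE k) \ M) M
      (fun s hs v hv => mem_VV.2 ⟨s, hs, hv⟩) hME
      (fun s hs => UU_touch (mem_inter.1 (mem_sdiff.1 hs).1).1) disjoint_sdiff subset_rfl hMm
    refine this.trans ?_
    have h2 : (1 / p) ^ ((VV M).card ^ 2) ≤ ((1 / p) ^ (4 * r)) ^ M.card := by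
      rw [← pow_mul]
      refine pow_le_pow_right₀ hp1 ?_
      calc (VV M).card ^ 2 ≤ (2 * M.card) ^ 2 := Nat.pow_le_pow_left hV 2
        _ = 4 * M.card * M.card := by ring
        _ ≤ 4 * r * M.card := by gcongr
    calc _ ≤ ((1 / p) ^ (4 * r)) ^ M.card * 2 * l ^ M.card := by gcongr
      _ = 2 * ((1 / p) ^ (4 * r) * l) ^ M.card := by rw [mul_pow]; ring
      _ ≤ _ := by gcongr
  have hsum : |∑ M ∈ S.erase ∅, XX univ M ((UU M ∩ EE k) \ M) p G| ≤ 2 * ((5:ℝ) / 4 - 1) := by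
    refine (abs_sum_le_sum_abs _ _).trans ((sum_le_sum key).trans ?_)
    rw [← mul_sum]
    gcongr
    have h3 := sum_pow_subsets (k := k) hx0.le
    rw [← add_sum_erase _ _ (empty_mem_powerset (EE k))] at h3
    have h4 : ∑ M ∈ S.erase ∅, x ^ M.card ≤ ∑ M ∈ (EE k).powerset.erase ∅, x ^ M.card :=
      sum_le_sum_of_subset_of_nonneg (erase_subset_erase _ (filter_subset _ _))
        (fun _ _ _ => by positivity)
    simp only [card_empty, pow_zero] at h3
    linarith
  have := (abs_le.1 hsum).1
  linarith

lemma nu_missing {p τ l x : ℝ} (h0 : 0 < p) (h1 : p ≤ 1) (hτ : 0 ≤ τ) (hl : 0 < l) (hl1 : l ≤ 1)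
    {T0 r : ℕ} (hr : 1 ≤ r) (hT0 : 8 * r ≤ T0)
    (hn : 0 < n) {Reg : Finset (Finset (Tup k n))}
    {G : Finset (Sym2 (Vtx k n))} (hG : Good1 p τ T0 G)
    (hG2 : Good2 p l (fun i => (1 / p) ^ (i ^ 2) * (1 + T0 * τ) ^ k) Reg G)
    {R : Finset (Tup k n)}
    (hR : R ∈ Reg) (hx0 : 0 < x) (hx1 : x ≤ 1) (hC : (1 + T0 * τ) ^ k ≤ 2)
    (hxk : (1 + x) ^ (k ^ 2) ≤ 5 / 4) (e : Sym2 (Fin k)) (he : e ∈ EE k)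
    (hch : ∀ t ∈ R, ed t e ∉ G) :
    nu r p G R ≤ 4 * ((1 / p) ^ (64 * r ^ 2) * l ^ r * (x ^ (4 * r))⁻¹) := by
  have hp1 : 1 ≤ 1 / p := by rw [le_div_iff₀ h0]; linarith
  obtain ⟨Q, coef, hQ, hz⟩ := Pfun_missing r hr e he
  have e1 : nu r p G R = ∑ q ∈ Q, coef q * XX R (AA e q) (BB e q) p G := by
    unfold nu XX
    rw [sum_congr rfl fun t ht => hz (ch p G t) (by simp [ch, chi1, hch t ht]), sum_comm, mul_sum]
    refine sum_congr rfl fun q _ => ?_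
    rw [← mul_sum]
    ring
  set E := (1 / p) ^ (64 * r ^ 2) * l ^ r with hE
  have hE0 : 0 < E := by positivity
  have key : ∀ q ∈ Q, coef q * XX R (AA e q) (BB e q) p G ≤
      (2 * E * (x ^ (4 * r))⁻¹) * (x ^ q.1.card * x ^ q.2.card) := by
    intro q hq
    obtain ⟨c1, c2, c3, c4, c5, c6, c7, c8⟩ := hQ q hq
    set T := VV q.1 ∪ VV q.2 with hT
    have hTc : T.card ≤ 8 * r := by
      rw [hT]
      have := card_union_le (VV q.1) (VV q.2)
      have a := card_VV q.1
      have b := card_VV q.2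
      omega
    have hN : ∃ N ⊆ AA e q, IsMat N ∧ r ≤ N.card := by
      rcases c8 with h | h
      · exact ⟨q.1, subset_union_left, c4, h.le⟩
      · refine ⟨q.2.erase e, subset_union_right, ?_, ?_⟩
        · intro a ha b hb
          exact c5 a (mem_of_mem_erase ha) b (mem_of_mem_erase hb)
        · have := pred_card_le_card_erase (s := q.2) (a := e)
          omega
    obtain ⟨N, hN1, hN2, hN3⟩ := hN
    have hb := XX_bound h0 h1 hτ hn hG hG2 hR T (by omega) (AA e q) (BB e q) N
      (by
        intro s hs v hv
        rcases mem_union.1 hs with h | h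
        · exact mem_union_left _ (mem_VV.2 ⟨s, h, hv⟩)
        · exact mem_union_right _ (mem_VV.2 ⟨s, mem_of_mem_erase h, hv⟩))
      (union_subset c2 ((erase_subset _ _).trans c3))
      (by
        intro s hs
        have hs := (mem_inter.1 (mem_inter.1 (mem_sdiff.1 (mem_of_mem_erase hs)).1).1).1
        obtain ⟨v, hv, hv2⟩ := UU_touch hs
        exact ⟨v, hv, mem_union_left _ hv2⟩)
      (disjoint_sdiff.mono_right (erase_subset _ _)) hN1 hN2
    have hb2 : |XX R (AA e q) (BB e q) p G| ≤ 2 * E := by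
      refine hb.trans ?_
      have h2 : (1 / p) ^ (T.card ^ 2) ≤ (1 / p) ^ (64 * r ^ 2) := by
        refine pow_le_pow_right₀ hp1 ?_
        calc T.card ^ 2 ≤ (8 * r) ^ 2 := Nat.pow_le_pow_left hTc 2
          _ = _ := by ring
      have h3 : l ^ N.card ≤ l ^ r := pow_le_pow_of_le_one hl.le hl1 hN3
      calc _ ≤ (1 / p) ^ (64 * r ^ 2) * 2 * l ^ r := by gcongr
        _ = _ := by rw [hE]; ring
    have hcx : coef q * XX R (AA e q) (BB e q) p G ≤ 2 * E := by
      refine (le_abs_self _).trans ?_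
      rw [abs_mul]
      calc _ ≤ 1 * (2 * E) := by gcongr
        _ = _ := one_mul _
    refine hcx.trans ?_
    have h5 : x ^ (4 * r) ≤ x ^ q.1.card * x ^ q.2.card := by
      rw [← pow_add]
      exact pow_le_pow_of_le_one hx0.le hx1 c6
    have h6 : 0 < x ^ (4 * r) := by positivity
    rw [mul_assoc, ← div_eq_inv_mul]
    have : 1 ≤ (x ^ q.1.card * x ^ q.2.card) / x ^ (4 * r) := by rwa [one_le_div h6]
    nlinarith
  rw [e1]
  refine (sum_le_sum key).trans ?_
  rw [← mul_sum]
  have hQsub : Q ⊆ (EE k).powerset ×ˢ (EE k).powerset := by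
    intro q hq
    obtain ⟨c1, c2, c3, _⟩ := hQ q hq
    simp [c2, c3]
  have h7 : ∑ q ∈ Q, x ^ q.1.card * x ^ q.2.card ≤ (5/4) * (5/4) := by
    refine (sum_le_sum_of_subset_of_nonneg hQsub fun _ _ _ => by positivity).trans ?_
    rw [sum_product]
    simp only
    simp_rw [← mul_sum]
    rw [← sum_mul]
    have h3 := (sum_pow_subsets (k := k) hx0.le).trans hxk
    have h8 : 0 ≤ ∑ M ∈ (EE k).powerset, x ^ M.card := sum_nonneg fun _ _ => by positivity
    gcongr
  have h9 : 0 ≤ 2 * E * (x ^ (4 * r))⁻¹ := by positivity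
  calc _ ≤ 2 * E * (x ^ (4 * r))⁻¹ * ((5/4) * (5/4)) := by gcongr
    _ ≤ _ := by
      have : 0 ≤ E * (x ^ (4 * r))⁻¹ := by positivity
      nlinarith

end TF

/-! ## Balancing tree-like proofs -/
namespace TF

inductive PT (α : Type) : Type
  | hole : PT α
  | ax : Finset α → PT α
  | node : Finset α → PT α → PT α → PT α

namespace PT

variable {α : Type}

def root : PT α → Finset α
  | hole => ∅
  | ax f => f
  | node f _ _ => f

def w : PT α → ℕ
  | hole => 0
  | ax _ => 1
  | node _ s t => s.w + t.w

def V (Ln Ax : Finset (Finset α)) (R : Finset α) : PT α → Prop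
  | hole => True
  | ax f => f ∈ Ax
  | node f s t => f ∈ Ln ∧ (∀ x ∈ R, x ∈ f → x ∈ s.root ∨ x ∈ t.root) ∧ V Ln Ax R s ∧ V Ln Ax R t

variable {Ln Ax : Finset (Finset α)}

lemma V_mono {R R' : Finset α} (h : R' ⊆ R) {π : PT α} (hπ : V Ln Ax R π) : V Ln Ax R' π := by
  induction π with
  | hole => trivial
  | ax f => exact hπ
  | node f s t ihs iht =>
    exact ⟨hπ.1, fun x hx => hπ.2.1 x (h hx), ihs hπ.2.2.1, iht hπ.2.2.2⟩

lemma split [DecidableEq α] {R : Finset α} {τ : ℝ} (hτ : 1 ≤ τ) (π : PT α) (hπ : V Ln Ax R π)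
    (hw : τ < π.w) : ∃ σ π' : PT α, (σ.w : ℝ) ≤ τ ∧ τ ≤ 2 * σ.w ∧ σ.w + π'.w = π.w ∧
      V Ln Ax R σ ∧ V Ln Ax (R \ σ.root) π' ∧ (σ.root ∈ Ln ∪ Ax) ∧ π.root \ σ.root ⊆ π'.root := by
  induction π with
  | hole => simp [w] at hw; linarith
  | ax f => simp [w] at hw; linarith
  | node f s t ihs iht =>
    obtain ⟨hf, himp, hs, ht⟩ := hπ
    have hroot : ∀ σ : PT α, 0 < σ.w → V Ln Ax R σ → σ.root ∈ Ln ∪ Ax := by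
      intro σ h1 h2
      cases σ with
      | hole => simp [w] at h1
      | ax f => exact mem_union_right _ h2
      | node f s t => exact mem_union_left _ h2.1
    by_cases h1 : τ < s.w
    · obtain ⟨σ, s', a, b, c, d, e, g, hr⟩ := ihs hs h1
      refine ⟨σ, node f s' t, a, b, ?_, d, ⟨hf, ?_, e, V_mono sdiff_subset ht⟩, g, sdiff_subset⟩
      · simp only [w]; omega
      · intro x hx hxf
        obtain ⟨hxR, hxσ⟩ := mem_sdiff.1 hx
        rcases himp x hxR hxf with h | h
        · exact Or.inl (hr (mem_sdiff.2 ⟨h, hxσ⟩))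
        · exact Or.inr h
    by_cases h2 : τ < t.w
    · obtain ⟨σ, t', a, b, c, d, e, g, hr⟩ := iht ht h2
      refine ⟨σ, node f s t', a, b, ?_, d, ⟨hf, ?_, V_mono sdiff_subset hs, e⟩, g, sdiff_subset⟩
      · simp only [w]; omega
      · intro x hx hxf
        obtain ⟨hxR, hxσ⟩ := mem_sdiff.1 hx
        rcases himp x hxR hxf with h | h
        · exact Or.inl h
        · exact Or.inr (hr (mem_sdiff.2 ⟨h, hxσ⟩))
    push Not at h1 h2
    simp only [w] at hw
    push_cast at hw
    rcases le_total s.w t.w with h | h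
    · have h' : (s.w : ℝ) ≤ t.w := by exact_mod_cast h
      have hpos : 0 < t.w := by
        have : (0:ℝ) < t.w := by linarith
        exact_mod_cast this
      refine ⟨t, node f s hole, h2, by linarith, by simp only [w]; omega, ht,
        ⟨hf, ?_, V_mono sdiff_subset hs, trivial⟩, hroot t hpos ht, sdiff_subset⟩
      intro x hx hxf
      obtain ⟨hxR, hxσ⟩ := mem_sdiff.1 hx
      rcases himp x hxR hxf with h | h
      · exact Or.inl h
      · exact absurd h hxσ
    · have h' : (t.w : ℝ) ≤ s.w := by exact_mod_cast h
      have hpos : 0 < s.w := by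
        have : (0:ℝ) < s.w := by linarith
        exact_mod_cast this
      refine ⟨s, node f hole t, h1, by linarith, by simp only [w]; omega, hs,
        ⟨hf, ?_, trivial, V_mono sdiff_subset ht⟩, hroot s hpos hs, sdiff_subset⟩
      intro x hx hxf
      obtain ⟨hxR, hxσ⟩ := mem_sdiff.1 hx
      rcases himp x hxR hxf with h | h
      · exact absurd h hxσ
      · exact Or.inr h

lemma w_zero {R : Finset α} (π : PT α) (hπ : V Ln Ax R π) (hw : π.w = 0) :
    ∀ x ∈ R, x ∉ π.root := by
  induction π with
  | hole => simp [root]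
  | ax f => simp [w] at hw
  | node f s t ihs iht =>
    obtain ⟨hf, himp, hs, ht⟩ := hπ
    simp only [w] at hw
    intro x hx hxf
    rcases himp x hx hxf with h | h
    · exact ihs hs (by omega) x hx h
    · exact iht ht (by omega) x hx h

lemma w_one {R : Finset α} (π : PT α) (hπ : V Ln Ax R π) (hw : π.w ≤ 1) :
    (∃ f ∈ Ax, ∀ x ∈ R, x ∈ π.root → x ∈ f) ∨ ∀ x ∈ R, x ∉ π.root := by
  induction π with
  | hole => simp [root]
  | ax f => exact Or.inl ⟨f, hπ, fun x _ h => h⟩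
  | node f s t ihs iht =>
    obtain ⟨hf, himp, hs, ht⟩ := hπ
    simp only [w] at hw
    rcases Nat.eq_zero_or_pos s.w with h0 | h0
    · have z := w_zero s hs h0
      rcases iht ht (by omega) with ⟨g, hg, h⟩ | h
      · left
        refine ⟨g, hg, fun x hx hxf => h x hx ?_⟩
        exact (himp x hx hxf).resolve_left (z x hx)
      · right
        intro x hx hxf
        exact h x hx ((himp x hx hxf).resolve_left (z x hx))
    · have z := w_zero t ht (by omega)
      rcases ihs hs (by omega) with ⟨g, hg, h⟩ | h
      · left
        refine ⟨g, hg, fun x hx hxf => h x hx ?_⟩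
        exact (himp x hx hxf).resolve_right (z x hx)
      · right
        intro x hx hxf
        exact h x hx ((himp x hx hxf).resolve_right (z x hx))

end PT

section reg
variable {α : Type} [Fintype α] [DecidableEq α]

def Reg (Ls : Finset (Finset α)) : ℕ → Finset (Finset α)
  | 0 => {univ}
  | j + 1 => Reg Ls j ∪ ((Reg Ls j ×ˢ Ls).image (fun q => q.1 ∩ q.2) ∪
      (Reg Ls j ×ˢ Ls).image (fun q => q.1 \ q.2))

lemma Reg_card (Ls : Finset (Finset α)) (j : ℕ) : (Reg Ls j).card ≤ (1 + 2 * Ls.card) ^ j := by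
  induction j with
  | zero => simp [Reg]
  | succ j ih =>
    have h1 : (Reg Ls (j+1)).card ≤ (Reg Ls j).card * (1 + 2 * Ls.card) := by
      simp only [Reg]
      refine (card_union_le _ _).trans ?_
      have h2 := card_union_le ((Reg Ls j ×ˢ Ls).image (fun q => q.1 ∩ q.2))
        ((Reg Ls j ×ˢ Ls).image (fun q => q.1 \ q.2))
      have h3 := card_image_le (s := Reg Ls j ×ˢ Ls) (f := fun q => q.1 ∩ q.2)
      have h4 := card_image_le (s := Reg Ls j ×ˢ Ls) (f := fun q => q.1 \ q.2)
      rw [card_product] at h3 h4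
      nlinarith
    rw [pow_succ]
    exact h1.trans (Nat.mul_le_mul_right _ ih)

lemma Reg_mono (Ls : Finset (Finset α)) {i j : ℕ} (h : i ≤ j) : Reg Ls i ⊆ Reg Ls j := by
  induction j, h using Nat.le_induction with
  | base => rfl
  | succ j _ ih => exact ih.trans subset_union_left

lemma balanced {Ln Ax : Finset (Finset α)} {J : ℕ} {δ : ℝ} (hδ : 0 ≤ δ) (F : α → ℝ)
    (hF : ∀ R ∈ Reg (Ln ∪ Ax) J, ∀ f ∈ Ax, R ⊆ f → ∑ x ∈ R, F x ≤ δ)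
    (h j : ℕ) (hj : j + h ≤ J) (R : Finset α) (hR : R ∈ Reg (Ln ∪ Ax) j) (π : PT α)
    (hπ : π.V Ln Ax R) (hRπ : R ⊆ π.root) (hw : (π.w : ℝ) ≤ (3/2) ^ h) :
    ∑ x ∈ R, F x ≤ 2 ^ h * δ := by
  induction h generalizing j R π with
  | zero =>
    have hw' : π.w ≤ 1 := by
      have : (π.w : ℝ) ≤ 1 := by simpa using hw
      exact_mod_cast this
    rw [pow_zero, one_mul]
    rcases PT.w_one π hπ hw' with ⟨f, hf, h⟩ | h
    · exact hF R (Reg_mono _ (by omega) hR) f hf fun x hx => h x hx (hRπ hx)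
    · have : R = ∅ := by
        rw [eq_empty_iff_forall_notMem]
        intro x hx
        exact h x hx (hRπ hx)
      rw [this]
      simpa using hδ
  | succ h ih =>
    by_cases hlt : (π.w : ℝ) ≤ (3/2) ^ h
    · refine (ih j (by omega) R hR π hπ hRπ hlt).trans ?_
      rw [pow_succ]
      have : 0 ≤ (2:ℝ) ^ h * δ := by positivity
      linarith
    push Not at hlt
    obtain ⟨σ, π', a, b, c, d, e, g, hr⟩ := PT.split (one_le_pow₀ (by norm_num)) π hπ hlt
    have hc : (σ.w : ℝ) + π'.w = π.w := by exact_mod_cast c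
    have r1 := ih (j+1) (by omega) (R ∩ σ.root)
      (mem_union_right _ (mem_union_left _ (mem_image.2 ⟨(R, σ.root), by simp [hR, mem_union.1 g], rfl⟩)))
      σ (PT.V_mono inter_subset_left d) inter_subset_right a
    have r2 := ih (j+1) (by omega) (R \ σ.root)
      (mem_union_right _ (mem_union_right _ (mem_image.2 ⟨(R, σ.root), by simp [hR, mem_union.1 g], rfl⟩)))
      π' e ((sdiff_subset_sdiff hRπ le_rfl).trans hr) (by rw [pow_succ] at hw; linarith)
    have : ∑ x ∈ R, F x = ∑ x ∈ R ∩ σ.root, F x + ∑ x ∈ R \ σ.root, F x :=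
      (sum_inter_add_sum_sdiff R σ.root F).symm
    rw [this, pow_succ]
    linarith

lemma balanced_univ {Ln Ax : Finset (Finset α)} {J : ℕ} {δ : ℝ} (hδ : 0 ≤ δ) (F : α → ℝ)
    (hF : ∀ R ∈ Reg (Ln ∪ Ax) J, ∀ f ∈ Ax, R ⊆ f → ∑ x ∈ R, F x ≤ δ) (π : PT α)
    (hπ : π.V Ln Ax univ) (hRπ : π.root = univ) (hw : (π.w : ℝ) ≤ (3/2) ^ J) :
    ∑ x, F x ≤ 2 ^ J * δ :=
  balanced hδ F hF J 0 (by omega) univ (by simp [Reg]) π hπ (by rw [hRπ]) hw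

/-- Trivial counting bound. -/
lemma count_bound {Ln Ax : Finset (Finset α)} {b : ℕ} (hAx : ∀ f ∈ Ax, f.card ≤ b) (π : PT α)
    (hπ : π.V Ln Ax univ) : π.root.card ≤ π.w * b := by
  induction π with
  | hole => simp [PT.root]
  | ax f => simpa [PT.root, PT.w] using hAx f hπ
  | node f s t ihs iht =>
    obtain ⟨hf, himp, hs, ht⟩ := hπ
    have : f ⊆ s.root ∪ t.root := fun x hx => mem_union.2 (himp x (mem_univ _) hx)
    have := (card_le_card this).trans (card_union_le _ _)
    have h1 := ihs hs
    have h2 := iht ht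
    simp only [PT.root, PT.w]
    rw [add_mul]
    omega

end reg

section conv
variable {α : Type} [Fintype α] [DecidableEq α] {N : ℕ}

def tset (asg : α → Fin N → Bool) (f : BFunc N) : Finset α := univ.filter fun x => f (asg x) = true

lemma conv (asg : α → Fin N → Bool) (F : Set (BFunc N)) (A : Finset (Clause N))
    (Ln Ax : Finset (Finset α)) (hLn : ∀ f ∈ F, tset asg f ∈ Ln)
    (hAx : ∀ c ∈ A, tset asg (falsInd c) ∈ Ax) (π : SemProof N) (hπ : SemProof.Valid F A π) :
    ∃ π' : PT α, π'.root = tset asg π.root ∧ π'.w ≤ π.length ∧ π'.V Ln Ax univ := by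
  induction π with
  | leaf f =>
    obtain ⟨c, hc, rfl⟩ := hπ
    exact ⟨PT.ax _, rfl, le_rfl, hAx c hc⟩
  | node1 f s ih =>
    obtain ⟨h, hs⟩ := hπ
    obtain ⟨s', a, b, c⟩ := ih hs
    rcases h with ⟨c, hc, rfl⟩ | ⟨hf, himp⟩
    · exact ⟨PT.ax _, rfl, by simp [PT.w, SemProof.length], hAx c hc⟩
    · refine ⟨PT.node (tset asg f) s' PT.hole, rfl, by simp only [PT.w, SemProof.length]; omega,
        hLn f hf, ?_, c, trivial⟩
      intro x _ hx
      left
      rw [a]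
      simp only [tset, mem_filter, mem_univ, true_and] at hx ⊢
      exact himp _ hx
  | node2 f s t ihs iht =>
    obtain ⟨h, hs, ht⟩ := hπ
    obtain ⟨s', a, b, c⟩ := ihs hs
    obtain ⟨t', a', b', c'⟩ := iht ht
    rcases h with ⟨c, hc, rfl⟩ | ⟨hf, himp⟩
    · exact ⟨PT.ax _, rfl, by simp [PT.w, SemProof.length], hAx c hc⟩
    · refine ⟨PT.node (tset asg f) s' t', rfl, by simp only [PT.w, SemProof.length]; omega,
        hLn f hf, ?_, c, c'⟩
      intro x _ hx
      rw [a, a']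
      simp only [tset, mem_filter, mem_univ, true_and] at hx ⊢
      exact himp _ hx

end conv

end TF

/-! ## Counting small formulas -/
namespace TF

variable {N : ℕ}

abbrev Tok (N : ℕ) := Fin N ⊕ Fin 4

def stepTok (a : Fin N → Bool) : Tok N → List Bool → List Bool
  | Sum.inl i, st => a i :: st
  | Sum.inr 0, st => match st with
    | x :: st => (!x) :: st
    | [] => []
  | Sum.inr 1, st => match st with
    | x :: y :: st => (y && x) :: st
    | _ => []
  | Sum.inr 2, st => match st with
    | x :: y :: st => (y || x) :: st
    | _ => []
  | Sum.inr 3, st => st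

def runTok (a : Fin N → Bool) : List (Tok N) → List Bool → List Bool
  | [], st => st
  | x :: L, st => runTok a L (stepTok a x st)

def code : BFormula N → List (Tok N)
  | .var i => [Sum.inl i]
  | .not φ => code φ ++ [Sum.inr 0]
  | .and φ ψ => code φ ++ (code ψ ++ [Sum.inr 1])
  | .or φ ψ => code φ ++ (code ψ ++ [Sum.inr 2])

lemma code_length (φ : BFormula N) : (code φ).length = φ.size := by
  induction φ with
  | var i => rfl
  | not φ ih => simp [code, BFormula.size, ih]
  | and φ ψ h1 h2 => simp [code, BFormula.size, h1, h2]; omega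
  | or φ ψ h1 h2 => simp [code, BFormula.size, h1, h2]; omega

lemma run_code (a : Fin N → Bool) (φ : BFormula N) (L : List (Tok N)) (st : List Bool) :
    runTok a (code φ ++ L) st = runTok a L (φ.eval a :: st) := by
  induction φ generalizing L st with
  | var i => rfl
  | not φ ih =>
    simp only [code, List.append_assoc, ih]
    rfl
  | and φ ψ h1 h2 =>
    simp only [code, List.append_assoc, h1, h2]
    rfl
  | or φ ψ h1 h2 =>
    simp only [code, List.append_assoc, h1, h2]
    rfl

lemma run_nop (a : Fin N → Bool) (j : ℕ) (st : List Bool) :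
    runTok a (List.replicate j (Sum.inr 3)) st = st := by
  induction j with
  | zero => rfl
  | succ j ih => rw [List.replicate_succ]; exact ih

def outTok (a : Fin N → Bool) (L : List (Tok N)) : Bool := (runTok a L []).headD true

def decTok (S : ℕ) (v : Fin S → Tok N) : BFunc N := fun a => !(outTok a (List.ofFn v))

lemma frege_dec {s : ℝ} {f : BFunc N} (hf : f ∈ FregeLines N s) :
    ∃ v : Fin ⌊s⌋₊ → Tok N, decTok ⌊s⌋₊ v = f := by
  obtain ⟨φ, hs, hφ⟩ := hf
  have hle : φ.size ≤ ⌊s⌋₊ := Nat.le_floor hs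
  set L := code φ ++ List.replicate (⌊s⌋₊ - φ.size) (Sum.inr 3 : Tok N) with hL
  have hlen : L.length = ⌊s⌋₊ := by
    rw [hL, List.length_append, code_length, List.length_replicate]
    omega
  refine ⟨fun i => L.get (i.cast hlen.symm), ?_⟩
  funext a
  rw [hφ a]
  have : List.ofFn (fun i : Fin ⌊s⌋₊ => L.get (i.cast hlen.symm)) = L := by
    have := List.ofFn_get L
    conv_rhs => rw [← this]
    exact (List.ofFn_congr hlen _).symm
  unfold decTok
  rw [this]
  simp only [outTok, hL, run_code, run_nop]
  rfl

variable {α : Type} [Fintype α] [DecidableEq α]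

noncomputable def LnF (asg : α → Fin N → Bool) (s : ℝ) : Finset (Finset α) :=
  (univ : Finset (Fin ⌊s⌋₊ → Tok N)).image fun v => tset asg (decTok ⌊s⌋₊ v)

lemma LnF_card (asg : α → Fin N → Bool) (s : ℝ) : (LnF asg s).card ≤ (N + 4) ^ ⌊s⌋₊ := by
  refine card_image_le.trans ?_
  simp

lemma mem_LnF (asg : α → Fin N → Bool) {s : ℝ} {f : BFunc N} (hf : f ∈ FregeLines N s) :
    tset asg f ∈ LnF asg s := by
  obtain ⟨v, hv⟩ := frege_dec hf
  exact mem_image.2 ⟨v, mem_univ _, by rw [hv]⟩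

end TF

/-! ## The axioms of the block clique formula on tuples -/
namespace TF

variable {k n : ℕ}

def star (q : Vtx k n × Vtx k n) : Finset (Tup k n) :=
  univ.filter fun t => t q.1.1 = q.1.2 ∧ t q.2.1 = q.2.2

open Classical in
noncomputable def AxG (G : Finset (Sym2 (Vtx k n))) : Finset (Finset (Tup k n)) :=
  insert ∅ ((univ.filter fun q : Vtx k n × Vtx k n => q.1.1 ≠ q.2.1 ∧ s(q.1, q.2) ∉ G).image star)

lemma AxG_anti (G : Finset (Sym2 (Vtx k n))) : AxG G ⊆ AxG ∅ := by
  unfold AxG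
  refine insert_subset_insert _ (image_subset_image ?_)
  intro q hq
  simp only [mem_filter, mem_univ, true_and, notMem_empty, not_false_eq_true, and_true] at hq ⊢
  exact hq.1

lemma AxG_card : (AxG (∅ : Finset (Sym2 (Vtx k n)))).card ≤ (k * n) ^ 2 + 1 := by
  unfold AxG
  refine (card_insert_le _ _).trans ?_
  gcongr
  refine card_image_le.trans ((card_filter_le _ _).trans ?_)
  simp [card_univ, Fintype.card_prod, pow_two]

lemma star_card (hn : 0 < n) (q : Vtx k n × Vtx k n) (hq : q.1.1 ≠ q.2.1) :
    (star q).card ≤ n ^ k / n ^ 2 := by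
  rw [Nat.le_div_iff_mul_le (by positivity)]
  have h1 : (star q ×ˢ (univ : Finset (Fin n × Fin n))).card ≤ (univ : Finset (Tup k n)).card := by
    refine card_le_card_of_injOn (fun z => upd (q.1.1, q.2.1) z.1 z.2) (fun _ _ => mem_coe.2 (mem_univ _)) ?_
    rintro ⟨t, x⟩ ht ⟨t', x'⟩ ht' h
    simp only [coe_product, Set.mem_prod, mem_coe, star, mem_filter, mem_univ, true_and, and_true] at ht ht'
    simp only [upd] at h
    have e1 := congrFun h q.1.1
    have e2 := congrFun h q.2.1
    simp only [Function.update_self, Function.update_of_ne hq] at e1 e2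
    refine Prod.ext (funext fun i => ?_) (Prod.ext e1 e2)
    by_cases h1 : i = q.1.1
    · subst h1; exact ht.1.trans ht'.1.symm
    by_cases h2 : i = q.2.1
    · subst h2; exact ht.2.trans ht'.2.symm
    have := congrFun h i
    simpa only [Function.update_of_ne h1, Function.update_of_ne h2] using this
  rw [card_product] at h1
  simpa [card_univ, Fintype.card_prod, pow_two] using h1

lemma AxG_small (hn : 0 < n) (G : Finset (Sym2 (Vtx k n))) : ∀ f ∈ AxG G, f.card ≤ n ^ k / n ^ 2 := by
  intro f hf
  rcases mem_insert.1 hf with rfl | hf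
  · simp
  · obtain ⟨q, hq, rfl⟩ := mem_image.1 hf
    exact star_card hn q (mem_filter.1 hq).2.1

lemma AxG_ruled (G : Finset (Sym2 (Vtx k n))) {R : Finset (Tup k n)} {f : Finset (Tup k n)}
    (hf : f ∈ AxG G) (hR : R ⊆ f) :
    R = ∅ ∨ ∃ e ∈ EE k, ∀ t ∈ R, ed t e ∉ G := by
  rcases mem_insert.1 hf with rfl | hf
  · left
    exact subset_empty.1 hR
  · right
    obtain ⟨q, hq, rfl⟩ := mem_image.1 hf
    obtain ⟨_, h1, h2⟩ := mem_filter.1 hq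
    refine ⟨s(q.1.1, q.2.1), by simpa [EE] using h1, fun t ht => ?_⟩
    have := (mem_filter.1 (hR ht)).2
    simp only [ed, Sym2.map_mk, this.1, this.2]
    exact h2

section asg
variable {m c : ℕ}

def asg (t : Tup k (m ^ c)) : Fin (k * (c * m)) → Bool := fun w =>
  let p := finProdFinEquiv.symm w
  let jc := finProdFinEquiv.symm p.2
  decide (digit (t p.1) jc.1 = jc.2)

lemma digit_inj {u v : Fin (m ^ c)} (h : ∀ j, digit u j = digit v j) : u = v :=
  finFunctionFinEquiv.symm.injective (funext h)

lemma mem_tset_fals (C : Clause (k * (c * m))) (t : Tup k (m ^ c)) :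
    t ∈ tset asg (falsInd C) ↔ ∀ i b, C i = some b → asg t i ≠ b := by
  unfold tset
  rw [mem_filter]
  simp [falsInd]

lemma ax_mem (G : Finset (Sym2 (Vtx k (m ^ c)))) :
    ∀ C ∈ bcliqueC k m c G, tset asg (falsInd C) ∈ AxG G := by
  intro C hC
  unfold bcliqueC at hC
  rcases mem_union.1 hC with hC | hC
  · obtain ⟨q, hq, rfl⟩ := mem_image.1 hC
    refine mem_insert_of_mem (mem_image.2 ⟨q, ?_, ?_⟩)
    · simpa using hq
    · ext t
      rw [mem_tset_fals]
      simp only [star, mem_filter, mem_univ, true_and, asg]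
      constructor
      · rintro ⟨h1, h2⟩ w b hb
        have hf : digit (t (finProdFinEquiv.symm w).1)
            (finProdFinEquiv.symm (finProdFinEquiv.symm w).2).1
              = (finProdFinEquiv.symm (finProdFinEquiv.symm w).2).2 ∧ b = false := by
          split_ifs at hb with c1 c2
          · rw [c1.1, h1]
            exact ⟨c1.2, by simpa using hb.symm⟩
          · rw [c2.1, h2]
            exact ⟨c2.2, by simpa using hb.symm⟩
        rw [hf.2]
        rw [hf.1]
        simp
      · intro h
        constructor
        · refine digit_inj fun j => ?_
          have := h (finProdFinEquiv (q.1.1, finProdFinEquiv (j, digit q.1.2 j))) false (by simp)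
          simpa using this
        · refine digit_inj fun j => ?_
          have := h (finProdFinEquiv (q.2.1, finProdFinEquiv (j, digit q.2.2 j))) false (by simp)
          simpa using this
  · obtain ⟨ij, _, rfl⟩ := mem_image.1 hC
    refine mem_insert.2 (Or.inl ?_)
    rw [eq_empty_iff_forall_notMem]
    intro t ht
    rw [mem_tset_fals] at ht
    simp only [asg] at ht
    have := ht (finProdFinEquiv (ij.1, finProdFinEquiv (ij.2, digit (t ij.1) ij.2))) true (by simp)
    simp at this

end asg

end TF

namespace TF

lemma probG_eq (k n : ℕ) (p : ℝ) (S : Finset (Sym2 (Vtx k n)) → Prop) :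
    probG k n p S = Pr (potEdges k n) p S := by
  unfold probG Pr Ex
  refine sum_congr rfl fun G _ => ?_
  by_cases h : S G <;> simp [h]

section
variable {k m c : ℕ}

lemma trivial_bound (hn : 0 < m ^ c) (s : ℝ) (G : Finset (Sym2 (Vtx k (m ^ c))))
    (π : SemProof (k * (c * m)))
    (hπ : IsRefutation (FregeLines (k * (c * m)) s) (bcliqueC k m c G) π) :
    (m ^ c) ^ 2 ≤ π.length := by
  obtain ⟨π', a, b, d⟩ := conv asg _ _ (LnF asg s) (AxG G) (fun f hf => mem_LnF asg hf)
    (ax_mem G) π hπ.1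
  have h1 := count_bound (AxG_small hn G) π' d
  have h2 : π'.root = univ := by
    rw [a]
    unfold tset
    rw [filter_eq_self]
    intro x _
    exact hπ.2 _
  rw [h2] at h1
  have h3 : (univ : Finset (Tup k (m ^ c))).card = (m ^ c) ^ k := by simp [card_univ]
  rw [h3] at h1
  have h4 : (m ^ c) ^ k / (m ^ c) ^ 2 * (m ^ c) ^ 2 ≤ (m ^ c) ^ k := Nat.div_mul_le_self _ _
  have h5 : 0 < (m ^ c) ^ k := by positivity
  have h6 : (m ^ c) ^ k * (m ^ c) ^ 2 ≤ (m ^ c) ^ k * π'.w := by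
    calc (m ^ c) ^ k * (m ^ c) ^ 2 ≤ (π'.w * ((m ^ c) ^ k / (m ^ c) ^ 2)) * (m ^ c) ^ 2 :=
          Nat.mul_le_mul_right _ h1
      _ = π'.w * ((m ^ c) ^ k / (m ^ c) ^ 2 * (m ^ c) ^ 2) := by ring
      _ ≤ π'.w * (m ^ c) ^ k := Nat.mul_le_mul_left _ h4
      _ = _ := by ring
  exact (Nat.le_of_mul_le_mul_left h6 h5).trans b

lemma core_det {p τ l x s : ℝ} (h0 : 0 < p) (h1 : p ≤ 1) (hτ : 0 ≤ τ) (hl : 0 < l) (hl1 : l ≤ 1)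
    {T0 r J : ℕ} (hr : 1 ≤ r) (hT0 : 8 * r ≤ T0)
    (hn : 0 < m ^ c)
    {G : Finset (Sym2 (Vtx k (m ^ c)))} (hG : Good1 p τ T0 G)
    (hG2 : Good2 p l (fun i => (1 / p) ^ (i ^ 2) * (1 + T0 * τ) ^ k)
      (Reg (LnF asg s ∪ AxG ∅) J) G)
    (hx0 : 0 < x) (hx1 : x ≤ 1) (hC : (1 + T0 * τ) ^ k ≤ 2) (hx : (1 / p) ^ (4 * r) * l ≤ x)
    (hxk : (1 + x) ^ (k ^ 2) ≤ 5 / 4)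
    (hE : 2 ^ J * (4 * ((1 / p) ^ (64 * r ^ 2) * l ^ r * (x ^ (4 * r))⁻¹)) < 1 / 2)
    (π : SemProof (k * (c * m)))
    (hπ : IsRefutation (FregeLines (k * (c * m)) s) (bcliqueC k m c G) π) :
    (3 / 2 : ℝ) ^ J ≤ π.length := by
  by_contra hcon
  push Not at hcon
  obtain ⟨π', a, b, d⟩ := conv asg _ _ (LnF asg s ∪ AxG ∅) (AxG G)
    (fun f hf => mem_union_left _ (mem_LnF asg hf)) (ax_mem G) π hπ.1
  have h2 : π'.root = univ := by
    rw [a]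
    unfold tset
    rw [filter_eq_self]
    intro x _
    exact hπ.2 _
  set δ := 4 * ((1 / p) ^ (64 * r ^ 2) * l ^ r * (x ^ (4 * r))⁻¹) with hδ
  have hδ0 : 0 ≤ δ := by positivity
  have hLs : LnF (asg (k := k) (m := m) (c := c)) s ∪ AxG ∅ ∪ AxG G = LnF asg s ∪ AxG ∅ :=
    union_eq_left.2 ((AxG_anti G).trans subset_union_right)
  have hsum : ∀ R, ∑ t ∈ R, (((m ^ c : ℕ) : ℝ) ^ k)⁻¹ * Pfun r (ch p G t) = nu r p G R := by
    intro R
    unfold nu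
    rw [mul_sum]
  have hb := balanced_univ (Ln := LnF asg s ∪ AxG ∅) (Ax := AxG G) (J := J) hδ0
    (fun t => (((m ^ c : ℕ) : ℝ) ^ k)⁻¹ * Pfun r (ch p G t)) ?_ π' d h2
    (le_trans (by exact_mod_cast b) hcon.le)
  · rw [hsum] at hb
    have hu := nu_univ h0 h1 hτ hl hT0 hn hG hG2 (Reg_mono _ (Nat.zero_le J) (by simp [Reg])) hx0 hC hx hxk
    linarith
  · intro R hR f hf hRf
    rw [hLs] at hR
    rw [hsum]
    rcases AxG_ruled G hf hRf with rfl | ⟨e, he, hch⟩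
    · simpa [nu] using hδ0
    · exact nu_missing h0 h1 hτ hl hl1 hr hT0 hn hG hG2 hR hx0 hx1 hC hxk e he hch

lemma core_prob {p τ l x s γ B : ℝ} (h0 : 0 < p) (h1 : p ≤ 1) (hτ : 0 < τ) (hτ1 : τ ≤ 1)
    (hl : 0 < l) (hl1 : l ≤ 1)
    {T0 r J : ℕ} (hr : 1 ≤ r) (hT0 : 8 * r ≤ T0)
    (hn : 0 < m ^ c)
    (hx0 : 0 < x) (hx1 : x ≤ 1) (hC : (1 + T0 * τ) ^ k ≤ 2) (hx : (1 / p) ^ (4 * r) * l ≤ x)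
    (hxk : (1 + x) ^ (k ^ 2) ≤ 5 / 4)
    (hE : 2 ^ J * (4 * ((1 / p) ^ (64 * r ^ 2) * l ^ r * (x ^ (4 * r))⁻¹)) < 1 / 2)
    (hB : B ≤ (3 / 2 : ℝ) ^ J)
    (hγ1 : (((m ^ c : ℕ) : ℝ) ^ k * (k * (k * 2 ^ k))) *
        (2 * Real.exp (-((τ * p ^ T0) ^ 2 * p ^ 2 * (m ^ c : ℕ) / 4))) ≤ γ / 2)
    (hγ2 : (((1 + 2 * ((k * (c * m) + 4) ^ ⌊s⌋₊ + ((k * m ^ c) ^ 2 + 1))) ^ J : ℕ)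
          * (2 ^ (k ^ 2) * (2 ^ (k ^ 2) * (2 ^ (k ^ 2) * 2 ^ k)))) *
        ((k : ℝ) ^ 2 * (((m ^ c : ℕ) : ℝ) ^ k *
          (2 * Real.exp (-(l ^ 2 * p ^ 2 * ((m ^ c : ℕ) : ℝ) ^ 2 / 4))))) ≤ γ / 2) :
    1 - γ ≤ probG k (m ^ c) p (fun G => ∀ π : SemProof (k * (c * m)),
      IsRefutation (FregeLines (k * (c * m)) s) (bcliqueC k m c G) π → B ≤ (π.length : ℝ)) := by
  rw [probG_eq, Pr_compl]
  set b : ℕ → ℝ := fun i => (1 / p) ^ (i ^ 2) * (1 + T0 * τ) ^ k with hb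
  set Rg := Reg (LnF (asg (k := k) (m := m) (c := c)) s ∪ AxG ∅) J with hRg
  have p1 := Good1_prob (k := k) (n := m ^ c) h0 h1 hτ hτ1 T0
  have p2 := Good2_prob (k := k) (n := m ^ c) h0 h1 hl hl1 b (fun i => by positivity) Rg
  have hcard : Rg.card ≤ (1 + 2 * ((k * (c * m) + 4) ^ ⌊s⌋₊ + ((k * m ^ c) ^ 2 + 1))) ^ J := by
    refine (Reg_card _ J).trans ?_
    gcongr
    exact (card_union_le _ _).trans (add_le_add (LnF_card _ _) AxG_card)
  have p3 : Pr (potEdges k (m ^ c)) p (fun G => ¬ Good2 p l b Rg G) ≤ γ / 2 := by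
    refine p2.trans (le_trans ?_ hγ2)
    gcongr
  have p4 := Pr_or h0.le h1 (P := potEdges k (m ^ c)) (fun G => ¬ Good1 p τ T0 G) (fun G => ¬ Good2 p l b Rg G)
  have p5 : Pr (potEdges k (m ^ c)) p (fun G => ¬ ∀ π : SemProof (k * (c * m)),
      IsRefutation (FregeLines (k * (c * m)) s) (bcliqueC k m c G) π → B ≤ (π.length : ℝ))
      ≤ Pr (potEdges k (m ^ c)) p (fun G => ¬ Good1 p τ T0 G ∨ ¬ Good2 p l b Rg G) := by
    refine Pr_mono h0.le h1 fun G _ hG => ?_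
    by_contra hh
    push Not at hh
    apply hG
    intro π hπ
    exact hB.trans (core_det h0 h1 hτ.le hl hl1 hr hT0 hn hh.1 hh.2 hx0 hx1 hC hx hxk hE π hπ)
  linarith [p1.trans hγ1]

lemma triv_prob {p γ s B : ℝ} (h0 : 0 ≤ p) (h1 : p ≤ 1) (hγ : 0 ≤ γ) (hn : 0 < m ^ c)
    (hB : B ≤ ((m ^ c : ℕ) : ℝ) ^ 2) :
    1 - γ ≤ probG k (m ^ c) p (fun G => ∀ π : SemProof (k * (c * m)),
      IsRefutation (FregeLines (k * (c * m)) s) (bcliqueC k m c G) π → B ≤ (π.length : ℝ)) := by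
  rw [probG_eq]
  have e := Ex_const (potEdges k (m ^ c)) p 1
  have : Ex (potEdges k (m ^ c)) p (fun _ => 1) ≤ Pr (potEdges k (m ^ c)) p (fun G =>
    ∀ π : SemProof (k * (c * m)),
      IsRefutation (FregeLines (k * (c * m)) s) (bcliqueC k m c G) π → B ≤ (π.length : ℝ)) := by
    unfold Pr
    refine Ex_mono h0 h1 fun G _ => ?_
    rw [if_pos]
    intro π hπ
    exact hB.trans (by exact_mod_cast trivial_bound hn s G π hπ)
  linarith

end

end TF

/-! ## Asymptotics -/
namespace TF

lemma pow_exp_le {a : ℝ} (ha : 0 ≤ a) {y : ℝ} (h : a ≤ Real.exp y) (j : ℕ) :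
    a ^ j ≤ Real.exp (j * y) := by
  rw [Real.exp_nat_mul]
  exact pow_le_pow_left₀ ha h j

lemma two_le_exp : (2:ℝ) ≤ Real.exp 1 := by
  have := Real.add_one_le_exp (1:ℝ)
  linarith

lemma small_factors {n ℓ K : ℝ} (k : ℕ) (hn : n = Real.exp ℓ) (hℓ : 1 ≤ ℓ) (hK : 1 ≤ K)
    (hk : (k : ℝ) ≤ K * ℓ) :
    n ^ k ≤ Real.exp (K * ℓ ^ 2) ∧ (k : ℝ) ≤ Real.exp (K * ℓ) ∧ (2:ℝ) ^ k ≤ Real.exp (K * ℓ) ∧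
    (2:ℝ) ^ (k ^ 2) ≤ Real.exp (K ^ 2 * ℓ ^ 2) := by
  refine ⟨?_, ?_, ?_, ?_⟩
  · refine (pow_exp_le (by rw [hn]; positivity) hn.le k).trans (Real.exp_le_exp.2 ?_)
    nlinarith
  · have := Real.add_one_le_exp (K * ℓ)
    linarith
  · refine (pow_exp_le (by norm_num) two_le_exp k).trans (Real.exp_le_exp.2 ?_)
    linarith
  · refine (pow_exp_le (by norm_num) two_le_exp (k ^ 2)).trans (Real.exp_le_exp.2 ?_)
    push_cast
    rw [mul_one, ← mul_pow]
    exact pow_le_pow_left₀ (by positivity) hk 2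

lemma poly_bound {ℓ K : ℝ} (hℓ : 1 ≤ ℓ) (hK : 1 ≤ K) :
    K * ℓ ^ 2 + 3 * (K ^ 2 * ℓ ^ 2) + 3 * (K * ℓ) + 1 ≤ 8 * K ^ 2 * ℓ ^ 3 := by
  have h1 : 1 ≤ K ^ 2 := one_le_pow₀ hK
  have h2 : K ≤ K ^ 2 := by nlinarith
  have h3 : 1 ≤ ℓ ^ 3 := one_le_pow₀ hℓ
  have h4 : ℓ ^ 2 ≤ ℓ ^ 3 := pow_le_pow_right₀ hℓ (by norm_num)
  have h5 : ℓ ≤ ℓ ^ 3 := le_self_pow₀ hℓ (by norm_num)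
  have e1 : K * ℓ ^ 2 ≤ K ^ 2 * ℓ ^ 3 := by gcongr
  have e2 : K ^ 2 * ℓ ^ 2 ≤ K ^ 2 * ℓ ^ 3 := by gcongr
  have e3 : K * ℓ ≤ K ^ 2 * ℓ ^ 3 := by gcongr
  have e4 : 1 ≤ K ^ 2 * ℓ ^ 3 := by nlinarith
  linarith

lemma gam1 {n ℓ K γ P : ℝ} (k : ℕ) (hn : n = Real.exp ℓ) (hℓ : 1 ≤ ℓ) (hK : 1 ≤ K)
    (hk : (k : ℝ) ≤ K * ℓ) (hP : 4 * (8 * K ^ 2 + 1) * ℓ ^ 3 ≤ P) (hγ : 0 < γ) (hγn : 2 / γ ≤ n) :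
    (n ^ k * (k * (k * 2 ^ k))) * (2 * Real.exp (-(P / 4))) ≤ γ / 2 := by
  obtain ⟨f1, f2, f3, f4⟩ := small_factors k hn hℓ hK hk
  have hn0 : 0 < n := by rw [hn]; positivity
  have h5 : ℓ ≤ ℓ ^ 3 := le_self_pow₀ hℓ (by norm_num)
  calc (n ^ k * (k * (k * 2 ^ k))) * (2 * Real.exp (-(P / 4)))
      ≤ (Real.exp (K * ℓ ^ 2) * (Real.exp (K * ℓ) * (Real.exp (K * ℓ) * Real.exp (K * ℓ)))) *
        (Real.exp 1 * Real.exp (-(P / 4))) := by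
        have := two_le_exp
        gcongr
    _ = Real.exp (K * ℓ ^ 2 + 3 * (K * ℓ) + 1 - P / 4) := by
        simp only [← Real.exp_add]
        congr 1
        ring
    _ ≤ Real.exp (-ℓ) := by
        apply Real.exp_le_exp.2
        have := poly_bound hℓ hK
        have : 0 ≤ K ^ 2 * ℓ ^ 2 := by positivity
        nlinarith
    _ = n⁻¹ := by rw [Real.exp_neg, hn]
    _ ≤ γ / 2 := by
        rw [inv_le_comm₀ hn0 (by positivity), inv_div]
        exact hγn

lemma gam2 {n ℓ K γ P Q : ℝ} (k J S Bs : ℕ) (hn : n = Real.exp ℓ) (hℓ : 1 ≤ ℓ) (hK : 1 ≤ K)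
    (hk : (k : ℝ) ≤ K * ℓ) (hJ : (J : ℝ) ≤ 10 * ℓ ^ 2) (hQ : 1 ≤ Q) (hS : (S : ℝ) ≤ Q)
    (hBs : (Bs : ℝ) ≤ n ^ (4 * (S + 4)))
    (hP : 4 * (201 + 8 * K ^ 2) * ℓ ^ 3 * Q ≤ P) (hγ : 0 < γ) (hγn : 2 / γ ≤ n) :
    ((Bs ^ J : ℕ) * (2 ^ (k ^ 2) * (2 ^ (k ^ 2) * (2 ^ (k ^ 2) * 2 ^ k)))) *
        ((k : ℝ) ^ 2 * (n ^ k * (2 * Real.exp (-(P / 4))))) ≤ γ / 2 := by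
  obtain ⟨f1, f2, f3, f4⟩ := small_factors k hn hℓ hK hk
  have hn0 : 0 < n := by rw [hn]; positivity
  have h5 : ℓ ≤ ℓ ^ 3 := le_self_pow₀ hℓ (by norm_num)
  have h3 : 1 ≤ ℓ ^ 3 := one_le_pow₀ hℓ
  have fB : ((Bs ^ J : ℕ) : ℝ) ≤ Real.exp (200 * ℓ ^ 3 * Q) := by
    push_cast
    have hB1 : (Bs : ℝ) ≤ Real.exp (20 * Q * ℓ) := by
      refine hBs.trans ((pow_exp_le hn0.le hn.le _).trans (Real.exp_le_exp.2 ?_))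
      push_cast
      have h9 : (S : ℝ) + 4 ≤ 5 * Q := by linarith
      nlinarith
    refine (pow_exp_le (by positivity) hB1 J).trans (Real.exp_le_exp.2 ?_)
    calc (J : ℝ) * (20 * Q * ℓ) ≤ (10 * ℓ ^ 2) * (20 * Q * ℓ) := by gcongr
      _ = _ := by ring
  have hk2 : (k : ℝ) ^ 2 ≤ Real.exp (K * ℓ) * Real.exp (K * ℓ) := by
    rw [pow_two]
    gcongr
  calc _ ≤ (Real.exp (200 * ℓ ^ 3 * Q) * (Real.exp (K ^ 2 * ℓ ^ 2) * (Real.exp (K ^ 2 * ℓ ^ 2) *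
          (Real.exp (K ^ 2 * ℓ ^ 2) * Real.exp (K * ℓ))))) *
        ((Real.exp (K * ℓ) * Real.exp (K * ℓ)) *
          (Real.exp (K * ℓ ^ 2) * (Real.exp 1 * Real.exp (-(P / 4))))) := by
        have := two_le_exp
        gcongr
    _ = Real.exp (200 * ℓ ^ 3 * Q + (K * ℓ ^ 2 + 3 * (K ^ 2 * ℓ ^ 2) + 3 * (K * ℓ) + 1) - P / 4) := by
        simp only [← Real.exp_add]
        congr 1
        ring
    _ ≤ Real.exp (-ℓ) := by
        apply Real.exp_le_exp.2
        have h6 := poly_bound hℓ hK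
        have h7 : 8 * K ^ 2 * ℓ ^ 3 ≤ 8 * K ^ 2 * ℓ ^ 3 * Q := le_mul_of_one_le_right (by positivity) hQ
        have h8 : ℓ ^ 3 ≤ ℓ ^ 3 * Q := le_mul_of_one_le_right (by positivity) hQ
        nlinarith
    _ = n⁻¹ := by rw [Real.exp_neg, hn]
    _ ≤ γ / 2 := by
        rw [inv_le_comm₀ hn0 (by positivity), inv_div]
        exact hγn

lemma base_bound {n k c m S : ℕ} (hn : 2 ≤ n) (hk : k ≤ n) (hc : c ≤ n) (hm : m ≤ n) :
    1 + 2 * ((k * (c * m) + 4) ^ S + ((k * n) ^ 2 + 1)) ≤ n ^ (4 * (S + 4)) := by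
  have hX : k * (c * m) + 4 ≤ n ^ 4 := by
    have : k * (c * m) ≤ n * (n * n) := by gcongr
    have h2 : 2 * (n * (n * n)) ≤ n * (n * (n * n)) := Nat.mul_le_mul_right _ hn
    have h3 : 2 * 2 * 2 ≤ n * n * n := by gcongr
    nlinarith
  have h1 : (k * (c * m) + 4) ^ S ≤ n ^ (4 * S) := by
    rw [pow_mul]
    gcongr
  have h2 : (k * n) ^ 2 ≤ n ^ 4 := by
    calc (k * n) ^ 2 ≤ (n * n) ^ 2 := by gcongr
      _ = n ^ 4 := by ring
  have h16 : 2 ^ 4 ≤ n ^ 4 := by gcongr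
  have hS : 1 ≤ n ^ (4 * S) := Nat.one_le_pow _ _ (by omega)
  have e : n ^ (4 * (S + 4)) = n ^ (4 * S) * (n ^ 4 * (n ^ 4 * (n ^ 4 * n ^ 4))) := by ring
  rw [e]
  generalize n ^ (4 * S) = a at *
  generalize n ^ 4 = b at *
  have h3 : b * 1 ≤ b * (b * (b * b)) := by
    gcongr
    have : 1 ≤ b * b := by nlinarith
    nlinarith
  have h4 : 16 * b ≤ b * (b * (b * b)) := by
    have : 1 * 16 ≤ (b * b) * b := by nlinarith
    nlinarith
  have h5 : a * (16 * b) ≤ a * (b * (b * (b * b))) := Nat.mul_le_mul_left _ h4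
  nlinarith

end TF

namespace TF

lemma clog_le_self' {N : ℕ} (h : 1 ≤ N) : Nat.clog 2 N ≤ N := by
  apply Nat.clog_le_of_le_pow
  exact Nat.lt_two_pow_self.le

/-- the range of `n` on which the asymptotic estimates hold -/
lemma eventual (A a b : ℝ) (ha : 0 < a) : ∃ n₀ : ℕ, ∀ N : ℕ, n₀ ≤ N →
    A * Real.log N ^ 3 ≤ Real.exp (a * Real.log N) ∧ 1 ≤ Real.log N ∧ b ≤ (N : ℝ) ∧ 1 ≤ N := by
  have h1 : ∀ᶠ y : ℝ in Filter.atTop, A * y ^ 3 ≤ Real.exp (a * y) := by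
    have h := isLittleO_pow_exp_pos_mul_atTop 3 ha
    have h2 := h.bound (c := 1 / (|A| + 1)) (by positivity)
    filter_upwards [h2, Filter.eventually_ge_atTop 0] with y hy hy0
    rw [Real.norm_of_nonneg (by positivity), Real.norm_of_nonneg (by positivity)] at hy
    rw [div_mul_eq_mul_div, one_mul, le_div_iff₀ (by positivity)] at hy
    have h3 : A * y ^ 3 ≤ |A| * y ^ 3 := by
      gcongr
      exact le_abs_self A
    have : 0 ≤ y ^ 3 := by positivity
    nlinarith
  have hlog : Filter.Tendsto (fun N : ℕ => Real.log N) Filter.atTop Filter.atTop :=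
    Real.tendsto_log_atTop.comp tendsto_natCast_atTop_atTop
  have h := (hlog.eventually h1).and ((hlog.eventually (Filter.eventually_ge_atTop 1)).and
    ((tendsto_natCast_atTop_atTop (R := ℝ)).eventually (Filter.eventually_ge_atTop b) |>.and
      (Filter.eventually_ge_atTop 1)))
  obtain ⟨n₀, hn₀⟩ := Filter.eventually_atTop.1 h
  exact ⟨n₀, fun N hN => hn₀ N hN⟩

/-- choice of the number of rounds `J` -/
lemma chooseJ {y : ℝ} (hy : 0 ≤ y) : ∃ J : ℕ, Real.exp y ≤ (3 / 2 : ℝ) ^ J ∧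
    (2 : ℝ) ^ J ≤ 2 * Real.exp (2 * y) ∧ (J : ℝ) ≤ 3 * y + 1 := by
  have hl2 : 2 / 3 < Real.log 2 := by have := Real.log_two_gt_d9; linarith
  have hl2p : 0 < Real.log 2 := by linarith
  refine ⟨⌈2 * y / Real.log 2⌉₊, ?_, ?_, ?_⟩
  · have h1 : 2 * y / Real.log 2 ≤ (⌈2 * y / Real.log 2⌉₊ : ℝ) := Nat.le_ceil _
    rw [div_le_iff₀ hl2p] at h1
    have h2 : Real.log 2 ≤ 2 * Real.log (3 / 2) := by
      rw [show (2 : ℝ) * Real.log (3 / 2) = Real.log ((3 / 2) ^ 2) by rw [Real.log_pow]; norm_num]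
      exact Real.log_le_log (by norm_num) (by norm_num)
    rw [← Real.exp_log (show (0 : ℝ) < 3 / 2 by norm_num), ← Real.exp_nat_mul, Real.exp_le_exp]
    have : (0 : ℝ) ≤ (⌈2 * y / Real.log 2⌉₊ : ℝ) := by positivity
    nlinarith
  · have h1 : (⌈2 * y / Real.log 2⌉₊ : ℝ) < 2 * y / Real.log 2 + 1 := Nat.ceil_lt_add_one (by positivity)
    calc (2 : ℝ) ^ ⌈2 * y / Real.log 2⌉₊ = Real.exp (⌈2 * y / Real.log 2⌉₊ * Real.log 2) := by
          rw [Real.exp_nat_mul, Real.exp_log (by norm_num)]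
      _ ≤ Real.exp ((2 * y / Real.log 2 + 1) * Real.log 2) := by gcongr
      _ = Real.exp (Real.log 2 + 2 * y) := by congr 1; field_simp; ring
      _ = _ := by rw [Real.exp_add, Real.exp_log (by norm_num)]
  · have h1 : (⌈2 * y / Real.log 2⌉₊ : ℝ) < 2 * y / Real.log 2 + 1 := Nat.ceil_lt_add_one (by positivity)
    have h2 : 2 * y / Real.log 2 ≤ 3 * y := by
      rw [div_le_iff₀ hl2p]
      nlinarith
    linarith

set_option maxHeartbeats 2000000 in
lemma main_case {δ η c' K A γ s ℓ : ℝ} {m c k D : ℕ} (hδ : 0 < δ) (hδ1 : δ ≤ 1 / 16)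
    (hη : η = δ / 1000) (hc' : c' = δ * η / 100) (hK : 1 ≤ K) (hA : A = 1000 * (1 + K ^ 2))
    (hγ : 0 < γ) (hN : ((m ^ c : ℕ) : ℝ) = Real.exp ℓ) (hℓ : 1 ≤ ℓ)
    (hAl : A * ℓ ^ 3 ≤ Real.exp (δ / 16 * ℓ)) (hγN : 2 / γ ≤ ((m ^ c : ℕ) : ℝ))
    (hD1 : 1 ≤ D) (hD : (D : ℝ) ≤ 3 * ℓ) (hc1 : 1 ≤ c) (hc : c ≤ m ^ c)
    (hk : (k : ℝ) ≤ K * ℓ) (hs : s ≤ Real.exp ((2 - 16 * δ) * ℓ)) (hcD : 2 < c' * D) :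
    1 - γ ≤ probG k (m ^ c) (Real.exp (-(2 / D * ℓ))) (fun G =>
      ∀ π, IsRefutation (FregeLines (k * (c * m)) s) (bcliqueC k m c G) π →
        Real.exp (c' * D * ℓ) ≤ (π.length : ℝ)) := by
  have hη0 : 0 < η := by rw [hη]; positivity
  have hc0 : 0 < c' := by rw [hc']; positivity
  have hDp : (0 : ℝ) < D := by exact_mod_cast hD1
  set u : ℝ := 2 / D with hu
  have hu0 : 0 < u := by positivity
  have huD : u * D = 2 := by rw [hu]; field_simp
  have huc : u < c' := by
    rw [hu, div_lt_iff₀ hDp]; exact hcD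
  have hη1 : η ≤ 1 / 16000 := by rw [hη]; linarith
  have hcs : c' ≤ δ / 1000 := by
    rw [hc']; nlinarith
  have hδηD : 200 < δ * η * D := by
    rw [hc'] at hcD; linarith
  have hηD : 3200 < η * D := by nlinarith [mul_pos hη0 hDp]
  set r : ℕ := ⌊η * D⌋₊ with hr
  have hr1 : (r : ℝ) ≤ η * D := Nat.floor_le (by positivity)
  have hr2 : η * D / 2 ≤ (r : ℝ) := by
    have := Nat.lt_floor_add_one (η * D)
    rw [← hr] at this
    linarith
  have hrp : (1 : ℝ) ≤ r := by linarith
  have hr3 : 1 ≤ r := by exact_mod_cast hrp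
  have hru : r * u ≤ 2 * η := by nlinarith
  have hℓ3 : 1 ≤ ℓ ^ 3 := one_le_pow₀ hℓ
  have hℓ2 : 1 ≤ ℓ ^ 2 := one_le_pow₀ hℓ
  have hA1 : 0 < A := by rw [hA]; positivity
  have hKK : K ≤ K ^ 2 := by nlinarith
  have hN0 : 0 < m ^ c := by
    have : (0 : ℝ) < ((m ^ c : ℕ) : ℝ) := by rw [hN]; positivity
    exact_mod_cast this
  obtain ⟨J, hJ1, hJ2, hJ3⟩ := chooseJ (y := c' * D * ℓ) (by positivity)
  have hJ4 : (J : ℝ) ≤ 10 * ℓ ^ 2 := by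
    have h1 : c' * D * ℓ ≤ 1 * (3 * ℓ) * ℓ := by
      gcongr
      linarith
    nlinarith
  have hexm : ∀ a : ℝ, δ / 16 ≤ a → A * ℓ ^ 3 ≤ Real.exp (a * ℓ) := fun a ha =>
    hAl.trans (Real.exp_le_exp.2 (by nlinarith))
  have hkN : k ≤ m ^ c := by
    have h1 : (k : ℝ) ≤ ((m ^ c : ℕ) : ℝ) := by
      rw [hN]
      have h2 := hexm 1 (by linarith)
      rw [one_mul] at h2
      have h3 : K * ℓ ≤ A * ℓ ^ 3 := by
        have : ℓ ≤ ℓ ^ 3 := le_self_pow₀ hℓ (by norm_num)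
        gcongr
        rw [hA]; linarith
      linarith
    exact_mod_cast h1
  have hmN : m ≤ m ^ c := Nat.le_self_pow (by omega) m
  have hN2 : 2 ≤ m ^ c := by
    have h1 : (2 : ℝ) ≤ ((m ^ c : ℕ) : ℝ) := by
      rw [hN]
      exact two_le_exp.trans (Real.exp_le_exp.2 hℓ)
    exact_mod_cast h1
  have hex1 : ∀ a : ℝ, 0 ≤ a → Real.exp (-(a * ℓ)) ≤ 1 := fun a ha => by
    rw [Real.exp_le_one_iff]; nlinarith
  have hinv : 1 / Real.exp (-(u * ℓ)) = Real.exp (u * ℓ) := by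
    rw [Real.exp_neg, one_div, inv_inv]
  refine core_prob (τ := Real.exp (-(1 / 8 * ℓ))) (l := Real.exp (-(δ * ℓ)))
    (x := Real.exp (-(δ / 16 * ℓ))) (T0 := 8 * r) (r := r) (J := J)
    (Real.exp_pos _) (hex1 _ hu0.le) (Real.exp_pos _) (hex1 _ (by norm_num)) (Real.exp_pos _)
    (hex1 _ hδ.le) hr3 le_rfl hN0 (Real.exp_pos _) (hex1 _ (by positivity)) ?_ ?_ ?_ ?_ hJ1 ?_ ?_
  · -- hC
    have h1 := hexm (1 / 8) (by linarith)
    set e := Real.exp (1 / 8 * ℓ) with he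
    have he0 : 0 < e := Real.exp_pos _
    rw [Real.exp_neg, ← he]
    have h2 : ((8 * r : ℕ) : ℝ) ≤ ℓ := by
      push_cast
      nlinarith
    calc (1 + ((8 * r : ℕ) : ℝ) * e⁻¹) ^ k ≤ (Real.exp (((8 * r : ℕ) : ℝ) * e⁻¹)) ^ k := by
          gcongr
          rw [add_comm]; exact Real.add_one_le_exp _
      _ = Real.exp (k * (((8 * r : ℕ) : ℝ) * e⁻¹)) := (Real.exp_nat_mul _ _).symm
      _ ≤ Real.exp (Real.log 2) := by
          apply Real.exp_le_exp.2
          have hl2 := Real.log_two_gt_d9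
          have h3 : k * (((8 * r : ℕ) : ℝ) * e⁻¹) ≤ K * ℓ * (ℓ * e⁻¹) := by gcongr
          have h4 : K * ℓ * (ℓ * e⁻¹) ≤ 1 / 2 := by
            rw [← mul_assoc, ← div_eq_mul_inv, div_le_iff₀ he0]
            have : ℓ ^ 2 ≤ ℓ ^ 3 := pow_le_pow_right₀ hℓ (by norm_num)
            have h5 : 2 * K * ℓ ^ 2 ≤ A * ℓ ^ 3 := by
              gcongr
              rw [hA]; linarith
            nlinarith
          linarith
      _ = 2 := Real.exp_log (by norm_num)
  · -- hx
    rw [hinv, ← Real.exp_nat_mul, ← Real.exp_add]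
    apply Real.exp_le_exp.2
    push_cast
    have h1 : 4 * (r * u) - δ ≤ -(δ / 16) := by rw [hη] at hru; linarith
    nlinarith
  · -- hxk
    have h1 := hexm (δ / 16) le_rfl
    set e := Real.exp (δ / 16 * ℓ) with he
    have he0 : 0 < e := Real.exp_pos _
    rw [Real.exp_neg, ← he]
    calc (1 + e⁻¹) ^ (k ^ 2) ≤ (Real.exp (e⁻¹)) ^ (k ^ 2) := by
          gcongr
          rw [add_comm]; exact Real.add_one_le_exp _
      _ = Real.exp ((k ^ 2 : ℕ) * e⁻¹) := by rw [Real.exp_nat_mul]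
      _ ≤ Real.exp (1 / 5) := by
          apply Real.exp_le_exp.2
          rw [← div_eq_mul_inv, div_le_iff₀ he0]
          push_cast
          have h3 : (k : ℝ) ^ 2 ≤ (K * ℓ) ^ 2 := by gcongr
          have : ℓ ^ 2 ≤ ℓ ^ 3 := pow_le_pow_right₀ hℓ (by norm_num)
          have h5 : (5 * K ^ 2) * ℓ ^ 2 ≤ A * ℓ ^ 3 := by
            gcongr
            rw [hA]; linarith
          nlinarith
      _ ≤ 5 / 4 := by
          have h6 := Real.add_one_le_exp (-(1 / 5) : ℝ)
          rw [Real.exp_neg] at h6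
          have h7 : (4 / 5 : ℝ) ≤ (Real.exp (1 / 5))⁻¹ := by linarith
          rw [le_inv_comm₀ (by norm_num) (Real.exp_pos _)] at h7
          linarith
  · -- hE
    rw [hinv, ← Real.exp_nat_mul, ← Real.exp_nat_mul, ← Real.exp_nat_mul, ← Real.exp_neg,
      ← Real.exp_add, ← Real.exp_add]
    push_cast
    set Z := Real.exp (64 * (r : ℝ) ^ 2 * (u * ℓ) + r * -(δ * ℓ) + -(4 * r * -(δ / 16 * ℓ))) with hZ
    have hZ1 : Z ≤ Real.exp (-(δ * η * D / 4 * ℓ)) := by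
      rw [hZ]
      apply Real.exp_le_exp.2
      have h1 : 64 * (r : ℝ) * (r * u) ≤ 64 * r * (2 * η) := by gcongr
      have h2 : 64 * (r : ℝ) * (r * u) + r * (-δ) + 4 * r * (δ / 16) ≤ -(δ * r / 2) := by
        rw [hη] at h1
        nlinarith
      have h3 : -(δ * r / 2) ≤ -(δ * η * D / 4) := by nlinarith
      have h4 := mul_le_mul_of_nonneg_right (h2.trans h3) (show 0 ≤ ℓ by linarith)
      linarith
    calc (2 : ℝ) ^ J * (4 * Z) ≤ (2 * Real.exp (2 * (c' * D * ℓ))) *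
          (4 * Real.exp (-(δ * η * D / 4 * ℓ))) := by gcongr
      _ = 8 * Real.exp (2 * (c' * D * ℓ) - δ * η * D / 4 * ℓ) := by
          rw [sub_eq_add_neg, Real.exp_add]; ring
      _ ≤ 8 * Real.exp (-40) := by
          gcongr
          rw [hc']
          nlinarith
      _ < 1 / 2 := by
          rw [Real.exp_neg]
          have h6 := Real.add_one_le_exp (40 : ℝ)
          have h7 : (Real.exp 40)⁻¹ ≤ (41 : ℝ)⁻¹ := by
            gcongr
            linarith
          norm_num at h7 ⊢
          linarith
  · -- hγ1
    refine gam1 k hN hℓ hK hk ?_ hγ hγN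
    rw [hN, mul_pow, ← Real.exp_nat_mul, ← Real.exp_nat_mul, ← Real.exp_nat_mul, ← Real.exp_nat_mul,
      ← Real.exp_add, ← Real.exp_add, ← Real.exp_add]
    have h1 := hexm (1 / 2) (by linarith)
    have h2 : 4 * (8 * K ^ 2 + 1) * ℓ ^ 3 ≤ A * ℓ ^ 3 := by
      gcongr
      rw [hA]; linarith
    refine (h2.trans h1).trans (Real.exp_le_exp.2 ?_)
    push_cast
    have h3 : (1 / 2 : ℝ) ≤ 2 * (-(1 / 8)) + 2 * (8 * -(r * u)) + 2 * -u + 1 := by linarith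
    have h4 := mul_le_mul_of_nonneg_right h3 (show 0 ≤ ℓ by linarith)
    linarith
  · -- hγ2
    have hQ : 1 ≤ Real.exp ((2 - 16 * δ) * ℓ) := by
      rw [Real.one_le_exp_iff]
      apply mul_nonneg <;> linarith
    have hS : ((⌊s⌋₊ : ℕ) : ℝ) ≤ Real.exp ((2 - 16 * δ) * ℓ) := by
      rcases le_total 0 s with h | h
      · exact (Nat.floor_le h).trans hs
      · rw [Nat.floor_of_nonpos h]
        simp only [Nat.cast_zero]; positivity
    have hBs := base_bound (S := ⌊s⌋₊) hN2 hkN hc hmN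
    refine gam2 k J ⌊s⌋₊ _ hN hℓ hK hk hJ4 hQ hS (by exact_mod_cast hBs) ?_ hγ hγN
    rw [hN, ← Real.exp_nat_mul, ← Real.exp_nat_mul, ← Real.exp_nat_mul, ← Real.exp_add,
      ← Real.exp_add]
    have h1 := hexm (13 * δ) (by linarith)
    have h2 : 4 * (201 + 8 * K ^ 2) * ℓ ^ 3 ≤ A * ℓ ^ 3 := by
      gcongr
      rw [hA]; linarith
    calc _ ≤ Real.exp (13 * δ * ℓ) * Real.exp ((2 - 16 * δ) * ℓ) := by
          gcongr
          exact h2.trans h1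
      _ = Real.exp ((2 - 3 * δ) * ℓ) := by rw [← Real.exp_add]; congr 1; ring
      _ ≤ _ := by
          apply Real.exp_le_exp.2
          push_cast
          have h3 : 2 - 3 * δ ≤ 2 * (-δ) + 2 * (-u) + 2 * 1 := by linarith
          have h4 := mul_le_mul_of_nonneg_right h3 (show 0 ≤ ℓ by linarith)
          linarith

end TF

/-- Corollary 4.10: for every `ε > 0` and constant `β > 0` there is a
constant `c' > 0` such that for all integers `c, D, k` and `n = m^c` with `D ≤ 2 log n`,
`1 ≤ c ≤ ⌈log n⌉` and `k ≤ βD`: if `G ∼ G(n,k,n^{−2/D})`, then with probability tending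
to `1` as `n → ∞` every semantic tree-like Frege refutation of `bclique_c(G,k)` with
lines of size at most `n^{2−ε}` has length at least `n^{c'·D}`. -/
theorem treelike_frege_lower_bound :
    ∀ ε > (0 : ℝ), ∀ β > (0 : ℝ), ∃ c' > (0 : ℝ), ∀ γ > (0 : ℝ), ∃ n₀ : ℕ,
      ∀ m c k D : ℕ, n₀ ≤ m ^ c →
        1 ≤ D → (D : ℝ) ≤ 2 * Real.logb 2 (m ^ c : ℕ) →
        1 ≤ c → c ≤ Nat.clog 2 (m ^ c) → (k : ℝ) ≤ β * (D : ℝ) →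
        1 - γ ≤
          probG k (m ^ c) (((m ^ c : ℕ) : ℝ) ^ (-(2 : ℝ) / (D : ℝ))) (fun G =>
            ∀ π : SemProof (k * (c * m)),
              IsRefutation (FregeLines (k * (c * m)) (((m ^ c : ℕ) : ℝ) ^ ((2 : ℝ) - ε)))
                (bcliqueC k m c G) π →
              ((m ^ c : ℕ) : ℝ) ^ (c' * (D : ℝ)) ≤ (π.length : ℝ)) := by
  intro ε hε β hβ
  obtain ⟨δ, hδ, hδ1, hδε⟩ : ∃ δ : ℝ, 0 < δ ∧ δ ≤ 1 / 16 ∧ 16 * δ ≤ ε :=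
    ⟨min ε 1 / 16, by positivity, by have := min_le_right ε 1; linarith,
      by have := min_le_left ε 1; linarith⟩
  obtain ⟨K, hK, hKβ⟩ : ∃ K : ℝ, 1 ≤ K ∧ 3 * β ≤ K := ⟨max 1 (3 * β), le_max_left _ _, le_max_right _ _⟩
  refine ⟨δ * (δ / 1000) / 100, by positivity, fun γ hγ => ?_⟩
  obtain ⟨n₀, hn₀⟩ := TF.eventual (1000 * (1 + K ^ 2)) (δ / 16) (2 / γ) (by positivity)
  refine ⟨n₀, fun m c k D hn hD1 hD hc1 hc hk => ?_⟩
  obtain ⟨h1, hℓ, hγN, hN1⟩ := hn₀ _ hn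
  set ℓ := Real.log ((m ^ c : ℕ) : ℝ) with hℓd
  have hNp : (0 : ℝ) < ((m ^ c : ℕ) : ℝ) := by exact_mod_cast hN1
  have hN : ((m ^ c : ℕ) : ℝ) = Real.exp ℓ := (Real.exp_log hNp).symm
  have hrp : ∀ a : ℝ, ((m ^ c : ℕ) : ℝ) ^ a = Real.exp (a * ℓ) := fun a => by
    rw [Real.rpow_def_of_pos hNp, mul_comm]
  have hDp : (0 : ℝ) < D := by exact_mod_cast hD1
  have hp : ((m ^ c : ℕ) : ℝ) ^ (-(2 : ℝ) / (D : ℝ)) = Real.exp (-(2 / D * ℓ)) := by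
    rw [hrp]; congr 1; ring
  rw [hp]
  by_cases hcD : δ * (δ / 1000) / 100 * (D : ℝ) ≤ 2
  · refine TF.triv_prob (Real.exp_pos _).le ?_ hγ.le hN1 ?_
    · rw [Real.exp_le_one_iff]
      have : 0 ≤ 2 / (D : ℝ) * ℓ := by positivity
      linarith
    · rw [← Real.rpow_natCast (((m ^ c : ℕ) : ℝ)) 2]
      exact Real.rpow_le_rpow_of_exponent_le (by exact_mod_cast hN1) (by exact_mod_cast hcD)
  · push Not at hcD
    have hD3 : (D : ℝ) ≤ 3 * ℓ := by
      have hl2 := Real.log_two_gt_d9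
      refine hD.trans ?_
      rw [Real.logb, ← hℓd, ← mul_div_assoc, div_le_iff₀ (by linarith)]
      nlinarith
    rw [hrp (δ * (δ / 1000) / 100 * (D : ℝ))]
    refine TF.main_case hδ hδ1 rfl rfl hK rfl hγ hN hℓ h1 hγN hD1 hD3 hc1
      (hc.trans (TF.clog_le_self' hN1)) ?_ ?_ hcD
    · nlinarith
    · rw [hrp]
      apply Real.exp_le_exp.2
      nlinarith
end

section
/- There is a function 'core' mapping each graph H on vertex set [k] to one of its cores with the following property: for every graph F in the image of core, |V(E(F))| ≤ 3·vc(F), and there exists an edge set E*_F ⊆ V(E(F)) × ([k] ∖ V(E(F))) such that for every graph H on [k], core(H) = F if and only if E(H) = E(F) ⊔ E for some E ⊆ E*_F. -/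
/-- The set of non-isolated vertices `V(E(H))` of a graph `H` on `[k]`. -/
def nonIsolated {k : ℕ} (H : Finset (Sym2 (Fin k))) : Finset (Fin k) :=
  Finset.univ.filter fun v => ∃ e ∈ H, v ∈ e

/-- `F` is a vertex-induced subgraph of `H`: for some `S ⊆ [k]`,
`E(F) = {e ∈ E(H) : e ⊆ S}`. -/
def IsInduced {k : ℕ} (F H : Finset (Sym2 (Fin k))) : Prop :=
  ∃ S : Finset (Fin k), ∀ e, e ∈ F ↔ e ∈ H ∧ ∀ v ∈ e, v ∈ S

/-- `F` is a core of `H`: a vertex-induced subgraph of `H` every minimum vertex cover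
of which is also a vertex cover of `H`. -/
def IsCore {k : ℕ} (F H : Finset (Sym2 (Fin k))) : Prop :=
  IsInduced F H ∧ ∀ S : Finset (Fin k), IsCover F S → S.card = vc F → IsCover H S

/-- A graph on `[k]` (identified with its edge set) has no diagonal "edges". -/
def IsGraph {k : ℕ} (H : Finset (Sym2 (Fin k))) : Prop := ∀ e ∈ H, ¬ e.IsDiag

namespace CoreMap

open Finset

variable {k : ℕ}

lemma cover_iff (H : Finset (Sym2 (Fin k))) (S : Finset (Fin k)) :
    IsCover H S ↔ ∀ a b, s(a, b) ∈ H → a ∈ S ∨ b ∈ S := by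
  constructor
  · intro h a b hab
    obtain ⟨v, hv, hve⟩ := h _ hab
    rcases Sym2.mem_iff.1 hve with rfl | rfl
    · exact Or.inl hv
    · exact Or.inr hv
  · intro h e
    induction e using Sym2.ind with
    | _ a b =>
      intro he
      rcases h a b he with h | h
      · exact ⟨a, h, by simp⟩
      · exact ⟨b, h, by simp⟩

/-- Minimum vertex covers. -/
def IsMin (H : Finset (Sym2 (Fin k))) (S : Finset (Fin k)) : Prop :=
  IsCover H S ∧ S.card = vc H

lemma vc_le {H : Finset (Sym2 (Fin k))} {S : Finset (Fin k)} (h : IsCover H S) :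
    vc H ≤ S.card := Nat.sInf_le ⟨S, rfl, h⟩

lemma exists_min (H : Finset (Sym2 (Fin k))) : ∃ S, IsMin H S := by
  have : vc H ∈ {m | ∃ S : Finset (Fin k), S.card = m ∧ IsCover H S} := by
    apply Nat.sInf_mem
    exact ⟨_, Finset.univ, rfl, (cover_iff _ _).2 (by simp)⟩
  obtain ⟨S, h1, h2⟩ := this
  exact ⟨S, h2, h1⟩

lemma min_iff {F H : Finset (Sym2 (Fin k))} (hFH : F ⊆ H)
    (h : ∀ S, IsMin F S → IsCover H S) (S : Finset (Fin k)) : IsMin F S ↔ IsMin H S := by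
  have hvc : vc F = vc H := by
    apply le_antisymm
    · obtain ⟨T, hT⟩ := exists_min H
      rw [← hT.2]
      exact vc_le fun e he => hT.1 e (hFH he)
    · obtain ⟨T, hT⟩ := exists_min F
      rw [← hT.2]
      exact vc_le (h T hT)
  constructor
  · intro hS
    exact ⟨h S hS, hS.2.trans hvc⟩
  · intro hS
    exact ⟨fun e he => hS.1 e (hFH he), hS.2.trans hvc.symm⟩

open Classical in
/-- Union of all minimum covers. -/
noncomputable def U (H : Finset (Sym2 (Fin k))) : Finset (Fin k) :=
  univ.filter fun v => ∃ S, IsMin H S ∧ v ∈ S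

open Classical in
/-- Intersection of all minimum covers. -/
noncomputable def C (H : Finset (Sym2 (Fin k))) : Finset (Fin k) :=
  univ.filter fun v => ∀ S, IsMin H S → v ∈ S

lemma mem_U {H : Finset (Sym2 (Fin k))} {v : Fin k} : v ∈ U H ↔ ∃ S, IsMin H S ∧ v ∈ S := by
  simp [U]

lemma mem_C {H : Finset (Sym2 (Fin k))} {v : Fin k} : v ∈ C H ↔ ∀ S, IsMin H S → v ∈ S := by
  simp [C]

lemma C_sub_U (H : Finset (Sym2 (Fin k))) : C H ⊆ U H := by
  intro v hv
  obtain ⟨S, hS⟩ := exists_min H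
  exact mem_U.2 ⟨S, hS, mem_C.1 hv S hS⟩

lemma nb_mem_C {H : Finset (Sym2 (Fin k))} {w c : Fin k} (hw : w ∉ U H) (h : s(w, c) ∈ H) :
    c ∈ C H := by
  rw [mem_C]
  intro S hS
  rcases (cover_iff _ _).1 hS.1 _ _ h with h1 | h1
  · exact absurd (mem_U.2 ⟨S, hS, h1⟩) hw
  · exact h1

lemma mem_nonIsolated {H : Finset (Sym2 (Fin k))} {v : Fin k} :
    v ∈ nonIsolated H ↔ ∃ u, s(v, u) ∈ H := by
  simp only [nonIsolated, mem_filter, mem_univ, true_and]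
  constructor
  · rintro ⟨e, he, hv⟩
    obtain ⟨u, rfl⟩ := Sym2.mem_iff_exists.1 hv
    exact ⟨u, he⟩
  · rintro ⟨u, hu⟩
    exact ⟨_, hu, by simp⟩

lemma U_sub_nonIsolated (H : Finset (Sym2 (Fin k))) : U H ⊆ nonIsolated H := by
  intro v hv
  obtain ⟨S, hS, hvS⟩ := mem_U.1 hv
  by_contra hn
  have hc : IsCover H (S.erase v) := by
    rw [cover_iff]
    intro a b hab
    have ha : a ≠ v := by
      rintro rfl
      exact hn (mem_nonIsolated.2 ⟨b, hab⟩)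
    have hb : b ≠ v := by
      rintro rfl
      exact hn (mem_nonIsolated.2 ⟨a, by rwa [Sym2.eq_swap]⟩)
    have := (cover_iff _ _).1 hS.1 _ _ hab
    simpa [ha, hb] using this
  have h1 := vc_le hc
  have h2 := Finset.card_erase_lt_of_mem hvS
  have h3 := hS.2
  omega

lemma U_add_C_aux (H : Finset (Sym2 (Fin k))) (S₀ : Finset (Fin k)) (h₀ : IsMin H S₀)
    (Γ : Finset (Finset (Fin k))) :
    (∀ S ∈ Γ, IsMin H S) →
    ((insert S₀ Γ).sup id).card + ((insert S₀ Γ).inf id).card ≤ 2 * vc H := by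
  induction Γ using Finset.induction_on with
  | empty =>
    intro _
    simp [h₀.2]
    omega
  | insert S Γ hS ih =>
    intro h
    have ih := ih fun T hT => h T (mem_insert_of_mem hT)
    rw [Finset.insert_comm, Finset.sup_insert, Finset.inf_insert]
    have hSm := h S (mem_insert_self _ _)
    have hmem : ∀ T ∈ insert S₀ Γ, IsMin H T := by
      intro T hT
      rcases mem_insert.1 hT with rfl | hT
      · exact h₀
      · exact h T (mem_insert_of_mem hT)
    set P := (insert S₀ Γ).sup id with hP
    set Q := (insert S₀ Γ).inf id with hQ
    have hQP : Q ⊆ P := by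
      have h1 : Q ≤ id S₀ := Finset.inf_le (mem_insert_self _ _)
      have h2 : id S₀ ≤ P := Finset.le_sup (f := id) (mem_insert_self _ _)
      exact h1.trans h2
    have key : ∀ a b, s(a, b) ∈ H → a ∉ P → b ∈ Q := by
      intro a b hab ha
      rw [hQ, Finset.mem_inf]
      intro T hT
      rcases (cover_iff _ _).1 (hmem T hT).1 _ _ hab with h1 | h1
      · exact absurd ((Finset.le_sup (f := id) hT : id T ≤ P) h1) ha
      · exact h1
    have hcov : IsCover H ((S ∩ P) ∪ (Q \ S)) := by
      rw [cover_iff]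
      intro a b hab
      have k1 := key a b hab
      have k2 := key b a (by rwa [Sym2.eq_swap])
      have k3 := (cover_iff _ _).1 hSm.1 _ _ hab
      have k4 := @hQP a
      have k5 := @hQP b
      simp only [mem_union, mem_inter, mem_sdiff]
      clear_value P Q
      clear key ih hmem h hS hSm h₀ hP hQ hQP
      by_cases c1 : a ∈ P <;> by_cases c2 : b ∈ P <;> by_cases c3 : a ∈ S <;>
        by_cases c4 : b ∈ S <;> simp_all
    have h1 := vc_le hcov
    have h2 := Finset.card_union_le (S ∩ P) (Q \ S)
    have h3 := hSm.2
    have h4 := Finset.card_union_add_card_inter S P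
    have h5 := Finset.card_inter_add_card_sdiff Q S
    have h6 : (S ∩ Q).card = (Q ∩ S).card := by rw [Finset.inter_comm]
    change (S ∪ P).card + (S ∩ Q).card ≤ _
    omega

lemma U_add_C (H : Finset (Sym2 (Fin k))) : (U H).card + (C H).card ≤ 2 * vc H := by
  classical
  obtain ⟨S₀, h₀⟩ := exists_min H
  have := U_add_C_aux H S₀ h₀ (univ.filter fun S => IsMin H S) (by simp)
  have hi : insert S₀ (univ.filter fun S => IsMin H S) = univ.filter fun S => IsMin H S :=
    Finset.insert_eq_self.2 (by simpa using h₀)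
  rw [hi] at this
  convert this using 3
  · ext v
    simp [U, Finset.mem_sup]
  · ext v
    simp [C, Finset.mem_inf]

/-- Neighbourhood of a set. -/
def nbs (H : Finset (Sym2 (Fin k))) (Y : Finset (Fin k)) : Finset (Fin k) :=
  univ.filter fun u => ∃ y ∈ Y, s(y, u) ∈ H

lemma mem_nbs {H : Finset (Sym2 (Fin k))} {Y : Finset (Fin k)} {u : Fin k} :
    u ∈ nbs H Y ↔ ∃ y ∈ Y, s(y, u) ∈ H := by simp [nbs]

lemma nbs_mono (H : Finset (Sym2 (Fin k))) {Y Z : Finset (Fin k)} (h : Y ⊆ Z) :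
    nbs H Y ⊆ nbs H Z := by
  intro u hu
  obtain ⟨y, hy, h2⟩ := mem_nbs.1 hu
  exact mem_nbs.2 ⟨y, h hy, h2⟩

/-- `c` lies in the neighbourhood of a tight subset of `Z`. -/
def InD (H : Finset (Sym2 (Fin k))) (Z : Finset (Fin k)) (c : Fin k) : Prop :=
  ∃ Y ⊆ Z, 2 * (nbs H Y).card ≤ Y.card ∧ c ∈ nbs H Y

lemma InD_congr {H F : Finset (Sym2 (Fin k))} {Z : Finset (Fin k)}
    (h : ∀ z ∈ Z, ∀ u, s(z, u) ∈ H ↔ s(z, u) ∈ F) (c : Fin k) : InD H Z c ↔ InD F Z c := by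
  have : ∀ Y ⊆ Z, nbs H Y = nbs F Y := by
    intro Y hY
    ext u
    simp only [mem_nbs]
    exact exists_congr fun y => and_congr_right fun hy => h y (hY hy) u
  unfold InD
  refine exists_congr fun Y => and_congr_right fun hY => ?_
  rw [this Y hY]

/-- The recursion defining the greedy set of kept vertices. -/
def IsX (H : Finset (Sym2 (Fin k))) (X : Finset (Fin k)) : Prop :=
  ∀ w, w ∈ X ↔ w ∉ U H ∧ ¬ ∀ c, s(w, c) ∈ H → InD H (X.filter (· < w)) c

lemma rec_exists (Φ : Fin k → Finset (Fin k) → Prop) :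
    ∃ X : Finset (Fin k), ∀ w, w ∈ X ↔ Φ w (X.filter (· < w)) := by
  classical
  have : ∀ n : ℕ, ∃ X : Finset (Fin k), (∀ w ∈ X, w.val < n) ∧
      ∀ w, w.val < n → (w ∈ X ↔ Φ w (X.filter (· < w))) := by
    intro n
    induction n with
    | zero => exact ⟨∅, by simp, by simp⟩
    | succ n ih =>
      obtain ⟨X, h1, h2⟩ := ih
      refine ⟨X ∪ univ.filter (fun w => w.val = n ∧ Φ w X), ?_, ?_⟩
      · intro w hw
        simp only [mem_union, mem_filter, mem_univ, true_and] at hw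
        rcases hw with hw | hw
        · have := h1 w hw
          omega
        · omega
      · intro w hw
        have hf : (X ∪ univ.filter (fun w => w.val = n ∧ Φ w X)).filter (· < w)
            = X.filter (· < w) := by
          ext x
          simp only [mem_filter, mem_union, mem_univ, true_and, Fin.lt_def]
          constructor
          · rintro ⟨h | h, h'⟩
            · exact ⟨h, h'⟩
            · omega
          · rintro ⟨h, h'⟩
            exact ⟨Or.inl h, h'⟩
        rw [hf]
        by_cases hwn : w.val = n
        · have hx : X.filter (· < w) = X := by
            apply Finset.filter_true_of_mem
            intro x hx
            have := h1 x hx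
            rw [Fin.lt_def]
            omega
          have hwX : w ∉ X := fun h => by
            have := h1 w h
            omega
          rw [hx]
          simp [hwn, hwX]
        · rw [← h2 w (by omega)]
          simp [hwn]
  obtain ⟨X, -, h⟩ := this k
  exact ⟨X, fun w => h w w.isLt⟩

lemma rec_unique (Φ : Fin k → Finset (Fin k) → Prop) (X Y : Finset (Fin k))
    (hX : ∀ w, w ∈ X ↔ Φ w (X.filter (· < w))) (hY : ∀ w, w ∈ Y ↔ Φ w (Y.filter (· < w))) :
    X = Y := by
  ext w
  induction w using WellFoundedLT.induction with
  | _ w ih =>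
    have : X.filter (· < w) = Y.filter (· < w) := by
      ext x
      simp only [mem_filter]
      exact and_congr_left fun h => ih x h
    rw [hX, hY, this]

lemma exists_X (H : Finset (Sym2 (Fin k))) : ∃ X, IsX H X :=
  rec_exists fun w Z => w ∉ U H ∧ ¬ ∀ c, s(w, c) ∈ H → InD H Z c

lemma X_unique {H : Finset (Sym2 (Fin k))} {X Y : Finset (Fin k)} (hX : IsX H X) (hY : IsX H Y) :
    X = Y :=
  rec_unique (fun w Z => w ∉ U H ∧ ¬ ∀ c, s(w, c) ∈ H → InD H Z c) X Y hX hY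

/-- The kept vertices. -/
noncomputable def X (H : Finset (Sym2 (Fin k))) : Finset (Fin k) := (exists_X H).choose

lemma X_spec (H : Finset (Sym2 (Fin k))) : IsX H (X H) := (exists_X H).choose_spec

lemma X_not_U {H : Finset (Sym2 (Fin k))} {w : Fin k} (h : w ∈ X H) : w ∉ U H :=
  ((X_spec H w).1 h).1

lemma X_indep (H : Finset (Sym2 (Fin k))) (Y : Finset (Fin k)) :
    Y ⊆ X H → Y.card ≤ 2 * (nbs H Y).card := by
  induction Y using Finset.induction_on_max with
  | empty => simp
  | insert w Y hlt ih =>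
    intro hs
    have hwY : w ∉ Y := fun h => lt_irrefl _ (hlt w h)
    have hY : Y ⊆ X H := (subset_insert _ _).trans hs
    have ih := ih hY
    by_contra hcon
    rw [card_insert_of_notMem hwY] at hcon
    have hm := nbs_mono H (subset_insert w Y)
    have hcard := card_le_card hm
    have heq : nbs H Y = nbs H (insert w Y) := eq_of_subset_of_card_le hm (by omega)
    apply ((X_spec H w).1 (hs (mem_insert_self _ _))).2
    intro c hc
    refine ⟨Y, ?_, by omega, ?_⟩
    · intro y hy
      exact mem_filter.2 ⟨hY hy, hlt y hy⟩
    · rw [heq]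
      exact mem_nbs.2 ⟨w, mem_insert_self _ _, hc⟩

open Classical in
/-- The core map. -/
noncomputable def core (H : Finset (Sym2 (Fin k))) : Finset (Sym2 (Fin k)) :=
  H.filter fun e => ∀ v ∈ e, v ∈ U H ∪ X H

lemma mem_core {H : Finset (Sym2 (Fin k))} {a b : Fin k} :
    s(a, b) ∈ core H ↔ s(a, b) ∈ H ∧ a ∈ U H ∪ X H ∧ b ∈ U H ∪ X H := by
  simp only [core, mem_filter, Sym2.mem_iff]
  simp only [forall_eq_or_imp, forall_eq]

lemma core_sub (H : Finset (Sym2 (Fin k))) : core H ⊆ H := filter_subset _ _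

lemma core_nb {H : Finset (Sym2 (Fin k))} {x : Fin k} (hx : x ∈ X H) (u : Fin k) :
    s(x, u) ∈ H ↔ s(x, u) ∈ core H := by
  rw [mem_core]
  constructor
  · intro h
    exact ⟨h, mem_union_right _ hx,
      mem_union_left _ (C_sub_U _ (nb_mem_C (X_not_U hx) h))⟩
  · exact fun h => h.1

/-- Neighbourhoods of tight sets lie in every minimum cover of the core. -/
lemma tight {H : Finset (Sym2 (Fin k))} {S : Finset (Fin k)} (hS : IsMin (core H) S) {c : Fin k}
    (hc : InD H (X H) c) : c ∈ S := by
  obtain ⟨Y, hYX, ht, hcY⟩ := hc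
  set A := nbs H Y with hA
  have hsub : nbs H (Y \ S) ⊆ A ∩ S := by
    intro u hu
    refine mem_inter.2 ⟨nbs_mono H sdiff_subset hu, ?_⟩
    obtain ⟨y, hy, hyu⟩ := mem_nbs.1 hu
    rw [mem_sdiff] at hy
    rcases (cover_iff _ _).1 hS.1 _ _ ((core_nb (hYX hy.1) u).1 hyu) with h | h
    · exact absurd h hy.2
    · exact h
  have h1 := X_indep H (Y \ S) (sdiff_subset.trans hYX)
  have h2 := card_le_card hsub
  have hcov : IsCover (core H) ((S \ Y) ∪ A) := by
    rw [cover_iff]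
    intro a b hab
    have h := core_sub H hab
    have h' : s(b, a) ∈ H := by rwa [Sym2.eq_swap]
    have k1 : a ∈ Y → b ∈ A := fun ha => mem_nbs.2 ⟨a, ha, h⟩
    have k2 : b ∈ Y → a ∈ A := fun hb => mem_nbs.2 ⟨b, hb, h'⟩
    have k3 := (cover_iff _ _).1 hS.1 _ _ hab
    simp only [mem_union, mem_sdiff]
    tauto
  have h3 := vc_le hcov
  have hsub2 : (S \ Y) ∪ A ⊆ ((S \ Y) ∪ (A ∩ Y)) ∪ (A \ Y) := by
    intro a
    simp only [mem_union, mem_sdiff, mem_inter]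
    tauto
  have hsub3 : (S \ Y) ∪ A ⊆ (S \ Y) ∪ (A \ S) ∪ (A ∩ S ∩ Y) := by
    intro a
    simp only [mem_union, mem_sdiff, mem_inter]
    tauto
  have hAY : A ∩ Y = ∅ := by
    ext a
    simp only [mem_inter, notMem_empty, iff_false, not_and]
    intro ha hy
    obtain ⟨y, hy', hya⟩ := mem_nbs.1 ha
    exact X_not_U (hYX hy) (C_sub_U _ (nb_mem_C (X_not_U (hYX hy')) hya))
  have hAY2 : A ∩ S ∩ Y = ∅ := by
    rw [← subset_empty, ← hAY]
    intro a
    simp only [mem_inter]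
    tauto
  have h4 := card_le_card hsub3
  rw [hAY2, union_empty] at h4
  have h5 := card_union_le (S \ Y) (A \ S)
  have h6 := card_inter_add_card_sdiff S Y
  have h7 := card_inter_add_card_sdiff Y S
  have h8 := card_inter_add_card_sdiff A S
  have h9 : (Y ∩ S).card = (S ∩ Y).card := by rw [inter_comm]
  have h10 := hS.2
  have h11 : (A \ S).card = 0 := by omega
  by_contra hn
  rw [card_eq_zero] at h11
  have : c ∈ A \ S := mem_sdiff.2 ⟨hcY, hn⟩
  simp [h11] at this

lemma InD_mono {H : Finset (Sym2 (Fin k))} {Z Z' : Finset (Fin k)} (h : Z ⊆ Z') {c : Fin k}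
    (hc : InD H Z c) : InD H Z' c := by
  obtain ⟨Y, h1, h2⟩ := hc
  exact ⟨Y, h1.trans h, h2⟩

lemma missing {H : Finset (Sym2 (Fin k))} {w c : Fin k} (hw : w ∉ U H ∪ X H)
    (h : s(w, c) ∈ H) : InD H ((X H).filter (· < w)) c := by
  rw [mem_union, not_or] at hw
  have := (X_spec H w).not.1 hw.2
  by_contra hn
  exact this ⟨hw.1, fun h' => hn (h' c h)⟩

lemma core_cover {H : Finset (Sym2 (Fin k))} (S : Finset (Fin k)) (hS : IsMin (core H) S) :
    IsCover H S := by
  rw [cover_iff]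
  intro a b hab
  by_cases ha : a ∈ U H ∪ X H
  · by_cases hb : b ∈ U H ∪ X H
    · exact (cover_iff _ _).1 hS.1 _ _ (mem_core.2 ⟨hab, ha, hb⟩)
    · left
      rw [Sym2.eq_swap] at hab
      exact tight hS (InD_mono (filter_subset _ _) (missing hb hab))
  · right
    exact tight hS (InD_mono (filter_subset _ _) (missing ha hab))

lemma isCore (H : Finset (Sym2 (Fin k))) : IsCore (core H) H :=
  ⟨⟨U H ∪ X H, fun e => by simp only [core, mem_filter]⟩,
    fun S h1 h2 => core_cover S ⟨h1, h2⟩⟩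

lemma U_congr {F H : Finset (Sym2 (Fin k))} (h : ∀ S, IsMin F S ↔ IsMin H S) : U F = U H := by
  ext v
  simp only [mem_U, h]

lemma C_congr {F H : Finset (Sym2 (Fin k))} (h : ∀ S, IsMin F S ↔ IsMin H S) : C F = C H := by
  ext v
  simp only [mem_C, h]

lemma core_min (H : Finset (Sym2 (Fin k))) (S) : IsMin (core H) S ↔ IsMin H S :=
  min_iff (core_sub H) core_cover S

lemma nonIsolated_core (H : Finset (Sym2 (Fin k))) : nonIsolated (core H) = U H ∪ X H := by
  ext v
  constructor
  · intro h
    obtain ⟨u, hu⟩ := mem_nonIsolated.1 h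
    exact (mem_core.1 hu).2.1
  · intro h
    rcases mem_union.1 h with h | h
    · rw [← U_congr (core_min H)] at h
      exact U_sub_nonIsolated _ h
    · have h2 := ((X_spec H v).1 h).2
      push Not at h2
      obtain ⟨c, hc, -⟩ := h2
      exact mem_nonIsolated.2 ⟨c, (core_nb h c).1 hc⟩

lemma X_eq (H : Finset (Sym2 (Fin k))) : X H = nonIsolated (core H) \ U (core H) := by
  rw [nonIsolated_core, U_congr (core_min H)]
  ext v
  have := @X_not_U _ H v
  simp only [mem_sdiff, mem_union]
  tauto

lemma vc_core (H : Finset (Sym2 (Fin k))) : vc (core H) = vc H := by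
  obtain ⟨S, hS⟩ := exists_min H
  rw [← hS.2, ← ((core_min H S).2 hS).2]

lemma size (H : Finset (Sym2 (Fin k))) : (nonIsolated (core H)).card ≤ 3 * vc (core H) := by
  rw [nonIsolated_core, vc_core]
  have h1 := card_union_le (U H) (X H)
  have h2 := X_indep H (X H) subset_rfl
  have h3 : nbs H (X H) ⊆ C H := by
    intro u hu
    obtain ⟨x, hx, hxu⟩ := mem_nbs.1 hu
    exact nb_mem_C (X_not_U hx) hxu
  have h4 := card_le_card h3
  have h5 := U_add_C H
  have h6 := card_le_card (C_sub_U H)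
  omega

open Classical in
/-- The admissible extra edges. -/
noncomputable def Est (F : Finset (Sym2 (Fin k))) : Finset (Sym2 (Fin k)) :=
  univ.filter fun e => ∃ c w, e = s(c, w) ∧ w ∉ nonIsolated F ∧
    InD F ((nonIsolated F \ U F).filter (· < w)) c

lemma mem_Est {F : Finset (Sym2 (Fin k))} {e : Sym2 (Fin k)} :
    e ∈ Est F ↔ ∃ c w, e = s(c, w) ∧ w ∉ nonIsolated F ∧
    InD F ((nonIsolated F \ U F).filter (· < w)) c := by
  simp [Est]

lemma InD_nonIsolated {F : Finset (Sym2 (Fin k))} {Z : Finset (Fin k)} {c : Fin k}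
    (h : InD F Z c) : c ∈ nonIsolated F := by
  obtain ⟨Y, -, -, h⟩ := h
  obtain ⟨y, -, hy⟩ := mem_nbs.1 h
  exact mem_nonIsolated.2 ⟨y, by rwa [Sym2.eq_swap]⟩

lemma InD_core {H : Finset (Sym2 (Fin k))} {Z : Finset (Fin k)} (hZ : Z ⊆ X H) (c : Fin k) :
    InD H Z c ↔ InD (core H) Z c :=
  InD_congr (fun _ hz u => core_nb (hZ hz) u) c

lemma missing_Est {H : Finset (Sym2 (Fin k))} {w c : Fin k} (hw : w ∉ U H ∪ X H)
    (h : s(w, c) ∈ H) : s(c, w) ∈ Est (core H) := by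
  refine mem_Est.2 ⟨c, w, rfl, by rwa [nonIsolated_core], ?_⟩
  rw [← X_eq, ← InD_core (filter_subset _ _)]
  exact missing hw h

lemma fiber_mp (H : Finset (Sym2 (Fin k))) :
    ∃ E ⊆ Est (core H), Disjoint (core H) E ∧ H = core H ∪ E := by
  refine ⟨H \ core H, ?_, disjoint_sdiff, (union_sdiff_of_subset (core_sub H)).symm⟩
  intro e
  induction e using Sym2.ind with
  | _ a b =>
    intro he
    rw [mem_sdiff] at he
    by_cases ha : a ∈ U H ∪ X H
    · by_cases hb : b ∈ U H ∪ X H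
      · exact absurd (mem_core.2 ⟨he.1, ha, hb⟩) he.2
      · exact missing_Est hb (by rw [Sym2.eq_swap]; exact he.1)
    · rw [Sym2.eq_swap]
      exact missing_Est ha he.1

lemma fiber_mpr (H₀ E : Finset (Sym2 (Fin k))) (hE : E ⊆ Est (core H₀)) :
    core (core H₀ ∪ E) = core H₀ := by
  set F := core H₀ with hF
  set H := F ∪ E with hH
  have hFH : F ⊆ H := subset_union_left
  -- an edge of `E` seen from a vertex
  have hEe : ∀ a b, s(a, b) ∈ E → b ∈ nonIsolated F →
      a ∉ nonIsolated F ∧ InD F ((X H₀).filter (· < a)) b := by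
    intro a b hab hb
    obtain ⟨c, w, he, hw, hc⟩ := mem_Est.1 (hE hab)
    rw [← X_eq] at hc
    rcases Sym2.eq_iff.1 he with ⟨rfl, rfl⟩ | ⟨rfl, rfl⟩
    · exact absurd hb hw
    · exact ⟨hw, hc⟩
  have hEn : ∀ a b, s(a, b) ∈ E → a ∉ nonIsolated F → b ∈ nonIsolated F := by
    intro a b hab ha
    obtain ⟨c, w, he, hw, hc⟩ := mem_Est.1 (hE hab)
    rcases Sym2.eq_iff.1 he with ⟨rfl, rfl⟩ | ⟨rfl, rfl⟩
    · exact absurd (InD_nonIsolated hc) ha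
    · exact InD_nonIsolated hc
  have hDC : ∀ Z ⊆ X H₀, ∀ c, InD F Z c → c ∈ C F := by
    intro Z hZ c hc
    obtain ⟨Y, hY, -, h⟩ := hc
    obtain ⟨y, hy, hyc⟩ := mem_nbs.1 h
    rw [hF, C_congr (core_min H₀)]
    exact nb_mem_C (X_not_U (hZ (hY hy))) (core_sub _ hyc)
  have hmin : ∀ S, IsMin F S ↔ IsMin H S := by
    apply min_iff hFH
    intro S hS
    rw [cover_iff]
    intro a b hab
    rcases mem_union.1 hab with h | h
    · exact (cover_iff _ _).1 hS.1 _ _ h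
    · by_cases hb : b ∈ nonIsolated F
      · exact Or.inr (mem_C.1 (hDC _ (filter_subset _ _) _ (hEe a b h hb).2) S hS)
      · have h' : s(b, a) ∈ E := by rwa [Sym2.eq_swap]
        have ha := hEn b a h' hb
        exact Or.inl (mem_C.1 (hDC _ (filter_subset _ _) _ (hEe b a h' ha).2) S hS)
  have hU : U H = U H₀ := (U_congr hmin).symm.trans (U_congr (core_min H₀))
  have hUF : U F = U H₀ := U_congr (core_min H₀)
  have hnon : nonIsolated F = U H₀ ∪ X H₀ := nonIsolated_core H₀
  have hnb : ∀ x ∈ X H₀, ∀ u, s(x, u) ∈ H ↔ s(x, u) ∈ F := by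
    intro x hx u
    refine ⟨fun h => ?_, fun h => hFH h⟩
    rcases mem_union.1 h with h | h
    · exact h
    · exfalso
      have hxn : x ∈ nonIsolated F := by rw [hnon]; exact mem_union_right _ hx
      have h2 := (hEe u x (by rwa [Sym2.eq_swap]) hxn).2
      have h3 := C_sub_U _ (hDC _ (filter_subset _ _) _ h2)
      rw [hUF] at h3
      exact X_not_U hx h3
  have hX : IsX H (X H₀) := by
    intro w
    have hD : ∀ c, InD H ((X H₀).filter (· < w)) c ↔ InD F ((X H₀).filter (· < w)) c :=
      InD_congr fun z hz u => hnb z (mem_filter.1 hz).1 u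
    have hD0 : ∀ c, InD H₀ ((X H₀).filter (· < w)) c ↔ InD F ((X H₀).filter (· < w)) c :=
      InD_core (filter_subset _ _)
    rw [hU]
    constructor
    · intro hw
      refine ⟨X_not_U hw, fun h => ((X_spec H₀ w).1 hw).2 fun c hc => ?_⟩
      rw [hD0, ← hD]
      exact h c (hFH ((core_nb hw c).1 hc))
    · rintro ⟨hwU, hn⟩
      by_contra hwX
      apply hn
      intro c hc
      have hwn : w ∉ nonIsolated F := by
        rw [hnon, mem_union]
        tauto
      rcases mem_union.1 hc with h | h
      · exact absurd (mem_nonIsolated.2 ⟨c, h⟩) hwn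
      · rw [hD]
        exact (hEe w c h (hEn w c h hwn)).2
  have hXX : X H = X H₀ := X_unique (X_spec H) hX
  ext e
  induction e using Sym2.ind with
  | _ a b =>
    rw [mem_core, hU, hXX, ← hnon]
    constructor
    · rintro ⟨h, ha, hb⟩
      rcases mem_union.1 h with h | h
      · exact h
      · exact absurd ha (hEe a b h hb).1
    · intro h
      exact ⟨hFH h, mem_nonIsolated.2 ⟨b, h⟩,
        mem_nonIsolated.2 ⟨a, by rwa [Sym2.eq_swap]⟩⟩

end CoreMap

/-- Lemma 5.6: there is a map `core` sending every graph `H` on `[k]`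
to one of its cores such that for every `F` in the image of `core` we have
`|V(E(F))| ≤ 3·vc(F)`, and there is an edge set `E*_F ⊆ V(E(F)) × ([k] ∖ V(E(F)))` such
that for every graph `H`, `core H = F` iff `E(H) = E(F) ⊔ E` for some `E ⊆ E*_F`. -/
theorem exists_core_map (k : ℕ) :
    ∃ core : Finset (Sym2 (Fin k)) → Finset (Sym2 (Fin k)),
      (∀ H, IsGraph H → IsCore (core H) H) ∧
      ∀ F, (∃ H, IsGraph H ∧ core H = F) →
        (nonIsolated F).card ≤ 3 * vc F ∧
        ∃ Estar : Finset (Sym2 (Fin k)),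
          (∀ e ∈ Estar, ∃ u v, e = s(u, v) ∧ u ∈ nonIsolated F ∧ v ∉ nonIsolated F) ∧
          ∀ H, IsGraph H → (core H = F ↔ ∃ E ⊆ Estar, Disjoint F E ∧ H = F ∪ E) := by
  refine ⟨CoreMap.core, fun H _ => CoreMap.isCore H, ?_⟩
  rintro F ⟨H₀, -, rfl⟩
  refine ⟨CoreMap.size H₀, CoreMap.Est (CoreMap.core H₀), ?_, ?_⟩
  · intro e he
    obtain ⟨c, w, h1, h2, h3⟩ := CoreMap.mem_Est.1 he
    exact ⟨c, w, h1, CoreMap.InD_nonIsolated h3, h2⟩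
  · intro H _
    constructor
    · intro h
      rw [← h]
      exact CoreMap.fiber_mp H
    · rintro ⟨E, hE, -, rfl⟩
      exact CoreMap.fiber_mpr H₀ E hE
end

section
/- For every graph H on vertex set [k], every core F of H, and every edge e ∈ C([k],2): F is in the e-boundary if and only if H is in the e-boundary; that is, vc(F ∪ {e}) > vc(F) if and only if vc(H ∪ {e}) > vc(H). -/
theorem vc_le_of_cover {k : ℕ} {H : Finset (Sym2 (Fin k))} {S : Finset (Fin k)}
    (h : IsCover H S) : vc H ≤ S.card :=
  Nat.sInf_le ⟨S, rfl, h⟩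

theorem exists_min_cover {k : ℕ} (H : Finset (Sym2 (Fin k))) :
    ∃ S : Finset (Fin k), S.card = vc H ∧ IsCover H S := by
  have hne : {m | ∃ S : Finset (Fin k), S.card = m ∧ IsCover H S}.Nonempty := by
    refine ⟨_, Finset.univ, rfl, ?_⟩
    intro e _
    induction e using Sym2.ind with
    | _ x y => exact ⟨x, Finset.mem_univ _, Sym2.mem_mk_left x y⟩
  exact Nat.sInf_mem hne

theorem isCover_mono {k : ℕ} {F H : Finset (Sym2 (Fin k))} {S : Finset (Fin k)}
    (hFH : F ⊆ H) (h : IsCover H S) : IsCover F S :=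
  fun e he => h e (hFH he)

theorem vc_mono {k : ℕ} {F H : Finset (Sym2 (Fin k))} (hFH : F ⊆ H) : vc F ≤ vc H := by
  obtain ⟨S, hS, hc⟩ := exists_min_cover H
  exact hS ▸ vc_le_of_cover (isCover_mono hFH hc)

/-- Proposition 5.7: for every graph `H` on `[k]`, every core `F` of
`H` and every edge `e`: `F` is in the `e`-boundary iff `H` is, i.e.
`vc(F ∪ {e}) > vc(F)` iff `vc(H ∪ {e}) > vc(H)`. -/
theorem core_boundary (k : ℕ) (H F : Finset (Sym2 (Fin k))) (e : Sym2 (Fin k))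
    (hH : IsGraph H) (he : ¬ e.IsDiag) (hF : IsCore F H) :
    vc F < vc (insert e F) ↔ vc H < vc (insert e H) := by
  obtain ⟨⟨T, hT⟩, hcore⟩ := hF
  have hFH : F ⊆ H := fun x hx => ((hT x).1 hx).1
  have hvc : vc F = vc H := by
    apply le_antisymm (vc_mono hFH)
    obtain ⟨S, hS, hc⟩ := exists_min_cover F
    exact hS ▸ vc_le_of_cover (hcore S hc hS)
  constructor
  · intro h
    rw [← hvc]
    exact h.trans_le (vc_mono (Finset.insert_subset_insert e hFH))
  · intro h
    by_contra hn
    obtain ⟨S, hS, hc⟩ := exists_min_cover (insert e F)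
    have hcF : IsCover F S := isCover_mono (Finset.subset_insert e F) hc
    have hle := vc_le_of_cover hcF
    have hcH : IsCover H S := hcore S hcF (by omega)
    have hcI : IsCover (insert e H) S := by
      intro x hx
      rcases Finset.mem_insert.1 hx with rfl | hx
      · exact hc _ (Finset.mem_insert_self _ _)
      · exact hcH x hx
    have := vc_le_of_cover hcI
    omega
end
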